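/- Let T and T′ be increasing tableaux of type B. Then the row words of T and T′ are weakly K-Knuth equivalent if and only if T and T′ are jeu de taquin equivalent for the poset Δ. -/

import Mathlib

open Classical

noncomputable section

/-- A straight shape in a poset: a finite lower order ideal, given as a `Finset`. -/
def StraightShape {L : Type} [PartialOrder L] (lam : Finset L) : Prop :=
  ∀ a ∈ lam, ∀ b : L, b ≤ a → b ∈ lam

/-- The shape (set of boxes) of a partially defined tableau. -/
def shapeOf {L : Type} {V : Type} (T : L → Option V) : Set L := {α | T α ≠ none}

/-- `lam ⊆ nu` is a pair of straight shapes, defining the skew shape `nu / lam`. -/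
def IsSkewPair {L : Type} [PartialOrder L] (lam nu : Finset L) : Prop :=
  StraightShape lam ∧ StraightShape nu ∧ lam ⊆ nu

/-- `T` is defined on a skew shape `nu / lam`. -/
def HasSkewShape {L : Type} [PartialOrder L] (T : L → Option ℤ) : Prop :=
  ∃ lam nu : Finset L, IsSkewPair lam nu ∧ shapeOf T = (nu : Set L) \ (lam : Set L)

/-- `T` is strictly increasing along the partial order. -/
def Increasing {L : Type} [PartialOrder L] (T : L → Option ℤ) : Prop :=
  ∀ a b : L, a < b → ∀ x y : ℤ, T a = some x → T b = some y → x < y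

/-- An increasing tableau of skew shape. -/
def IncreasingSkewTableau {L : Type} [PartialOrder L] (T : L → Option ℤ) : Prop :=
  HasSkewShape T ∧ Increasing T

/-- Two boxes are neighbors if one covers the other. -/
def Neighbor {L : Type} [PartialOrder L] (a b : L) : Prop := a ⋖ b ∨ b ⋖ a

/-- The swap operation `swap_{s,s'}`. -/
def swapVal {L : Type} [PartialOrder L] {V : Type} (s s' : V) (T : L → Option V) :
    L → Option V := fun α =>
  if T α = some s ∧ ∃ β, Neighbor α β ∧ T β = some s' then some s'
  else if T α = some s' ∧ ∃ β, Neighbor α β ∧ T β = some s then some s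
  else T α

/-- Integer values extended with a dot `•`. -/
abbrev ZDot : Type := ℤ ⊕ Unit

def toDotted {L : Type} (T : L → Option ℤ) : L → Option ZDot := fun α => (T α).map Sum.inl

/-- Place a dot in every box of `C`. -/
def addDots {L : Type} (C : Finset L) (T : L → Option ZDot) : L → Option ZDot := fun α =>
  if α ∈ C then some (Sum.inr ()) else T α

/-- Restrict a dotted tableau to its integer-valued boxes. -/
def restrictInt {L : Type} (T : L → Option ZDot) : L → Option ℤ := fun α =>
  (T α).bind (Sum.elim some fun _ => none)

/-- Apply `swap_{a,•}, swap_{a+1,•}, …, swap_{a+n-1,•}` in this (increasing) order. -/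
def swapUp {L : Type} [PartialOrder L] (a : ℤ) : ℕ → (L → Option ZDot) → (L → Option ZDot)
  | 0, T => T
  | n + 1, T => swapVal (Sum.inl (a + n)) (Sum.inr ()) (swapUp a n T)

/-- Apply `swap_{b,•}, swap_{b-1,•}, …, swap_{b-n+1,•}` in this (decreasing) order. -/
def swapDown {L : Type} [PartialOrder L] (b : ℤ) : ℕ → (L → Option ZDot) → (L → Option ZDot)
  | 0, T => T
  | n + 1, T => swapVal (Sum.inl (b - n)) (Sum.inr ()) (swapDown b n T)

/-- All values of `T` lie in the interval `[a, b]`. -/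
def ValuesIn {L : Type} (T : L → Option ℤ) (a b : ℤ) : Prop :=
  ∀ (α : L) (x : ℤ), T α = some x → a ≤ x ∧ x ≤ b

/-- `T'` is obtained from `T` by a single forward jeu de taquin slide `jdt_C`,
starting from a set `C` of maximal boxes of the inner shape. -/
def IsForwardSlide {L : Type} [PartialOrder L] (T T' : L → Option ℤ) : Prop :=
  ∃ (lam nu C : Finset L) (a b : ℤ),
    IsSkewPair lam nu ∧ shapeOf T = (nu : Set L) \ (lam : Set L) ∧ ValuesIn T a b ∧
    (∀ c ∈ C, c ∈ lam ∧ ∀ d ∈ lam, ¬ c < d) ∧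
    T' = restrictInt (swapUp a (b - a + 1).toNat (addDots C (toDotted T)))

/-- `T'` is obtained from `T` by a single reverse jeu de taquin slide,
starting from a set `C` of minimal boxes of the complement of the outer shape. -/
def IsReverseSlide {L : Type} [PartialOrder L] (T T' : L → Option ℤ) : Prop :=
  ∃ (lam nu C : Finset L) (a b : ℤ),
    IsSkewPair lam nu ∧ shapeOf T = (nu : Set L) \ (lam : Set L) ∧ ValuesIn T a b ∧
    (∀ c ∈ C, c ∉ nu ∧ ∀ d : L, d ∉ nu → ¬ d < c) ∧
    T' = restrictInt (swapDown b (b - a + 1).toNat (addDots C (toDotted T)))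

/-- Jeu de taquin equivalence: a finite sequence of forward and reverse slides. -/
def JdtEquiv {L : Type} [PartialOrder L] (T T' : L → Option ℤ) : Prop :=
  Relation.ReflTransGen (fun A B => IsForwardSlide A B ∨ IsReverseSlide A B) T T'

/-- `T` is defined on a straight shape. -/
def HasStraightShape {L : Type} [PartialOrder L] (T : L → Option ℤ) : Prop :=
  ∃ lam : Finset L, StraightShape lam ∧ shapeOf T = (lam : Set L)

/-- `U` is a rectification of `T`: a straight-shape tableau obtained by forward slides. -/
def RectifiesTo {L : Type} [PartialOrder L] (T U : L → Option ℤ) : Prop :=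
  Relation.ReflTransGen IsForwardSlide T U ∧ HasStraightShape U

/-- Unique rectification target. -/
def IsURT {L : Type} [PartialOrder L] (U : L → Option ℤ) : Prop :=
  HasStraightShape U ∧ Increasing U ∧
    ∀ T : L → Option ℤ, IncreasingSkewTableau T → RectifiesTo T U →
      ∀ U' : L → Option ℤ, RectifiesTo T U' → U' = U

/-- The minimal increasing tableau of a shape `θ`: each box `α` receives the maximal
cardinality of a totally ordered subset of `θ` having `α` as its maximal element. -/
def minTab {L : Type} [PartialOrder L] (θ : Finset L) : L → Option ℤ := fun α =>
  if α ∈ θ then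
    some ((sSup {n : ℕ | ∃ s : Finset L, (s : Set L) ⊆ (θ : Set L) ∧
      (∀ a ∈ s, ∀ b ∈ s, a ≤ b ∨ b ≤ a) ∧ α ∈ s ∧ (∀ a ∈ s, a ≤ α) ∧ s.card = n} : ℕ) : ℤ)
  else none

/-- A unique rectification poset. -/
def IsURP (L : Type) [PartialOrder L] : Prop :=
  ∀ lam : Finset L, StraightShape lam → IsURT (minTab lam)

/-- The structure constant `c^ν_{λ,μ}`: the number of increasing tableaux of
shape `ν/λ` that have the minimal increasing tableau `M_μ` as a rectification. -/
def ccoef {L : Type} [PartialOrder L] (lam mu nu : Finset L) : ℕ :=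
  Set.ncard {T : L → Option ℤ | Increasing T ∧ shapeOf T = (nu : Set L) \ (lam : Set L) ∧
    RectifiesTo T (minTab mu)}

/-- The basic weak K-Knuth relations: the K-Knuth relations together with
interchanging the first two letters of a word. -/
inductive WKKnuthStep : List ℤ → List ℤ → Prop
  | dup (u v : List ℤ) (a : ℤ) : WKKnuthStep (u ++ [a, a] ++ v) (u ++ [a] ++ v)
  | aba (u v : List ℤ) (a b : ℤ) : WKKnuthStep (u ++ [a, b, a] ++ v) (u ++ [b, a, b] ++ v)
  | acb (u v : List ℤ) (a b c : ℤ) (h1 : b < a) (h2 : a < c) :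
      WKKnuthStep (u ++ [a, b, c] ++ v) (u ++ [a, c, b] ++ v)
  | bac (u v : List ℤ) (a b c : ℤ) (h1 : a < c) (h2 : c < b) :
      WKKnuthStep (u ++ [a, b, c] ++ v) (u ++ [b, a, c] ++ v)
  | front (u : List ℤ) (a b : ℤ) : WKKnuthStep (a :: b :: u) (b :: a :: u)

/-- Weak K-Knuth equivalence. -/
def WKKnuth : List ℤ → List ℤ → Prop := Relation.EqvGen WKKnuthStep

/-- The row word of a tableau on boxes in `ℕ × ℕ`: entries are read row by row
from left to right, starting with the bottom row; `rmax` and `cmax` are bounds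
enclosing the shape. -/
def rowWord (T : ℕ × ℕ → Option ℤ) (rmax cmax : ℕ) : List ℤ :=
  (List.range (rmax + 1)).reverse.flatMap fun r =>
    (List.range (cmax + 1)).filterMap fun c => T (r, c)

/-- The shape of `T` is contained in the rectangle `[0, rmax] × [0, cmax]`. -/
def BoundedBy (T : ℕ × ℕ → Option ℤ) (rmax cmax : ℕ) : Prop :=
  ∀ p : ℕ × ℕ, T p ≠ none → p.1 ≤ rmax ∧ p.2 ≤ cmax

/-- The poset `Δ = {[r,c] ∈ ℕ×ℕ : r ≤ c}` of shifted boxes, ordered componentwise. -/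
abbrev ShiftedBox : Type := {p : ℕ × ℕ // p.1 ≤ p.2}

/-- Extend a tableau on `Δ` by `none` to all of `ℕ × ℕ`. -/
def extendToPlane (T : ShiftedBox → Option ℤ) : ℕ × ℕ → Option ℤ := fun p =>
  if h : p.1 ≤ p.2 then T ⟨p, h⟩ else none

/-- The row word of a tableau of type B. -/
def rowWordB (T : ShiftedBox → Option ℤ) (rmax cmax : ℕ) : List ℤ :=
  rowWord (extendToPlane T) rmax cmax

/-! ### The plactic-type monoid and its right action on weak classes -/

theorem WKKnuth.append_right {x y : List ℤ} (h : WKKnuth x y) (v : List ℤ) :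
    WKKnuth (x ++ v) (y ++ v) := by
  induction h with
  | rel x y h =>
    apply Relation.EqvGen.rel
    cases h with
    | dup u w a => simpa using WKKnuthStep.dup u (w ++ v) a
    | aba u w a b => simpa using WKKnuthStep.aba u (w ++ v) a b
    | acb u w a b c h1 h2 => simpa using WKKnuthStep.acb u (w ++ v) a b c h1 h2
    | bac u w a b c h1 h2 => simpa using WKKnuthStep.bac u (w ++ v) a b c h1 h2
    | front u a b => simpa using WKKnuthStep.front (u ++ v) a b
  | refl x => exact Relation.EqvGen.refl _
  | symm x y _ ih => exact Relation.EqvGen.symm _ _ ih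
  | trans x y z _ _ ih1 ih2 => exact Relation.EqvGen.trans _ _ _ ih1 ih2

/-- Two words are interchangeable in every context up to weak K-Knuth equivalence. -/
def contextSetoid : Setoid (List ℤ) where
  r x y := ∀ u v, WKKnuth (u ++ x ++ v) (u ++ y ++ v)
  iseqv :=
    { refl := fun _ _ _ => Relation.EqvGen.refl _
      symm := fun h u v => Relation.EqvGen.symm _ _ (h u v)
      trans := fun h1 h2 u v => Relation.EqvGen.trans _ _ _ (h1 u v) (h2 u v) }

/-- The monoid of words modulo interchangeability. -/
def WordMonoid : Type := Quotient contextSetoid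

/-- The class of a word in `WordMonoid`. -/
def ck (x : List ℤ) : WordMonoid := Quotient.mk contextSetoid x

instance : Monoid WordMonoid where
  mul := Quotient.map₂ (fun x y => x ++ y) (by
    intro x x' hx y y' hy u v
    have h1 := hx u (y ++ v)
    have h2 := hy (u ++ x') v
    simp only [List.append_assoc] at h1 h2 ⊢
    exact Relation.EqvGen.trans _ _ _ h1 h2)
  one := ck []
  mul_assoc := by
    rintro ⟨x⟩ ⟨y⟩ ⟨z⟩
    exact congrArg ck (List.append_assoc x y z)
  one_mul := by
    rintro ⟨x⟩
    rfl
  mul_one := by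
    rintro ⟨x⟩
    exact congrArg ck (List.append_nil x)

theorem ck_append (x y : List ℤ) : ck (x ++ y) = ck x * ck y := rfl

theorem ck_nil : ck [] = 1 := rfl

/-- The class of a letter. -/
def lt (a : ℤ) : WordMonoid := ck [a]

theorem ck_cons (a : ℤ) (x : List ℤ) : ck (a :: x) = lt a * ck x := rfl

/-- The set of weak K-Knuth classes. -/
def WeakClass : Type := Quotient (Relation.EqvGen.setoid WKKnuthStep)

/-- The weak class of a word. -/
def wk (x : List ℤ) : WeakClass := Quotient.mk (Relation.EqvGen.setoid WKKnuthStep) x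

/-- The weak class of a representative of an element of `WordMonoid`. -/
def wcl : WordMonoid → WeakClass :=
  Quotient.lift (fun x => wk x) (fun x y h => Quotient.sound (by
    have h' : WKKnuth ([] ++ x ++ []) ([] ++ y ++ []) := h [] []
    rw [List.append_nil, List.append_nil] at h'
    exact h'))

theorem wcl_ck (x : List ℤ) : wcl (ck x) = wk x := rfl

theorem wk_eq_iff {x y : List ℤ} : wk x = wk y ↔ WKKnuth x y :=
  Quotient.eq (r := Relation.EqvGen.setoid WKKnuthStep)

theorem wcl_mul_right {p q : WordMonoid} (h : wcl p = wcl q) (r : WordMonoid) :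
    wcl (p * r) = wcl (q * r) := by
  induction p using Quotient.inductionOn
  induction q using Quotient.inductionOn
  induction r using Quotient.inductionOn
  rename_i x y z
  exact wk_eq_iff.2 ((wk_eq_iff.1 h).append_right z)

theorem wcl_front (a b : ℤ) (q : WordMonoid) : wcl (lt a * lt b * q) = wcl (lt b * lt a * q) := by
  induction q using Quotient.inductionOn
  rename_i x
  exact wk_eq_iff.2 (Relation.EqvGen.rel _ _ (WKKnuthStep.front x a b))

theorem lt_dup (a : ℤ) : lt a * lt a = lt a :=
  Quotient.sound fun u v => Relation.EqvGen.rel _ _ (WKKnuthStep.dup u v a)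

theorem lt_aba (a b : ℤ) : lt a * lt b * lt a = lt b * lt a * lt b :=
  Quotient.sound fun u v => Relation.EqvGen.rel _ _ (WKKnuthStep.aba u v a b)

/-- For `b < a < c`, the letters after `a` commute. -/
theorem lt_acb {a b c : ℤ} (h1 : b < a) (h2 : a < c) : lt a * lt b * lt c = lt a * lt c * lt b :=
  Quotient.sound fun u v => Relation.EqvGen.rel _ _ (WKKnuthStep.acb u v a b c h1 h2)

/-- For `a < c < b`, the letters before `c` commute. -/
theorem lt_bac {a b c : ℤ} (h1 : a < c) (h2 : c < b) : lt a * lt b * lt c = lt b * lt a * lt c :=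
  Quotient.sound fun u v => Relation.EqvGen.rel _ _ (WKKnuthStep.bac u v a b c h1 h2)

/-- A large letter moves past an increasing word followed by a letter of intermediate size. -/
theorem hook_letter (z t : ℤ) (S : List ℤ) (hS : S.Pairwise (· < ·)) (hSt : ∀ s ∈ S, s < t)
    (htz : t < z) : lt z * ck S * lt t = ck S * lt z * lt t := by
  induction S with
  | nil => simp [ck_nil]
  | cons s S ih =>
    have hS' := (List.pairwise_cons.1 hS)
    have ih' := ih hS'.2 (fun x hx => hSt x (List.mem_cons_of_mem _ hx))
    rw [ck_cons]
    have key : lt z * lt s * (ck S * lt t) = lt s * lt z * (ck S * lt t) := by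
      cases S with
      | nil =>
        rw [ck_nil, one_mul]
        exact (lt_bac (hSt s (by simp)) htz).symm
      | cons s2 S =>
        have h12 : s < s2 := hS'.1 s2 (by simp)
        have h2z : s2 < z := (hSt s2 (by simp)).trans htz
        rw [ck_cons, mul_assoc (lt s2), ← mul_assoc (lt z * lt s), ← lt_bac h12 h2z,
          mul_assoc (lt s * lt z)]
    calc lt z * (lt s * ck S) * lt t = lt z * lt s * (ck S * lt t) := by simp only [mul_assoc]
      _ = lt s * (lt z * ck S * lt t) := by rw [key]; simp only [mul_assoc]
      _ = lt s * ck S * lt z * lt t := by rw [ih']; simp only [mul_assoc]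

/-- A decreasing word moves past an increasing word followed by a letter of intermediate size. -/
theorem hook (Z S : List ℤ) (t : ℤ) (hZ : Z.Pairwise (· > ·)) (hS : S.Pairwise (· < ·))
    (hSt : ∀ s ∈ S, s < t) (htZ : ∀ z ∈ Z, t < z) :
    ck Z * ck S * lt t = ck S * ck Z * lt t := by
  induction Z using List.reverseRecOn generalizing t with
  | nil => simp [ck_nil]
  | append_singleton Z z ih =>
    rw [List.pairwise_append] at hZ
    have htz : t < z := htZ z (by simp)
    have ih' := ih z hZ.1 (fun s hs => (hSt s hs).trans htz)
      (fun w hw => hZ.2.2 w hw z (by simp))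
    have e : ck (Z ++ [z]) = ck Z * lt z := rfl
    rw [e]
    calc ck Z * lt z * ck S * lt t = ck Z * (lt z * ck S * lt t) := by simp only [mul_assoc]
      _ = (ck Z * ck S * lt z) * lt t := by rw [hook_letter z t S hS hSt htz]; simp only [mul_assoc]
      _ = ck S * (ck Z * lt z) * lt t := by rw [ih']; simp only [mul_assoc]

/-- A small letter moves past a decreasing word followed by a letter of intermediate size. -/
theorem hook_one (Z : List ℤ) (g t : ℤ) (hZ : Z.Pairwise (· > ·)) (hgt : g < t)
    (htZ : ∀ z ∈ Z, t < z) : lt g * ck Z * lt t = ck Z * lt g * lt t :=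
  (hook Z [g] t hZ (by simp) (by simpa using hgt) htZ).symm

/-- The word of an optional letter. -/
def olt (o : Option ℤ) : WordMonoid := ck o.toList

theorem olt_none : olt none = 1 := rfl

theorem olt_some (a : ℤ) : olt (some a) = lt a := rfl

/-- The word read off the first `n` cells of a row. -/
def rowList (f : ℕ → Option ℤ) (n : ℕ) : List ℤ := (List.range n).filterMap f

theorem rowList_zero (f : ℕ → Option ℤ) : rowList f 0 = [] := rfl

theorem rowList_succ (f : ℕ → Option ℤ) (n : ℕ) :
    rowList f (n + 1) = rowList f n ++ (f n).toList := by
  rw [rowList, List.range_succ, List.filterMap_append]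
  cases h : f n <;> simp [rowList, h]

theorem mem_rowList {f : ℕ → Option ℤ} {n : ℕ} {x : ℤ} :
    x ∈ rowList f n ↔ ∃ c < n, f c = some x := by
  simp [rowList]

theorem rowList_eq_nil {f : ℕ → Option ℤ} {n : ℕ} : rowList f n = [] ↔ ∀ c < n, f c = none := by
  simp [rowList]

theorem rowList_pairwise {f : ℕ → Option ℤ}
    (hf : ∀ c c' x x', c < c' → f c = some x → f c' = some x' → x < x') (n : ℕ) :
    (rowList f n).Pairwise (· < ·) := by
  induction n with
  | zero => simp [rowList_zero]
  | succ n ih =>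
    rw [rowList_succ, List.pairwise_append]
    refine ⟨ih, by cases f n <;> simp, ?_⟩
    intro a ha b hb
    obtain ⟨c, hc, hx⟩ := mem_rowList.1 ha
    exact hf c n a b hc hx (by simpa using hb)

/-! ### Comparing two versions of a row -/

/-- The class of the word read off the first `n` cells of a row. -/
def rowEl (f : ℕ → Option ℤ) (n : ℕ) : WordMonoid := ck (rowList f n)

theorem rowEl_succ (f : ℕ → Option ℤ) (n : ℕ) : rowEl f (n + 1) = rowEl f n * olt (f n) := by
  rw [rowEl, rowList_succ]; rfl

theorem rowEl_zero (f : ℕ → Option ℤ) : rowEl f 0 = 1 := rfl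

theorem rowEl_eq_one {f : ℕ → Option ℤ} {n : ℕ} (h : rowList f n = []) : rowEl f n = 1 := by
  rw [rowEl, h]; rfl

theorem rowList_nil_mono {f : ℕ → Option ℤ} {m n : ℕ} (hmn : m ≤ n) (h : rowList f n = []) :
    rowList f m = [] :=
  rowList_eq_nil.2 fun c hc => rowList_eq_nil.1 h c (hc.trans_le hmn)

theorem rowList_succ_nil {f : ℕ → Option ℤ} {n : ℕ} (h : rowList f n = []) (hn : f n = none) :
    rowList f (n + 1) = [] := by
  rw [rowList_succ, h, hn]; rfl

theorem rowList_nil_last {f : ℕ → Option ℤ} {n : ℕ} (h : rowList f (n + 1) = []) : f n = none :=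
  rowList_eq_nil.1 h n (Nat.lt_succ_self n)

/-- A row is strictly increasing. -/
def RowInc (f : ℕ → Option ℤ) : Prop :=
  ∀ c c' x x', c < c' → f c = some x → f c' = some x' → x < x'

theorem wcl_insert {p q : WordMonoid} {y : ℤ} (h : wcl p = wcl (q * lt y)) :
    wcl p = wcl (p * lt y) := by
  rw [wcl_mul_right h (lt y), mul_assoc, lt_dup, h]

/-- The local configuration around a row: `X n` is the class of the part of the tableau below
the row in the first `n` columns, `col c` is column `c` of that part, `R` is the row, `F` is the
row after sliding and `A` is the row above after sliding. -/
structure RowGeom (X : ℕ → WordMonoid) (col : ℕ → List ℤ) (R F A : ℕ → Option ℤ) (r : ℕ) :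
    Prop where
  diag : X (r + 1) = 1
  peel : ∀ c, X (c + 1) = X c * ck (col c)
  col_dec : ∀ c, (col c).Pairwise (· > ·)
  col_diag : ∀ c, c ≤ r → col c = []
  R_lt : ∀ c t, R c = some t → ∀ z ∈ col c, t < z
  F_lt_next : ∀ c f, F c = some f → ∀ z ∈ col (c + 1), f < z
  F_le : ∀ c f, F c = some f → ∀ z ∈ col c, f ≤ z
  R_inc : RowInc R
  F_inc : RowInc F
  A_inc : RowInc A
  A_le_R : ∀ c a t, A c = some a → R c = some t → a ≤ t
  A_lt_F : ∀ c a f, A c = some a → F c = some f → a < f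
  A_lt_R_next : ∀ c a t, A c = some a → R (c + 1) = some t → a < t
  F_le_R_next : ∀ c f t, F c = some f → R (c + 1) = some t → f ≤ t
  col_last : ∀ c Z g Z' y, F c ≠ none → col c = Z ++ [g] → col (c + 1) = Z' ++ [y] → g < y
  A_none : ∀ c, (F c ≠ none ∨ R c ≠ none ∨ col c ≠ []) → A c = none → rowList A (c + 1) = []
  A_contig : ∀ c, A c = none → A (c + 1) ≠ none → rowList A c = []
  F_none : ∀ c, F c = none → (F (c + 1) ≠ none ∨ R (c + 1) ≠ none ∨ col (c + 1) ≠ []) →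
    rowList F (c + 1) = [] ∧ (rowList A (c + 1) = [] ∨ c + 1 = r)
  F_diag : ∀ c, c < r → F c = none
  R_diag : ∀ c, c < r → R c = none
  A_diag : ∀ c, c + 1 < r → A c = none
  A_top : r = 0 → ∀ c, A c = none
  corner : ∀ c, F c ≠ none → col (c + 1) ≠ [] → col c = [] → c = r ∧ ∃ y, col (c + 1) = [y]

namespace RowGeom

variable {X : ℕ → WordMonoid} {col : ℕ → List ℤ} {R F A : ℕ → Option ℤ} {r : ℕ}

theorem no_above (h : RowGeom X col R F A r) : RowGeom X col R F (fun _ => none) r where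
  diag := h.diag
  peel := h.peel
  col_dec := h.col_dec
  col_diag := h.col_diag
  R_lt := h.R_lt
  F_lt_next := h.F_lt_next
  F_le := h.F_le
  R_inc := h.R_inc
  F_inc := h.F_inc
  A_inc := by intro c c' x x' _ h; simp at h
  A_le_R := by simp
  A_lt_F := by simp
  A_lt_R_next := by simp
  F_le_R_next := h.F_le_R_next
  col_last := h.col_last
  A_none := by intro c _ _; simp [rowList_eq_nil]
  A_contig := by simp
  F_none := fun c h1 h2 => ⟨(h.F_none c h1 h2).1, Or.inl (by simp [rowList_eq_nil])⟩
  F_diag := h.F_diag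
  R_diag := h.R_diag
  A_diag := by simp
  A_top := by simp
  corner := h.corner

theorem row_lt {f : ℕ → Option ℤ} (hf : RowInc f) {n m : ℕ} {t : ℤ} (hn : n ≤ m)
    (h : f m = some t) : ∀ s ∈ rowList f n, s < t := by
  intro s hs
  obtain ⟨c, hc, hs⟩ := mem_rowList.1 hs
  exact hf c m s t (hc.trans_le hn) hs h

/-- Column followed by a letter moves past the row above. -/
theorem move_up (h : RowGeom X col R F A r) {c d : ℕ} {f a : ℤ} (hf : ∀ z ∈ col d, f < z)
    (ha : A c = some a) (haf : a < f) :
    ck (col d) * lt f * rowEl A c * lt a = rowEl A c * ck (col d) * lt f * lt a := by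
  have := hook (col d ++ [f]) (rowList A c) a
    (List.pairwise_append.2 ⟨h.col_dec d, by simp, by simpa using hf⟩)
    (rowList_pairwise h.A_inc c) (row_lt h.A_inc le_rfl ha) (by
      intro z hz
      rcases List.mem_append.1 hz with hz | hz
      · exact haf.trans (hf z hz)
      · simp at hz; omega)
  have e : ck (col d ++ [f]) = ck (col d) * lt f := rfl
  rw [e] at this
  rw [rowEl, this]
  simp only [mul_assoc]

/-- The class `X (c+1) · F · A` truncated at column `c`. -/
def V (X : ℕ → WordMonoid) (F A : ℕ → Option ℤ) (c : ℕ) : WordMonoid :=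
  X (c + 1) * rowEl F c * rowEl A c

theorem V_succ (h : RowGeom X col R F A r) (c : ℕ) :
    V X F A (c + 1) = V X F A c * ck (col (c + 1)) * olt (F c) * olt (A c) := by
  unfold V
  rw [h.peel (c + 1), rowEl_succ, rowEl_succ]
  cases hF : F c with
  | none =>
    by_cases hc : col (c + 1) = []
    · rw [hc]; simp only [ck_nil, olt_none, mul_one, mul_assoc]
    · obtain ⟨h1, h2⟩ := h.F_none c hF (Or.inr (Or.inr hc))
      have h3 : rowList A (c + 1) = [] := by
        rcases h2 with h2 | h2
        · exact h2
        · exact absurd (h.col_diag _ h2.le) hc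
      rw [rowEl_eq_one (rowList_nil_mono (Nat.le_succ c) h1),
        rowEl_eq_one (rowList_nil_mono (Nat.le_succ c) h3), rowList_nil_last h3]
      simp only [olt_none, mul_one]
  | some f =>
    have hk := hook (col (c + 1)) (rowList F c) f (h.col_dec _) (rowList_pairwise h.F_inc c)
      (row_lt h.F_inc le_rfl hF) (h.F_lt_next c f hF)
    change ck (col (c + 1)) * rowEl F c * lt f = rowEl F c * ck (col (c + 1)) * lt f at hk
    rw [olt_some]
    cases hA : A c with
    | none =>
      have h3 := h.A_none c (Or.inl (by simp [hF])) hA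
      rw [rowEl_eq_one (rowList_nil_mono (Nat.le_succ c) h3), olt_none]
      simp only [mul_one]
      calc _ = X (c + 1) * (ck (col (c + 1)) * rowEl F c * lt f) := by simp only [mul_assoc]
        _ = _ := by rw [hk]; simp only [mul_assoc]
    | some a =>
      have hu := h.move_up (h.F_lt_next c f hF) hA (h.A_lt_F c a f hA hF)
      rw [olt_some]
      calc _ = X (c + 1) * (ck (col (c + 1)) * rowEl F c * lt f) * rowEl A c * lt a := by
              simp only [mul_assoc]
        _ = X (c + 1) * rowEl F c * (ck (col (c + 1)) * lt f * rowEl A c * lt a) := by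
              rw [hk]; simp only [mul_assoc]
        _ = _ := by rw [hu]; simp only [mul_assoc]

/-- The last letter of column `c` is absorbed. -/
theorem absorb (h : RowGeom X col R F A r) (c : ℕ) (Z : List ℤ) (y : ℤ) (hc : col c = Z ++ [y]) :
    wcl (V X F A c) = wcl (V X F A c * lt y) := by
  induction c generalizing Z y with
  | zero => rw [h.col_diag 0 (Nat.zero_le _)] at hc; simp at hc
  | succ c ih =>
    have hne : col (c + 1) ≠ [] := by simp [hc]
    have hcol : ck (col (c + 1)) = ck Z * lt y := by rw [hc]; rfl
    have hdec := h.col_dec (c + 1)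
    rw [hc, List.pairwise_append] at hdec
    have hyZ : ∀ z ∈ Z, y < z := fun z hz => hdec.2.2 z hz y (by simp)
    cases hF : F c with
    | none =>
      obtain ⟨h1, h2⟩ := h.F_none c hF (Or.inr (Or.inr hne))
      have h3 : rowList A (c + 1) = [] := by
        rcases h2 with h2 | h2
        · exact h2
        · exact absurd (h.col_diag _ h2.le) hne
      unfold V
      rw [rowEl_eq_one h1, rowEl_eq_one h3, h.peel, hcol]
      apply wcl_insert (q := X (c + 1) * ck Z)
      simp only [mul_one, mul_assoc]
    | some f =>
      have hfy : f < y := h.F_lt_next c f hF y (by simp [hc])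
      rcases List.eq_nil_or_concat (col c) with hnil | ⟨Z', g, hg⟩
      · obtain ⟨hcr, y', hy'⟩ := h.corner c (by simp [hF]) hne hnil
        have hyy : col (c + 1) = [y] := by
          rw [hy'] at hc
          cases Z with
          | nil => rw [hy', hc]; rfl
          | cons z Z => simp at hc
        have hXr : X (c + 1) = 1 := by rw [hcr]; exact h.diag
        have hFr : rowEl F c = 1 := rowEl_eq_one (rowList_eq_nil.2 fun d hd =>
          h.F_diag d (by omega))
        have hXs : X (c + 1 + 1) = lt y := by rw [h.peel, hXr, hyy, one_mul]; rfl
        have hV : V X F A (c + 1) = lt y * lt f * rowEl A c * olt (A c) := by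
          unfold V; rw [hXs, rowEl_succ, hFr, hF, rowEl_succ, one_mul, olt_some]
          simp only [mul_assoc]
        rw [hV]
        cases hA : A c with
        | none =>
          have h3 := h.A_none c (Or.inl (by simp [hF])) hA
          rw [rowEl_eq_one (rowList_nil_mono (Nat.le_succ c) h3), olt_none]
          apply wcl_insert (q := lt f)
          have := wcl_front y f 1
          simpa using this
        | some a =>
          have haf := h.A_lt_F c a f hA hF
          rw [olt_some]
          have hA' : rowEl A c = 1 ∨ ∃ a0, a0 < a ∧ rowEl A c = lt a0 := by
            cases c with
            | zero => left; rfl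
            | succ d =>
              have : rowEl A d = 1 := rowEl_eq_one (rowList_eq_nil.2 fun e he =>
                h.A_diag e (by omega))
              rw [rowEl_succ, this, one_mul]
              cases hd : A d with
              | none => left; rfl
              | some a0 => exact Or.inr ⟨a0, h.A_inc d (d + 1) a0 a (Nat.lt_succ_self d) hd hA, rfl⟩
          rcases hA' with hA' | ⟨a0, ha0, hA'⟩
          · rw [hA']
            apply wcl_insert (q := lt f * lt a)
            have := wcl_front y f (lt a)
            rw [mul_one, this, lt_acb haf hfy]
          · rw [hA']
            apply wcl_insert (q := lt a0 * lt f * lt a)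
            calc wcl (lt y * lt f * lt a0 * lt a)
                = wcl (lt y * lt f * (lt a0 * lt a)) := by simp only [mul_assoc]
              _ = wcl (lt f * (lt y * lt a0 * lt a)) := by
                  rw [wcl_front]; simp only [mul_assoc]
              _ = wcl (lt f * lt a0 * (lt y * lt a)) := by
                  rw [← lt_bac ha0 (haf.trans hfy)]; simp only [mul_assoc]
              _ = wcl (lt a0 * (lt f * lt y * lt a)) := by
                  rw [wcl_front]; simp only [mul_assoc]
              _ = wcl (lt a0 * lt f * lt a * lt y) := by
                  rw [← lt_acb haf hfy]; simp only [mul_assoc]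
      · have hg' : col c = Z' ++ [g] := by simpa using hg
        have hgy := h.col_last c Z' g Z y (by simp [hF]) hg' hc
        have hfg : f ≤ g := h.F_le c f hF g (by simp [hg'])
        have key : ∃ q, wcl (V X F A c * ck (col (c + 1)) * lt f) = wcl (q * lt f * lt y) := by
          have e1 : wcl (V X F A c * ck (col (c + 1)) * lt f)
              = wcl (V X F A c * ck Z * (lt g * lt y * lt f)) := by
            rw [hcol, mul_assoc, wcl_mul_right (ih Z' g hg')]
            calc _ = wcl (V X F A c * (lt g * ck Z * lt y) * lt f) := by simp only [mul_assoc]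
              _ = _ := by rw [hook_one Z g y hdec.1 hgy hyZ]; simp only [mul_assoc]
          rcases hfg.lt_or_eq with hlt | heq
          · refine ⟨V X F A c * ck Z * lt g, ?_⟩
            rw [e1, ← lt_acb hlt hgy]; simp only [mul_assoc]
          · refine ⟨V X F A c * ck Z * lt y, ?_⟩
            rw [e1, ← heq, lt_aba]; simp only [mul_assoc]
        obtain ⟨q, hq⟩ := key
        rw [h.V_succ, hF, olt_some]
        cases hA : A c with
        | none =>
          rw [olt_none, mul_one]
          exact wcl_insert hq
        | some a =>
          have haf := h.A_lt_F c a f hA hF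
          rw [olt_some]
          apply wcl_insert (q := q * lt f * lt a)
          rw [wcl_mul_right hq]
          calc _ = wcl (q * (lt f * lt y * lt a)) := by simp only [mul_assoc]
            _ = _ := by rw [← lt_acb haf hfy]; simp only [mul_assoc]

/-- The letter at column `c` of the row moves past the row above. -/
theorem letter_past (h : RowGeom X col R F A r) (c : ℕ) (t : ℤ) (hF : F c = some t) :
    wcl (X (c + 1) * rowEl F c * lt t * rowEl A c) = wcl (V X F A c * lt t) := by
  induction c generalizing t with
  | zero => simp [V, rowEl_zero]
  | succ c ih =>
    by_cases hAn : rowList A (c + 1) = []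
    · unfold V; rw [rowEl_eq_one hAn]; simp only [mul_one]
    by_cases hlast : ∃ Z, col (c + 1) = Z ++ [t]
    · obtain ⟨Z, hZ⟩ := hlast
      have h1 := h.no_above.absorb (c + 1) Z t hZ
      have hn : rowEl (fun _ => none) (c + 1) = 1 :=
        rowEl_eq_one (rowList_eq_nil.2 fun _ _ => rfl)
      unfold V at h1
      rw [hn, mul_one] at h1
      rw [← h.absorb (c + 1) Z t hZ]
      exact wcl_mul_right h1.symm _
    have htc : ∀ z ∈ col (c + 1), t < z := by
      intro z hz
      rcases List.eq_nil_or_concat (col (c + 1)) with hnil | ⟨Z', g, hg⟩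
      · simp [hnil] at hz
      · have hg' : col (c + 1) = Z' ++ [g] := by simpa using hg
        have hne : t ≠ g := fun e => hlast ⟨Z', by rw [hg', e]⟩
        have hle := h.F_le (c + 1) t hF g (by simp [hg'])
        have hdec := h.col_dec (c + 1)
        rw [hg', List.pairwise_append] at hdec
        rw [hg'] at hz
        rcases List.mem_append.1 hz with hz | hz
        · have := hdec.2.2 z hz g (by simp)
          omega
        · simp at hz; omega
    cases hf : F c with
    | none =>
      obtain ⟨h1, h2⟩ := h.F_none c hf (Or.inl (by simp [hF]))
      rcases h2 with h2 | h2
      · exact absurd h2 hAn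
      · have hX : X (c + 1 + 1) = 1 := by rw [h2]; exact h.diag
        have hA' : rowEl A c = 1 := rowEl_eq_one (rowList_eq_nil.2 fun e he =>
          h.A_diag e (by omega))
        unfold V
        rw [hX, rowEl_eq_one h1, rowEl_succ, hA']
        cases A c with
        | none => simp [olt_none]
        | some a =>
          have := wcl_front t a 1
          simpa [olt_some] using this
    | some f =>
      cases hA : A c with
      | none => exact absurd (h.A_none c (Or.inl (by simp [hf])) hA) hAn
      | some a =>
        have hft : f < t := h.F_inc c (c + 1) f t (Nat.lt_succ_self c) hf hF
        have haf : a < f := h.A_lt_F c a f hA hf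
        have hk := hook (col (c + 1)) (rowList F (c + 1)) t (h.col_dec _)
          (rowList_pairwise h.F_inc _) (row_lt h.F_inc le_rfl hF) htc
        change ck (col (c + 1)) * rowEl F (c + 1) * lt t
          = rowEl F (c + 1) * ck (col (c + 1)) * lt t at hk
        have hu := h.move_up htc hA (haf.trans hft)
        rw [rowEl_succ A, hA, olt_some, h.V_succ, hf, hA, olt_some, olt_some]
        calc wcl (X (c + 1 + 1) * rowEl F (c + 1) * lt t * (rowEl A c * lt a))
            = wcl (X (c + 1) * (ck (col (c + 1)) * rowEl F (c + 1) * lt t) * rowEl A c * lt a) := by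
              rw [h.peel (c + 1)]; simp only [mul_assoc]
          _ = wcl (X (c + 1) * rowEl F c * lt f
                * (ck (col (c + 1)) * lt t * rowEl A c * lt a)) := by
              rw [hk, rowEl_succ F, hf, olt_some]; simp only [mul_assoc]
          _ = wcl (X (c + 1) * rowEl F c * lt f * rowEl A c
                * (ck (col (c + 1)) * lt t * lt a)) := by
              rw [hu]; simp only [mul_assoc]
          _ = wcl (V X F A c * (lt f * ck (col (c + 1)) * lt t) * lt a) := by
              rw [wcl_mul_right (ih f hf)]; simp only [mul_assoc]
          _ = wcl (V X F A c * ck (col (c + 1)) * (lt f * lt t * lt a)) := by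
              rw [hook_one _ f t (h.col_dec _) hft htc]; simp only [mul_assoc]
          _ = _ := by rw [← lt_acb haf hft]; simp only [mul_assoc]

end RowGeom

/-- The behaviour of a slide on a row, with `D` the set of columns visited by a dot. -/
structure RowSlide (X : ℕ → WordMonoid) (col : ℕ → List ℤ) (R F A : ℕ → Option ℤ) (r : ℕ)
    (D : ℕ → Prop) : Prop extends RowGeom X col R F A r where
  stay : ∀ c, ¬ D c → F c = R c
  fill : ∀ c t, D c → R (c + 1) = some t →
    (F c = some t ∧ D (c + 1)) ∨ ∃ Z y, F c = some y ∧ col c = Z ++ [y] ∧ y ≠ t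
  vacate : ∀ c t, D c → R c = some t →
    A c = some t ∨ ∃ d, c = d + 1 ∧ D d ∧ F d = some t
  fill_end : ∀ c, D c → R (c + 1) = none →
    F c = none ∨ ∃ Z y, F c = some y ∧ col c = Z ++ [y]
  start : ∀ c, D c → R c = none → rowList R c = [] ∧ rowList F c = []
  gap : ∀ c, R c = none → ¬ D c → (rowList R c = [] ∧ rowList F c = []) ∨ col c = []

namespace RowSlide

variable {X : ℕ → WordMonoid} {col : ℕ → List ℤ} {R F A : ℕ → Option ℤ} {r : ℕ} {D : ℕ → Prop}

/-- The intermediate row after processing `n` columns. -/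
def U (F : ℕ → Option ℤ) (D : ℕ → Prop) : ℕ → WordMonoid
  | 0 => 1
  | n + 1 => if D n then rowEl F n else rowEl F (n + 1)

/-- A column and a letter may be moved behind the part of the row above to their left. -/
theorem column_past (h : RowSlide X col R F A r D) {c : ℕ} {t : ℤ} (hR : R c = some t) :
    ∃ E, ck (col c) * lt t * rowEl A (c + 1) = rowEl A c * E := by
  have htc := h.R_lt c t hR
  cases c with
  | zero => exact ⟨_, (one_mul _).symm⟩
  | succ c =>
    cases hA : A c with
    | none =>
      by_cases ha : A (c + 1) = none
      · have h3 := h.A_none (c + 1) (Or.inr (Or.inl (by simp [hR]))) ha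
        exact ⟨_, by rw [rowEl_eq_one (rowList_nil_mono (Nat.le_succ _) h3), one_mul]⟩
      · have h3 := h.A_contig c hA ha
        exact ⟨_, by rw [rowEl_eq_one (rowList_succ_nil h3 hA), one_mul]⟩
    | some a' =>
      cases ha : A (c + 1) with
      | none =>
        have h3 := h.A_none (c + 1) (Or.inr (Or.inl (by simp [hR]))) ha
        have := rowList_nil_last (rowList_nil_mono (Nat.le_succ _) h3)
        simp [hA] at this
      | some a =>
        have hat' : a' < t := h.A_lt_R_next c a' t hA hR
        have haa : a' < a := h.A_inc c (c + 1) a' a (Nat.lt_succ_self c) hA ha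
        have hat : a ≤ t := h.A_le_R (c + 1) a t ha hR
        have hu := h.move_up htc hA hat'
        have hk := hook_one (col (c + 1)) a' t (h.col_dec _) hat' htc
        rw [rowEl_succ A (c + 1), rowEl_succ A c, hA, ha, olt_some, olt_some]
        rcases hat.lt_or_eq with hlt | heq
        · refine ⟨ck (col (c + 1)) * lt t * lt a, ?_⟩
          calc _ = (ck (col (c + 1)) * lt t * rowEl A c * lt a') * lt a := by
                simp only [mul_assoc]
            _ = rowEl A c * ck (col (c + 1)) * (lt t * lt a' * lt a) := by
                rw [hu]; simp only [mul_assoc]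
            _ = rowEl A c * (ck (col (c + 1)) * lt a' * lt t) * lt a := by
                rw [← lt_bac haa hlt]; simp only [mul_assoc]
            _ = _ := by rw [← hk]; simp only [mul_assoc]
        · refine ⟨ck (col (c + 1)) * lt t * lt a', ?_⟩
          subst heq
          calc _ = (ck (col (c + 1)) * lt a * rowEl A c * lt a') * lt a := by
                simp only [mul_assoc]
            _ = rowEl A c * ck (col (c + 1)) * (lt a * lt a' * lt a) := by
                rw [hu]; simp only [mul_assoc]
            _ = rowEl A c * (ck (col (c + 1)) * lt a' * lt a) * lt a' := by
                rw [lt_aba]; simp only [mul_assoc]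
            _ = _ := by rw [← hk]; simp only [mul_assoc]

/-- A letter of the row that is also the last letter of its column may be dropped. -/
theorem drop_letter (h : RowSlide X col R F A r D) {c : ℕ} {Z : List ℤ} {y : ℤ}
    (hF : F c = some y) (hc : col c = Z ++ [y]) (q : WordMonoid) :
    wcl (X (c + 1) * rowEl F c * q) = wcl (X (c + 1) * rowEl F (c + 1) * q) := by
  have h1 := h.no_above.absorb c Z y hc
  have hn : rowEl (fun _ => none) c = 1 := rowEl_eq_one (rowList_eq_nil.2 fun _ _ => rfl)
  unfold RowGeom.V at h1
  rw [hn, mul_one] at h1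
  rw [rowEl_succ, hF, olt_some, ← mul_assoc]
  exact wcl_mul_right h1 q

/-- The step when the new letter of the row stays in place or is passed on from the left. -/
theorem step_row (h : RowSlide X col R F A r D) {c : ℕ} {t : ℤ} (hR : R c = some t)
    {d : ℕ} (hF : F d = some t) (q : WordMonoid) :
    X c * rowEl F d * ck (col c) * lt t * q = X (c + 1) * rowEl F (d + 1) * q := by
  have hk := hook (col c) (rowList F d) t (h.col_dec _) (rowList_pairwise h.F_inc _)
    (RowGeom.row_lt h.F_inc le_rfl hF) (h.R_lt c t hR)
  change ck (col c) * rowEl F d * lt t = rowEl F d * ck (col c) * lt t at hk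
  calc _ = X c * (rowEl F d * ck (col c) * lt t) * q := by simp only [mul_assoc]
    _ = _ := by rw [← hk, h.peel, rowEl_succ, hF, olt_some]; simp only [mul_assoc]

/-- The step when the new letter of the row moves up. -/
theorem step_up (h : RowSlide X col R F A r D) {c : ℕ} {t : ℤ} (hR : R c = some t)
    (hA : A c = some t) (hne : ∀ d, c = d + 1 → F d ≠ some t) :
    wcl (X c * rowEl F c * ck (col c) * lt t * rowEl A (c + 1))
      = wcl (X (c + 1) * rowEl F c * rowEl A (c + 1)) := by
  have htc := h.R_lt c t hR
  rw [rowEl_succ A, hA, olt_some]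
  cases c with
  | zero =>
    rw [rowEl_zero, rowEl_zero, h.peel]
    simp only [mul_one, one_mul, mul_assoc, lt_dup]
  | succ c =>
    cases hf : F c with
    | none =>
      obtain ⟨h1, h2⟩ := h.F_none c hf (Or.inr (Or.inl (by simp [hR])))
      rcases h2 with h2 | h2
      · rw [rowEl_eq_one h1, rowEl_eq_one h2, h.peel (c + 1)]
        simp only [mul_one, one_mul, mul_assoc, lt_dup]
      · have hX : X (c + 1 + 1) = 1 := by rw [h2]; exact h.diag
        have hX' : X (c + 1) * ck (col (c + 1)) = 1 := by rw [← h.peel, hX]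
        have hA' : rowEl A c = 1 := rowEl_eq_one (rowList_eq_nil.2 fun e he =>
          h.A_diag e (by omega))
        rw [rowEl_eq_one h1, hX, mul_one, hX', rowEl_succ, hA']
        cases A c with
        | none => simp [olt_none, lt_dup]
        | some a =>
          have := wcl_front t a (lt t)
          simp only [one_mul, olt_some]
          rw [← mul_assoc, this, mul_assoc, lt_dup]
    | some f =>
      have hft : f < t := by
        have h1 := h.F_le_R_next c f t hf hR
        have h2 := hne c rfl
        rw [hf] at h2
        have h3 : f ≠ t := fun e => h2 (by rw [e])
        omega
      have hk := hook (col (c + 1)) (rowList F (c + 1)) t (h.col_dec _)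
        (rowList_pairwise h.F_inc _) (by
          intro s hs
          rw [rowList_succ] at hs
          rcases List.mem_append.1 hs with hs | hs
          · exact (RowGeom.row_lt h.F_inc le_rfl hf s hs).trans hft
          · simp [hf] at hs; omega) htc
      change ck (col (c + 1)) * rowEl F (c + 1) * lt t
        = rowEl F (c + 1) * ck (col (c + 1)) * lt t at hk
      cases ha : A c with
      | none =>
        have h3 := h.A_none c (Or.inl (by simp [hf])) ha
        rw [rowEl_eq_one h3, one_mul]
        calc _ = wcl (X (c + 1) * (rowEl F (c + 1) * ck (col (c + 1)) * (lt t * lt t))) := by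
              simp only [mul_assoc]
          _ = _ := by rw [lt_dup, ← hk, h.peel (c + 1)]; simp only [mul_assoc]
      | some a =>
        have haf := h.A_lt_F c a f ha hf
        have hu := h.move_up htc ha (haf.trans hft)
        have hV : X (c + 1 + 1) * rowEl F (c + 1) * (rowEl A (c + 1) * lt t)
            = RowGeom.V X F A (c + 1) * lt t := by
          unfold RowGeom.V; simp only [mul_assoc]
        rw [hV, h.V_succ, rowEl_succ A, ha, hf, olt_some, olt_some, rowEl_succ F, hf, olt_some]
        calc _ = wcl (X (c + 1) * rowEl F c * lt f
                  * (ck (col (c + 1)) * lt t * rowEl A c * lt a) * lt t) := by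
              simp only [mul_assoc]
          _ = wcl (X (c + 1) * rowEl F c * lt f * rowEl A c
                * (ck (col (c + 1)) * lt t * lt a * lt t)) := by
              rw [hu]; simp only [mul_assoc]
          _ = wcl (RowGeom.V X F A c * (lt f * ck (col (c + 1)) * lt t) * lt a * lt t) := by
              rw [wcl_mul_right (h.letter_past c f hf)]; simp only [mul_assoc]
          _ = wcl (RowGeom.V X F A c * ck (col (c + 1)) * (lt f * lt t * lt a) * lt t) := by
              rw [hook_one _ f t (h.col_dec _) hft htc]; simp only [mul_assoc]
          _ = wcl (RowGeom.V X F A c * ck (col (c + 1)) * lt f * lt a * (lt t * lt t)) := by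
              rw [← lt_acb haf hft]; simp only [mul_assoc]
          _ = _ := by rw [lt_dup]

/-- Replacing a row by its version after sliding does not change the weak class. -/
theorem convert (h : RowSlide X col R F A r D) (n : ℕ) :
    wcl (X n * rowEl R n * rowEl A n) = wcl (X n * U F D n * rowEl A n) := by
  induction n with
  | zero => rfl
  | succ c ih =>
    cases hR : R c with
    | none =>
      have hRs : rowEl R (c + 1) = rowEl R c := by rw [rowEl_succ, hR, olt_none, mul_one]
      by_cases hD : D c
      · obtain ⟨h1, h2⟩ := h.start c hD hR
        rw [hRs, rowEl_eq_one h1]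
        simp only [U, if_pos hD]
        rw [rowEl_eq_one h2]
      · have hF : F c = none := by rw [h.stay c hD, hR]
        have hFs : rowEl F (c + 1) = rowEl F c := by rw [rowEl_succ, hF, olt_none, mul_one]
        simp only [U, if_neg hD]
        rw [hRs, hFs]
        rcases h.gap c hR hD with ⟨h1, h2⟩ | hc
        · rw [rowEl_eq_one h1, rowEl_eq_one h2]
        · have e : ∀ p, X (c + 1) * p * rowEl A (c + 1) = X c * p * rowEl A c * olt (A c) := by
            intro p; rw [h.peel, hc, ck_nil, mul_one, rowEl_succ]; simp only [mul_assoc]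
          rw [e, wcl_mul_right ih, ← e]
          cases c with
          | zero => rfl
          | succ c =>
            by_cases hd : D c
            · simp only [U, if_pos hd]
              rcases h.fill_end c hd hR with hf | ⟨Z, y, hy, hz⟩
              · rw [rowEl_succ F, hf, olt_none, mul_one]
              · rw [e, e]
                exact (by
                  simpa only [mul_assoc] using
                    h.drop_letter hy hz (rowEl A (c + 1) * olt (A (c + 1))))
            · simp only [U, if_neg hd]
    | some t =>
      obtain ⟨E, hE⟩ := h.column_past hR
      have hkR := hook (col c) (rowList R c) t (h.col_dec _) (rowList_pairwise h.R_inc _)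
        (RowGeom.row_lt h.R_inc le_rfl hR) (h.R_lt c t hR)
      change ck (col c) * rowEl R c * lt t = rowEl R c * ck (col c) * lt t at hkR
      have h1 : wcl (X (c + 1) * rowEl R (c + 1) * rowEl A (c + 1))
          = wcl (X c * U F D c * ck (col c) * lt t * rowEl A (c + 1)) := by
        calc _ = wcl (X c * (ck (col c) * rowEl R c * lt t) * rowEl A (c + 1)) := by
              rw [h.peel, rowEl_succ, hR, olt_some]; simp only [mul_assoc]
          _ = wcl (X c * rowEl R c * (ck (col c) * lt t * rowEl A (c + 1))) := by
              rw [hkR]; simp only [mul_assoc]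
          _ = wcl (X c * rowEl R c * rowEl A c * E) := by rw [hE]; simp only [mul_assoc]
          _ = wcl (X c * U F D c * (rowEl A c * E)) := by
              rw [wcl_mul_right ih]; simp only [mul_assoc]
          _ = _ := by rw [← hE]; simp only [mul_assoc]
      rw [h1]
      have full : (∀ d, c = d + 1 → ¬ (D d ∧ F d = some t)) →
          wcl (X c * rowEl F c * ck (col c) * lt t * rowEl A (c + 1))
            = wcl (X (c + 1) * U F D (c + 1) * rowEl A (c + 1)) := by
        intro hd
        by_cases hD : D c
        · simp only [U, if_pos hD]
          rcases h.vacate c t hD hR with hA | ⟨d, hd', h2⟩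
          · apply h.step_up hR hA
            intro d hcd hFd
            by_cases hDd : D d
            · exact hd d hcd ⟨hDd, hFd⟩
            · rw [h.stay d hDd] at hFd
              exact lt_irrefl _ (h.R_inc d c t t (by omega) hFd hR)
          · exact absurd h2 (hd d hd')
        · simp only [U, if_neg hD]
          rw [h.step_row hR (by rw [h.stay c hD, hR])]
      cases c with
      | zero => exact full (by simp)
      | succ c =>
        by_cases hd : D c
        · simp only [U, if_pos hd] at full ⊢
          rcases h.fill c t hd hR with ⟨hF, hD⟩ | ⟨Z, y, hy, hz, hyt⟩
          · rw [if_pos hD, h.step_row hR hF]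
          · rw [← full]
            · have := h.drop_letter hy hz (ck (col (c + 1)) * lt t * rowEl A (c + 1 + 1))
              simpa only [mul_assoc] using this
            · rintro d hcd ⟨-, hF⟩
              obtain rfl : c = d := by omega
              rw [hy] at hF
              exact hyt (by simpa using hF)
        · simp only [U, if_neg hd] at full ⊢
          apply full
          rintro d hcd ⟨hDd, -⟩
          obtain rfl : c = d := by omega
          exact hd hDd

end RowSlide

/-! ### Dotted tableaux and chains of swaps -/

section Chains

variable {L : Type} [PartialOrder L]

/-- The position of a value in the linear order where the dot sits just below `v`. -/
def rank (v : ℤ) : ZDot → ℤ := Sum.elim (fun x => 2 * x) fun _ => 2 * v - 1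

/-- A dotted tableau that is increasing when the dot is placed just below `v`. -/
def DotIncreasing (v : ℤ) (S : L → Option ZDot) : Prop :=
  ∀ a b : L, a < b → ∀ x y : ZDot, S a = some x → S b = some y → rank v x < rank v y

/-- The swap of the value `v` with the dot. -/
abbrev swapDot (v : ℤ) (S : L → Option ZDot) : L → Option ZDot :=
  swapVal (Sum.inl v) (Sum.inr ()) S

theorem swapDot_value {v : ℤ} {S : L → Option ZDot} {b c : L} (hb : S b = some (Sum.inl v))
    (hn : Neighbor b c) (hc : S c = some (Sum.inr ())) : swapDot v S b = some (Sum.inr ()) := by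
  simp only [swapDot, swapVal]
  rw [if_pos ⟨hb, c, hn, hc⟩]

theorem swapDot_value_stay {v : ℤ} {S : L → Option ZDot} {b : L} (hb : S b = some (Sum.inl v))
    (h : ∀ c, Neighbor b c → S c ≠ some (Sum.inr ())) : swapDot v S b = some (Sum.inl v) := by
  simp only [swapDot, swapVal]
  rw [if_neg (by rintro ⟨-, c, h1, h2⟩; exact h c h1 h2), if_neg (by simp [hb]), hb]

theorem swapDot_dot {v : ℤ} {S : L → Option ZDot} {b c : L} (hb : S b = some (Sum.inr ()))
    (hn : Neighbor b c) (hc : S c = some (Sum.inl v)) : swapDot v S b = some (Sum.inl v) := by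
  simp only [swapDot, swapVal]
  rw [if_neg (by simp [hb]), if_pos ⟨hb, c, hn, hc⟩]

theorem swapDot_dot_stay {v : ℤ} {S : L → Option ZDot} {b : L} (hb : S b = some (Sum.inr ()))
    (h : ∀ c, Neighbor b c → S c ≠ some (Sum.inl v)) : swapDot v S b = some (Sum.inr ()) := by
  simp only [swapDot, swapVal]
  rw [if_neg (by simp [hb]), if_neg (by rintro ⟨-, c, h1, h2⟩; exact h c h1 h2), hb]

theorem swapDot_other {v : ℤ} {S : L → Option ZDot} {b : L} (h1 : S b ≠ some (Sum.inl v))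
    (h2 : S b ≠ some (Sum.inr ())) : swapDot v S b = S b := by
  simp only [swapDot, swapVal]
  rw [if_neg (by simp [h1]), if_neg (by simp [h2])]

theorem swapDot_int {v w : ℤ} {S : L → Option ZDot} {b : L} (h : S b = some (Sum.inl w))
    (hw : w ≠ v) : swapDot v S b = some (Sum.inl w) := by
  rw [swapDot_other (by simpa [h] using hw) (by simp [h]), h]

/-- Case analysis for a swapped tableau. -/
theorem swapDot_cases (v : ℤ) (S : L → Option ZDot) (b : L) :
    (swapDot v S b = S b) ∨
    (S b = some (Sum.inl v) ∧ swapDot v S b = some (Sum.inr ()) ∧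
      ∃ c, Neighbor b c ∧ S c = some (Sum.inr ())) ∨
    (S b = some (Sum.inr ()) ∧ swapDot v S b = some (Sum.inl v) ∧
      ∃ c, Neighbor b c ∧ S c = some (Sum.inl v)) := by
  simp only [swapDot, swapVal]
  split_ifs with h1 h2
  · exact Or.inr (Or.inl ⟨h1.1, rfl, h1.2⟩)
  · exact Or.inr (Or.inr ⟨h2.1, rfl, h2.2⟩)
  · exact Or.inl rfl

theorem swapDot_eq_none {v : ℤ} {S : L → Option ZDot} {b : L} :
    swapDot v S b = none ↔ S b = none := by
  rcases swapDot_cases v S b with h | ⟨h1, h2, -⟩ | ⟨h1, h2, -⟩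
  · rw [h]
  · simp [h1, h2]
  · simp [h1, h2]

theorem Neighbor.symm {a b : L} (h : Neighbor a b) : Neighbor b a := Or.symm h

/-- In an increasing dotted tableau, a value and a dot with adjacent ranks in comparable boxes
occupy neighboring boxes. -/
theorem DotIncreasing.covBy {u : ℤ} {S : L → Option ZDot} (h : DotIncreasing u S)
    (hs : Set.OrdConnected {b | S b ≠ none}) {a b : L} {x y : ZDot} (hab : a < b)
    (ha : S a = some x) (hb : S b = some y) (hxy : rank u y ≤ rank u x + 1) : a ⋖ b := by
  refine ⟨hab, fun c hac hcb => ?_⟩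
  have hc : S c ≠ none := hs.out (x := a) (y := b) (by simp [ha]) (by simp [hb]) ⟨hac.le, hcb.le⟩
  obtain ⟨z, hz⟩ := Option.ne_none_iff_exists'.1 hc
  have h1 := h a c hac x z ha hz
  have h2 := h c b hcb z y hz hb
  omega

theorem DotIncreasing.not_same {u : ℤ} {S : L → Option ZDot} (h : DotIncreasing u S) {a b : L}
    (hn : Neighbor a b) {x : ZDot} (ha : S a = some x) : S b ≠ some x := by
  intro hb
  rcases hn with hn | hn
  · exact lt_irrefl _ (h a b hn.lt x x ha hb)
  · exact lt_irrefl _ (h b a hn.lt x x hb ha)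

theorem swapDot_involutive {u v : ℤ} {S : L → Option ZDot} (h : DotIncreasing u S) :
    swapDot v (swapDot v S) = S := by
  funext b
  rcases swapDot_cases v S b with h1 | ⟨h1, h2, c, hn, hc⟩ | ⟨h1, h2, c, hn, hc⟩
  · by_cases hv : S b = some (Sum.inl v)
    · rw [hv] at h1 ⊢
      apply swapDot_value_stay h1
      intro c hn hc
      rcases swapDot_cases v S c with h3 | ⟨h3, -⟩ | ⟨-, h3, -⟩
      · rw [h3] at hc
        rw [swapDot_value hv hn hc] at h1
        simp at h1
      · exact h.not_same hn hv h3
      · rw [h3] at hc; simp at hc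
    · by_cases hd : S b = some (Sum.inr ())
      · rw [hd] at h1 ⊢
        apply swapDot_dot_stay h1
        intro c hn hc
        rcases swapDot_cases v S c with h3 | ⟨-, h3, -⟩ | ⟨h3, -⟩
        · rw [h3] at hc
          rw [swapDot_dot hd hn hc] at h1
          simp at h1
        · rw [h3] at hc; simp at hc
        · exact h.not_same hn hd h3
      · rw [swapDot_other (by rwa [h1]) (by rwa [h1]), h1]
  · rw [h1]
    exact swapDot_dot h2 hn (swapDot_dot hc hn.symm h1)
  · rw [h1]
    exact swapDot_value h2 hn (swapDot_value hc hn.symm h1)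

theorem dot_or_int (x : ZDot) : x = Sum.inr () ∨ ∃ w, x = Sum.inl w := by
  rcases x with w | ⟨⟩
  · exact Or.inr ⟨w, rfl⟩
  · exact Or.inl rfl

theorem rank_int (v w : ℤ) : rank v (Sum.inl w) = 2 * w := rfl

theorem rank_dot (v : ℤ) : rank v (Sum.inr ()) = 2 * v - 1 := rfl

theorem DotIncreasing.swap_up {v : ℤ} {S : L → Option ZDot} (h : DotIncreasing v S)
    (hs : Set.OrdConnected {b | S b ≠ none}) : DotIncreasing (v + 1) (swapDot v S) := by
  intro a b hab x y ha hb
  have key : S a = some (Sum.inr ()) → S b = some (Sum.inl v) →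
      rank (v + 1) x < rank (v + 1) y := by
    intro h1 h2
    have hn : Neighbor a b := Or.inl (h.covBy hs hab h1 h2 (by simp [rank_int, rank_dot]))
    rw [swapDot_dot h1 hn h2] at ha
    rw [swapDot_value h2 hn.symm h1] at hb
    simp only [Option.some.injEq] at ha hb
    subst ha hb
    simp only [rank_int, rank_dot]; omega
  rcases swapDot_cases v S a with h1 | ⟨h1, h1', -⟩ | ⟨h1, h1', -⟩ <;>
  rcases swapDot_cases v S b with h2 | ⟨h2, h2', -⟩ | ⟨h2, h2', -⟩
  · rw [h1] at ha
    rw [h2] at hb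
    have := h a b hab x y ha hb
    rcases dot_or_int x with rfl | ⟨w, rfl⟩ <;> rcases dot_or_int y with rfl | ⟨w', rfl⟩
    · exact absurd this (lt_irrefl _)
    · by_cases e : w' = v
      · subst e; exact key ha hb
      · simp only [rank_int, rank_dot] at this ⊢; omega
    all_goals simp only [rank_int, rank_dot] at this ⊢; omega
  · rw [h1] at ha
    rw [h2'] at hb
    have := h a b hab _ _ ha h2
    simp only [Option.some.injEq] at hb
    subst hb
    rcases dot_or_int x with rfl | ⟨w, rfl⟩
    · exact key ha h2
    · simp only [rank_int, rank_dot] at this ⊢; omega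
  · rw [h1] at ha
    rw [h2'] at hb
    have := h a b hab _ _ ha h2
    simp only [Option.some.injEq] at hb
    subst hb
    rcases dot_or_int x with rfl | ⟨w, rfl⟩ <;>
    · simp only [rank_int, rank_dot] at this ⊢; omega
  · rw [h1'] at ha
    rw [h2] at hb
    have := h a b hab _ _ h1 hb
    simp only [Option.some.injEq] at ha
    subst ha
    rcases dot_or_int y with rfl | ⟨w, rfl⟩ <;>
    · simp only [rank_int, rank_dot] at this ⊢; omega
  · exact absurd (h a b hab _ _ h1 h2) (lt_irrefl _)
  · have := h a b hab _ _ h1 h2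
    simp only [rank_int, rank_dot] at this; omega
  · rw [h1'] at ha
    rw [h2] at hb
    have := h a b hab _ _ h1 hb
    simp only [Option.some.injEq] at ha
    subst ha
    rcases dot_or_int y with rfl | ⟨w, rfl⟩
    · simp only [rank_int, rank_dot] at this ⊢; omega
    · by_cases e : w = v
      · subst e; exact key h1 hb
      · simp only [rank_int, rank_dot] at this ⊢; omega
  · exact key h1 h2
  · exact absurd (h a b hab _ _ h1 h2) (lt_irrefl _)

theorem DotIncreasing.swap_down {v : ℤ} {S : L → Option ZDot} (h : DotIncreasing (v + 1) S)
    (hs : Set.OrdConnected {b | S b ≠ none}) : DotIncreasing v (swapDot v S) := by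
  intro a b hab x y ha hb
  have key : S a = some (Sum.inl v) → S b = some (Sum.inr ()) → rank v x < rank v y := by
    intro h1 h2
    have hn : Neighbor a b := Or.inl (h.covBy hs hab h1 h2 (by
      simp only [rank_int, rank_dot]; omega))
    rw [swapDot_value h1 hn h2] at ha
    rw [swapDot_dot h2 hn.symm h1] at hb
    simp only [Option.some.injEq] at ha hb
    subst ha hb
    simp only [rank_int, rank_dot]; omega
  rcases swapDot_cases v S a with h1 | ⟨h1, h1', -⟩ | ⟨h1, h1', -⟩ <;>
  rcases swapDot_cases v S b with h2 | ⟨h2, h2', -⟩ | ⟨h2, h2', -⟩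
  · rw [h1] at ha
    rw [h2] at hb
    have := h a b hab x y ha hb
    rcases dot_or_int x with rfl | ⟨w, rfl⟩ <;> rcases dot_or_int y with rfl | ⟨w', rfl⟩
    · exact absurd this (lt_irrefl _)
    · simp only [rank_int, rank_dot] at this ⊢; omega
    · by_cases e : w = v
      · subst e; exact key ha hb
      · simp only [rank_int, rank_dot] at this ⊢; omega
    · simp only [rank_int] at this ⊢; omega
  · rw [h1] at ha
    rw [h2'] at hb
    have := h a b hab _ _ ha h2
    simp only [Option.some.injEq] at hb
    subst hb
    rcases dot_or_int x with rfl | ⟨w, rfl⟩ <;>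
    · simp only [rank_int, rank_dot] at this ⊢; omega
  · rw [h1] at ha
    rw [h2'] at hb
    have := h a b hab _ _ ha h2
    simp only [Option.some.injEq] at hb
    subst hb
    rcases dot_or_int x with rfl | ⟨w, rfl⟩
    · simp only [rank_int, rank_dot] at this ⊢; omega
    · by_cases e : w = v
      · subst e; exact key ha h2
      · simp only [rank_int, rank_dot] at this ⊢; omega
  · rw [h1'] at ha
    rw [h2] at hb
    have := h a b hab _ _ h1 hb
    simp only [Option.some.injEq] at ha
    subst ha
    rcases dot_or_int y with rfl | ⟨w, rfl⟩
    · exact key h1 hb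
    · simp only [rank_int, rank_dot] at this ⊢; omega
  · exact absurd (h a b hab _ _ h1 h2) (lt_irrefl _)
  · exact key h1 h2
  · rw [h1'] at ha
    rw [h2] at hb
    have := h a b hab _ _ h1 hb
    simp only [Option.some.injEq] at ha
    subst ha
    rcases dot_or_int y with rfl | ⟨w, rfl⟩ <;>
    · simp only [rank_int, rank_dot] at this ⊢; omega
  · have := h a b hab _ _ h1 h2
    simp only [rank_int, rank_dot] at this; omega
  · exact absurd (h a b hab _ _ h1 h2) (lt_irrefl _)

end Chains

section SlideChains

variable {L : Type}

theorem restrictInt_eq_some {S : L → Option ZDot} {b : L} {x : ℤ} :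
    restrictInt S b = some x ↔ S b = some (Sum.inl x) := by
  simp only [restrictInt]
  cases h : S b with
  | none => simp
  | some y => rcases y with w | u <;> simp

theorem restrictInt_eq_none {S : L → Option ZDot} {b : L} :
    restrictInt S b = none ↔ S b = none ∨ S b = some (Sum.inr ()) := by
  simp only [restrictInt]
  cases h : S b with
  | none => simp
  | some y => rcases y with w | u <;> simp

theorem restrictInt_addDots {C : Finset L} {T : L → Option ℤ} (h : ∀ c ∈ C, T c = none) :
    restrictInt (addDots C (toDotted T)) = T := by
  funext b
  simp only [restrictInt, addDots, toDotted]
  split_ifs with hb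
  · simp [h b hb]
  · cases T b <;> simp

theorem addDots_restrictInt {C : Finset L} {S : L → Option ZDot}
    (h : ∀ c, c ∈ C ↔ S c = some (Sum.inr ())) :
    addDots C (toDotted (restrictInt S)) = S := by
  funext b
  simp only [addDots]
  split_ifs with hb
  · exact ((h b).1 hb).symm
  · rw [h] at hb
    simp only [toDotted, restrictInt]
    rcases hS : S b with _ | (w | u)
    · rfl
    · rfl
    · exact absurd hS hb

theorem addDots_int {C : Finset L} {T : L → Option ℤ} {b : L} {x : ℤ}
    (h : addDots C (toDotted T) b = some (Sum.inl x)) : T b = some x := by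
  simp only [addDots, toDotted] at h
  split_ifs at h with hb
  · simp at h
  · cases hT : T b <;> simp_all

theorem addDots_dot {C : Finset L} {T : L → Option ℤ} {b : L} {u : Unit}
    (h : addDots C (toDotted T) b = some (Sum.inr u)) : b ∈ C := by
  simp only [addDots, toDotted] at h
  split_ifs at h with hb
  · exact hb
  · cases hT : T b <;> simp_all

theorem addDots_ne_none {C : Finset L} {T : L → Option ℤ} {b : L} :
    addDots C (toDotted T) b ≠ none ↔ b ∈ C ∨ T b ≠ none := by
  simp only [addDots, toDotted]
  split_ifs with hb
  · simp [hb]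
  · cases hT : T b <;> simp [hb]

variable [PartialOrder L]

/-- A sequence of swaps `swap_{a,•}, …, swap_{a+n-1,•}` leading from `T` to `T'`. -/
structure SlideChain (T T' : L → Option ℤ) (a : ℤ) (n : ℕ) (S : ℕ → L → Option ZDot) :
    Prop where
  first : restrictInt (S 0) = T
  last : restrictInt (S n) = T'
  step : ∀ k < n, S (k + 1) = swapDot (a + k) (S k)
  inc : ∀ k ≤ n, DotIncreasing (a + k) (S k)
  fin : {b | S 0 b ≠ none}.Finite
  conv : Set.OrdConnected {b | S 0 b ≠ none}
  range : ∀ b x, S 0 b = some (Sum.inl x) → a ≤ x ∧ x < a + n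

theorem swapUp_eq_none {a : ℤ} {n : ℕ} {S : L → Option ZDot} {b : L} :
    swapUp a n S b = none ↔ S b = none := by
  induction n with
  | zero => rfl
  | succ n ih => exact swapDot_eq_none.trans ih

theorem swapDown_eq_none {a : ℤ} {n : ℕ} {S : L → Option ZDot} {b : L} :
    swapDown a n S b = none ↔ S b = none := by
  induction n with
  | zero => rfl
  | succ n ih => exact swapDot_eq_none.trans ih

theorem swapUp_inc {a : ℤ} {S : L → Option ZDot} (h : DotIncreasing a S)
    (hs : Set.OrdConnected {b | S b ≠ none}) (n : ℕ) : DotIncreasing (a + n) (swapUp a n S) := by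
  induction n with
  | zero => simpa [swapUp] using h
  | succ n ih =>
    have hs' : Set.OrdConnected {b | swapUp a n S b ≠ none} := by
      simpa only [ne_eq, swapUp_eq_none] using hs
    have := ih.swap_up hs'
    rw [Nat.cast_succ, ← add_assoc]
    exact this

theorem swapDown_inc {b : ℤ} {S : L → Option ZDot} (h : DotIncreasing (b + 1) S)
    (hs : Set.OrdConnected {b | S b ≠ none}) (n : ℕ) :
    DotIncreasing (b + 1 - n) (swapDown b n S) := by
  induction n with
  | zero => simpa [swapDown] using h
  | succ n ih =>
    have hs' : Set.OrdConnected {c | swapDown b n S c ≠ none} := by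
      simpa only [ne_eq, swapDown_eq_none] using hs
    have e1 : b + 1 - (n : ℤ) = b - n + 1 := by ring
    have e2 : b + 1 - ((n + 1 : ℕ) : ℤ) = b - n := by push_cast; ring
    rw [e1] at ih
    rw [e2]
    exact ih.swap_down hs'

theorem swapDown_int {b : ℤ} {S : L → Option ZDot} {n : ℕ} {c : L} {x : ℤ}
    (h : swapDown b n S c = some (Sum.inl x)) :
    S c = some (Sum.inl x) ∨ (b - n < x ∧ x ≤ b) := by
  induction n with
  | zero => exact Or.inl h
  | succ n ih =>
    rcases swapDot_cases (b - n) (swapDown b n S) c with h1 | ⟨-, h1, -⟩ | ⟨-, h1, -⟩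
    · rcases ih (h1.symm.trans h) with h2 | h2
      · exact Or.inl h2
      · exact Or.inr ⟨by push_cast; omega, h2.2⟩
    · exact absurd (h.symm.trans h1) (by simp)
    · have := h.symm.trans h1
      simp only [Option.some.injEq, Sum.inl.injEq] at this
      exact Or.inr ⟨by push_cast; omega, by omega⟩

/-- A forward slide of an increasing tableau is a chain of swaps. -/
theorem IsForwardSlide.chain {T T' : L → Option ℤ} (h : IsForwardSlide T T')
    (hT : Increasing T) : ∃ a n S, SlideChain T T' a n S := by
  obtain ⟨lam, nu, C, a, b, ⟨hl, hn, hln⟩, hsh, hv, hC, rfl⟩ := h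
  have hsh' : ∀ c, T c ≠ none ↔ c ∈ nu ∧ c ∉ lam := fun c => by
    have : c ∈ shapeOf T ↔ c ∈ (nu : Set L) \ (lam : Set L) := by rw [hsh]
    simpa [shapeOf] using this
  have hconv : Set.OrdConnected {c | addDots C (toDotted T) c ≠ none} := by
    refine ⟨fun x hx y hy c ⟨hxc, hcy⟩ => ?_⟩
    simp only [Set.mem_ofPred_eq, addDots_ne_none, hsh'] at hx hy ⊢
    have hynu : y ∈ nu := hy.elim (fun h => hln (hC y h).1) fun h => h.1
    have hcnu := hn y hynu c hcy
    by_cases hcl : c ∈ lam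
    · rcases hx with hx | hx
      · rcases hxc.lt_or_eq with h1 | h1
        · exact absurd h1 ((hC x hx).2 c hcl)
        · exact Or.inl (h1 ▸ hx)
      · exact absurd (hl c hcl x hxc) hx.2
    · exact Or.inr ⟨hcnu, hcl⟩
  have hinc : DotIncreasing a (addDots C (toDotted T)) := by
    intro c d hcd x y hx hy
    rcases dot_or_int x with rfl | ⟨w, rfl⟩ <;> rcases dot_or_int y with rfl | ⟨w', rfl⟩
    · exact absurd hcd ((hC c (addDots_dot hx)).2 d (hC d (addDots_dot hy)).1)
    · have := hv d w' (addDots_int hy)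
      simp only [rank_int, rank_dot]; omega
    · have h1 := (hsh' c).1 (by simp [addDots_int hx])
      exact absurd (hl d (hC d (addDots_dot hy)).1 c hcd.le) h1.2
    · have := hT c d hcd w w' (addDots_int hx) (addDots_int hy)
      simp only [rank_int]; omega
  refine ⟨a, (b - a + 1).toNat, fun k => swapUp a k (addDots C (toDotted T)), ?_, rfl,
    fun _ _ => rfl, fun k _ => swapUp_inc hinc hconv k, ?_, hconv, ?_⟩
  · apply restrictInt_addDots
    intro c hc
    by_contra h1
    exact ((hsh' c).1 h1).2 (hC c hc).1
  · apply (C.finite_toSet.union nu.finite_toSet).subset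
    intro c hc
    simp only [swapUp, Set.mem_ofPred_eq, addDots_ne_none, hsh'] at hc
    exact hc.imp id fun h => h.1
  · intro c x hx
    have := hv c x (addDots_int hx)
    omega

/-- A reverse slide of an increasing tableau is a chain of swaps in the other direction. -/
theorem IsReverseSlide.chain {T T' : L → Option ℤ} (h : IsReverseSlide T T')
    (hT : Increasing T) : ∃ a n S, SlideChain T' T a n S := by
  obtain ⟨lam, nu, C, a, b, ⟨hl, hn, hln⟩, hsh, hv, hC, rfl⟩ := h
  have hsh' : ∀ c, T c ≠ none ↔ c ∈ nu ∧ c ∉ lam := fun c => by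
    have : c ∈ shapeOf T ↔ c ∈ (nu : Set L) \ (lam : Set L) := by rw [hsh]
    simpa [shapeOf] using this
  have hconv : Set.OrdConnected {c | addDots C (toDotted T) c ≠ none} := by
    refine ⟨fun x hx y hy c ⟨hxc, hcy⟩ => ?_⟩
    simp only [Set.mem_ofPred_eq, addDots_ne_none, hsh'] at hx hy ⊢
    have hxl : x ∉ lam := hx.elim (fun h hl => (hC x h).1 (hln hl)) fun h => h.2
    have hcl : c ∉ lam := fun h => hxl (hl c h x hxc)
    by_cases hcn : c ∈ nu
    · exact Or.inr ⟨hcn, hcl⟩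
    · rcases hy with hy | hy
      · rcases hcy.lt_or_eq with h1 | h1
        · exact absurd h1 ((hC y hy).2 c hcn)
        · exact Or.inl (h1 ▸ hy)
      · exact absurd (hn y hy.1 c hcy) hcn
  have hinc : DotIncreasing (b + 1) (addDots C (toDotted T)) := by
    intro c d hcd x y hx hy
    rcases dot_or_int x with rfl | ⟨w, rfl⟩ <;> rcases dot_or_int y with rfl | ⟨w', rfl⟩
    · exact absurd hcd ((hC d (addDots_dot hy)).2 c (hC c (addDots_dot hx)).1)
    · have h1 := (hsh' d).1 (by simp [addDots_int hy])
      exact absurd (hn d h1.1 c hcd.le) (hC c (addDots_dot hx)).1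
    · have := hv c w (addDots_int hx)
      simp only [rank_int, rank_dot]; omega
    · have := hT c d hcd w w' (addDots_int hx) (addDots_int hy)
      simp only [rank_int]; omega
  set n := (b - a + 1).toNat with hn'
  set S0 := addDots C (toDotted T) with hS0
  have hdown := swapDown_inc hinc hconv
  have hset : {c | swapDown b (n - 0) S0 c ≠ none} = {c | S0 c ≠ none} := by
    ext c; simp only [Set.mem_ofPred_eq, ne_eq, swapDown_eq_none]
  refine ⟨b + 1 - n, n, fun k => swapDown b (n - k) S0, rfl, ?_, ?_, ?_, ?_, ?_, ?_⟩
  · simp only [Nat.sub_self, swapDown, hS0]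
    apply restrictInt_addDots
    intro c hc
    by_contra h1
    exact (hC c hc).1 ((hsh' c).1 h1).1
  · intro k hk
    obtain ⟨m, hm⟩ : ∃ m, n - k = m + 1 := ⟨n - k - 1, by omega⟩
    have hm' : n - (k + 1) = m := by omega
    have e : b + 1 - (n : ℤ) + k = b - m := by omega
    simp only [hm, hm', e]
    exact (swapDot_involutive (hdown m)).symm
  · intro k hk
    have e : b + 1 - (n : ℤ) + k = b + 1 - ((n - k : ℕ) : ℤ) := by omega
    rw [e]
    exact hdown _
  · rw [hset]
    apply (C.finite_toSet.union nu.finite_toSet).subset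
    intro c hc
    simp only [hS0, Set.mem_ofPred_eq, addDots_ne_none, hsh'] at hc
    exact hc.imp id fun h => h.1
  · rw [hset]; exact hconv
  · intro c x hx
    rcases swapDown_int hx with h1 | h1
    · have := hv c x (addDots_int h1)
      omega
    · simp only [Nat.sub_zero] at h1
      omega

namespace SlideChain

variable {T T' : L → Option ℤ} {a : ℤ} {n : ℕ} {S : ℕ → L → Option ZDot}

theorem ne_none_iff (h : SlideChain T T' a n S) {k : ℕ} (hk : k ≤ n) (b : L) :
    S k b ≠ none ↔ S 0 b ≠ none := by
  induction k with
  | zero => rfl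
  | succ k ih => rw [h.step k (by omega), ne_eq, swapDot_eq_none, ← ne_eq, ih (by omega)]

theorem conv' (h : SlideChain T T' a n S) {k : ℕ} (hk : k ≤ n) :
    Set.OrdConnected {b | S k b ≠ none} := by
  have : {b | S k b ≠ none} = {b | S 0 b ≠ none} := by ext b; exact h.ne_none_iff hk b
  rw [this]; exact h.conv

theorem range' (h : SlideChain T T' a n S) {k : ℕ} (hk : k ≤ n) {b : L} {x : ℤ}
    (hb : S k b = some (Sum.inl x)) : a ≤ x ∧ x < a + n := by
  induction k generalizing b x with
  | zero => exact h.range b x hb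
  | succ k ih =>
    rw [h.step k (by omega)] at hb
    rcases swapDot_cases (a + k) (S k) b with h1 | ⟨-, h1, -⟩ | ⟨-, h1, -⟩
    · exact ih (by omega) (h1.symm.trans hb)
    · exact absurd (hb.symm.trans h1) (by simp)
    · have := hb.symm.trans h1
      simp only [Option.some.injEq, Sum.inl.injEq] at this
      omega

theorem eq_first_iff (h : SlideChain T T' a n S) {b : L} {x : ℤ} :
    T b = some x ↔ S 0 b = some (Sum.inl x) := by rw [← h.first, restrictInt_eq_some]

theorem eq_last_iff (h : SlideChain T T' a n S) {b : L} {x : ℤ} :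
    T' b = some x ↔ S n b = some (Sum.inl x) := by rw [← h.last, restrictInt_eq_some]

theorem increasing_first (h : SlideChain T T' a n S) : Increasing T := by
  intro c d hcd x y hx hy
  have := h.inc 0 (Nat.zero_le _) c d hcd _ _ (h.eq_first_iff.1 hx) (h.eq_first_iff.1 hy)
  simp only [rank_int] at this; omega

theorem increasing_last (h : SlideChain T T' a n S) : Increasing T' := by
  intro c d hcd x y hx hy
  have := h.inc n le_rfl c d hcd _ _ (h.eq_last_iff.1 hx) (h.eq_last_iff.1 hy)
  simp only [rank_int] at this; omega

end SlideChain

/-- Finite convex sets are skew shapes. -/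
theorem exists_skewPair (hfin : ∀ b : L, (Set.Iic b).Finite) {P : Set L} (hP : P.Finite)
    (hc : P.OrdConnected) : ∃ lam nu : Finset L, IsSkewPair lam nu ∧
      P = (nu : Set L) \ (lam : Set L) ∧ (∀ b ∈ nu, ∃ p ∈ P, b ≤ p) := by
  have hN : (⋃ p ∈ P, Set.Iic p).Finite := hP.biUnion fun p _ => hfin p
  have hmem : ∀ b, b ∈ hN.toFinset ↔ ∃ p ∈ P, b ≤ p := by intro b; simp
  refine ⟨hN.toFinset.filter (· ∉ P), hN.toFinset, ⟨?_, ?_, Finset.filter_subset _ _⟩, ?_, ?_⟩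
  · intro b hb c hcb
    rw [Finset.mem_filter, hmem] at hb ⊢
    obtain ⟨⟨p, hp, hbp⟩, hbP⟩ := hb
    exact ⟨⟨p, hp, hcb.trans hbp⟩, fun h => hbP (hc.out h hp ⟨hcb, hbp⟩)⟩
  · intro b hb c hcb
    rw [hmem] at hb ⊢
    obtain ⟨p, hp, hbp⟩ := hb
    exact ⟨p, hp, hcb.trans hbp⟩
  · ext b
    simp only [Set.mem_sdiff, Finset.mem_coe, Finset.mem_filter, hmem]
    constructor
    · intro hb
      exact ⟨⟨b, hb, le_rfl⟩, fun h => h.2 hb⟩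
    · rintro ⟨h1, h2⟩
      by_contra hb
      exact h2 ⟨h1, hb⟩
  · intro b hb
    exact (hmem b).1 hb

namespace SlideChain

variable {T T' : L → Option ℤ} {a : ℤ} {n : ℕ} {S : ℕ → L → Option ZDot}

theorem isForwardSlide (h : SlideChain T T' a n S) (hfin : ∀ b : L, (Set.Iic b).Finite) :
    IsForwardSlide T T' := by
  obtain ⟨lam, nu, ⟨hl, hn, hln⟩, hP, hcof⟩ := exists_skewPair hfin h.fin h.conv
  have hP' : ∀ c, S 0 c ≠ none ↔ c ∈ nu ∧ c ∉ lam := fun c => by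
    have : c ∈ {b | S 0 b ≠ none} ↔ c ∈ (nu : Set L) \ (lam : Set L) := by rw [hP]
    simpa using this
  set C : Finset L := nu.filter (fun c => S 0 c = some (Sum.inr ())) with hCdef
  have hC : ∀ c, c ∈ C ↔ S 0 c = some (Sum.inr ()) := by
    intro c
    rw [hCdef, Finset.mem_filter]
    exact ⟨fun h => h.2, fun h => ⟨((hP' c).1 (by simp [h])).1, h⟩⟩
  have hdot : ∀ c d, S 0 c = some (Sum.inr ()) → d < c → S 0 d = none := by
    intro c d hcd hdc
    by_contra hne
    obtain ⟨x, hx⟩ := Option.ne_none_iff_exists'.1 hne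
    have := h.inc 0 (Nat.zero_le _) d c hdc x _ hx hcd
    rcases dot_or_int x with rfl | ⟨w, rfl⟩
    · exact lt_irrefl _ this
    · have h2 := h.range d w hx
      simp only [rank_int, rank_dot] at this
      push_cast at this
      omega
  refine ⟨lam ∪ C, nu, C, a, a + n - 1, ⟨?_, hn, ?_⟩, ?_, ?_, ?_, ?_⟩
  · intro c hc d hdc
    rw [Finset.mem_union] at hc ⊢
    rcases hc with hc | hc
    · exact Or.inl (hl c hc d hdc)
    · rcases hdc.lt_or_eq with h1 | h1
      · left
        by_contra hd
        have hcn := ((hP' c).1 (by simp [(hC c).1 hc])).1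
        exact (hP' d).2 ⟨hn c hcn d hdc, hd⟩ (hdot c d ((hC c).1 hc) h1)
      · exact Or.inr (h1 ▸ hc)
  · intro c hc
    rcases Finset.mem_union.1 hc with hc | hc
    · exact hln hc
    · exact (Finset.mem_filter.1 hc).1
  · ext c
    simp only [shapeOf, Set.mem_ofPred_eq, Set.mem_sdiff, Finset.mem_coe, Finset.mem_union, not_or,
      ← h.first]
    rw [hC, ne_eq, restrictInt_eq_none, not_or, ← ne_eq, hP', and_assoc]
  · intro c x hx
    have := h.range c x (h.eq_first_iff.1 hx)
    omega
  · intro c hc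
    refine ⟨Finset.mem_union_right _ hc, fun d hd hcd => ?_⟩
    rcases Finset.mem_union.1 hd with hd | hd
    · exact ((hP' c).1 (by simp [(hC c).1 hc])).2 (hl d hd c hcd.le)
    · have := hdot d c ((hC d).1 hd) hcd
      simp [(hC c).1 hc] at this
  · have e : (a + n - 1 - a + 1).toNat = n := by omega
    rw [e, ← h.first, addDots_restrictInt hC, ← h.last]
    congr 1
    have : ∀ k ≤ n, S k = swapUp a k (S 0) := by
      intro k
      induction k with
      | zero => intro _; rfl
      | succ k ih => intro hk; rw [h.step k (by omega), ih (by omega)]; rfl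
    exact this n le_rfl

theorem isReverseSlide (h : SlideChain T T' a n S) (hfin : ∀ b : L, (Set.Iic b).Finite) :
    IsReverseSlide T' T := by
  obtain ⟨lam, nu, ⟨hl, hn, hln⟩, hP, hcof⟩ := exists_skewPair hfin h.fin h.conv
  have hP' : ∀ c, S n c ≠ none ↔ c ∈ nu ∧ c ∉ lam := fun c => by
    have : c ∈ {b | S 0 b ≠ none} ↔ c ∈ (nu : Set L) \ (lam : Set L) := by rw [hP]
    rw [h.ne_none_iff le_rfl]
    simpa using this
  set C : Finset L := nu.filter (fun c => S n c = some (Sum.inr ())) with hCdef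
  have hC : ∀ c, c ∈ C ↔ S n c = some (Sum.inr ()) := by
    intro c
    rw [hCdef, Finset.mem_filter]
    exact ⟨fun h => h.2, fun h => ⟨((hP' c).1 (by simp [h])).1, h⟩⟩
  have hdot : ∀ c d, S n c = some (Sum.inr ()) → c < d → S n d = none := by
    intro c d hcd hdc
    by_contra hne
    obtain ⟨x, hx⟩ := Option.ne_none_iff_exists'.1 hne
    have := h.inc n le_rfl c d hdc _ x hcd hx
    rcases dot_or_int x with rfl | ⟨w, rfl⟩
    · exact lt_irrefl _ this
    · have h2 := h.range' le_rfl hx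
      simp only [rank_int, rank_dot] at this
      omega
  have hCP : ∀ c ∈ C, c ∉ lam := fun c hc => ((hP' c).1 (by simp [(hC c).1 hc])).2
  refine ⟨lam, nu \ C, C, a, a + n - 1, ⟨hl, ?_, ?_⟩, ?_, ?_, ?_, ?_⟩
  · intro c hc d hdc
    rw [Finset.mem_sdiff] at hc ⊢
    refine ⟨hn c hc.1 d hdc, fun hd => ?_⟩
    rcases hdc.lt_or_eq with h1 | h1
    · have h2 := hdot d c ((hC d).1 hd) h1
      have h3 : c ∉ lam := fun h => hCP d hd (hl c h d hdc)
      exact (hP' c).2 ⟨hc.1, h3⟩ h2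
    · exact hc.2 (h1 ▸ hd)
  · intro c hc
    exact Finset.mem_sdiff.2 ⟨hln hc, fun h => hCP c h hc⟩
  · ext c
    simp only [shapeOf, Set.mem_ofPred_eq, Set.mem_sdiff, Finset.mem_coe, Finset.mem_sdiff,
      ← h.last]
    rw [hC, ne_eq, restrictInt_eq_none, not_or, ← ne_eq, hP']
    tauto
  · intro c x hx
    have := h.range' le_rfl (h.eq_last_iff.1 hx)
    omega
  · intro c hc
    refine ⟨fun h => (Finset.mem_sdiff.1 h).2 hc, fun d hd hdc => ?_⟩
    have hcn : c ∈ nu := ((hP' c).1 (by simp [(hC c).1 hc])).1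
    have hdC : d ∈ C := by
      by_contra h1
      exact hd (Finset.mem_sdiff.2 ⟨hn c hcn d hdc.le, h1⟩)
    have := hdot d c ((hC d).1 hdC) hdc
    simp [(hC c).1 hc] at this
  · have e : (a + n - 1 - a + 1).toNat = n := by omega
    rw [e, ← h.last, addDots_restrictInt hC, ← h.first]
    congr 1
    have : ∀ k ≤ n, S (n - k) = swapDown (a + n - 1) k (S n) := by
      intro k
      induction k with
      | zero => intro _; rfl
      | succ k ih =>
        intro hk
        have h1 := h.step (n - (k + 1)) (by omega)
        have e2 : n - (k + 1) + 1 = n - k := by omega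
        rw [e2, ih (by omega)] at h1
        have e3 : a + ((n - (k + 1) : ℕ) : ℤ) = a + n - 1 - k := by omega
        rw [e3] at h1
        change _ = swapDot (a + n - 1 - k) (swapDown (a + n - 1) k (S n))
        rw [h1, swapDot_involutive (h.inc (n - (k + 1)) (by omega))]
    have := this n le_rfl
    rwa [Nat.sub_self] at this

end SlideChain

end SlideChains

section SlideFacts

variable {L : Type}

/-- The dotted tableau of a slide when the values below `v` have been processed. -/
def slideStage (T T' : L → Option ℤ) (D : Set L) (v : ℤ) : L → Option ZDot := fun b =>
  if b ∉ D then (T b).map Sum.inl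
  else if ∃ x, T b = some x ∧ v ≤ x then (T b).map Sum.inl
  else if ∃ x, T' b = some x ∧ x < v then (T' b).map Sum.inl
  else some (Sum.inr ())

theorem slideStage_of_notMem {T T' : L → Option ℤ} {D : Set L} {v : ℤ} {b : L} (hb : b ∉ D) :
    slideStage T T' D v b = (T b).map Sum.inl := by rw [slideStage, if_pos hb]

theorem slideStage_first {T T' : L → Option ℤ} {D : Set L} {v x : ℤ} {b : L}
    (h : T b = some x) (hx : v ≤ x) : slideStage T T' D v b = some (Sum.inl x) := by
  by_cases hb : b ∈ D
  · rw [slideStage, if_neg (by simpa using hb), if_pos ⟨x, h, hx⟩, h]; rfl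
  · rw [slideStage_of_notMem hb, h]; rfl

theorem slideStage_last {T T' : L → Option ℤ} {D : Set L} {v w : ℤ} {b : L} (hb : b ∈ D)
    (h : ∀ x, T b = some x → x < v) (h' : T' b = some w) (hw : w < v) :
    slideStage T T' D v b = some (Sum.inl w) := by
  rw [slideStage, if_neg (by simpa using hb), if_neg, if_pos ⟨w, h', hw⟩, h']
  · rfl
  · rintro ⟨x, hx, hvx⟩
    have := h x hx
    omega

theorem slideStage_dot {T T' : L → Option ℤ} {D : Set L} {v : ℤ} {b : L} (hb : b ∈ D)
    (h : ∀ x, T b = some x → x < v) (h' : ∀ x, T' b = some x → v ≤ x) :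
    slideStage T T' D v b = some (Sum.inr ()) := by
  rw [slideStage, if_neg (by simpa using hb), if_neg, if_neg]
  · rintro ⟨x, hx, hvx⟩
    have := h' x hx
    omega
  · rintro ⟨x, hx, hvx⟩
    have := h x hx
    omega

theorem slideStage_cases (T T' : L → Option ℤ) (v : ℤ) (b : L) :
    (∃ x, T b = some x ∧ v ≤ x) ∨ (∀ x, T b = some x → x < v) ∧
      ((∃ w, T' b = some w ∧ w < v) ∨ ∀ x, T' b = some x → v ≤ x) := by
  by_cases h1 : ∃ x, T b = some x ∧ v ≤ x
  · exact Or.inl h1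
  · push Not at h1
    by_cases h2 : ∃ w, T' b = some w ∧ w < v
    · exact Or.inr ⟨h1, Or.inl h2⟩
    · push Not at h2
      exact Or.inr ⟨h1, Or.inr h2⟩

theorem exists_value_bounds {T T' : L → Option ℤ} (h : {b | T b ≠ none}.Finite)
    (h' : {b | T' b ≠ none}.Finite) :
    ∃ (a : ℤ) (n : ℕ), ∀ b x, T b = some x ∨ T' b = some x → a ≤ x ∧ x < a + n := by
  have hf : {x : ℤ | ∃ b, T b = some x ∨ T' b = some x}.Finite := by
    apply ((h.image fun b => (T b).getD 0).union (h'.image fun b => (T' b).getD 0)).subset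
    rintro x ⟨b, hb | hb⟩
    · exact Or.inl ⟨b, by simp [hb], by simp [hb]⟩
    · exact Or.inr ⟨b, by simp [hb], by simp [hb]⟩
  obtain ⟨lo, hlo⟩ := hf.bddBelow
  obtain ⟨hi, hhi⟩ := hf.bddAbove
  refine ⟨lo, (hi - lo + 1).toNat, fun b x hx => ?_⟩
  have h1 := hlo ⟨b, hx⟩
  have h2 := hhi ⟨b, hx⟩
  omega

theorem slideStage_eq_dot {T T' : L → Option ℤ} {D : Set L} {v : ℤ} {b : L}
    (h : slideStage T T' D v b = some (Sum.inr ())) :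
    b ∈ D ∧ (∀ x, T b = some x → x < v) ∧ ∀ x, T' b = some x → v ≤ x := by
  by_cases hb : b ∈ D
  · refine ⟨hb, ?_⟩
    rcases slideStage_cases T T' v b with ⟨x, h1, h2⟩ | ⟨h1, ⟨w, h2, h3⟩ | h2⟩
    · rw [slideStage_first h1 h2] at h; simp at h
    · rw [slideStage_last hb h1 h2 h3] at h; simp at h
    · exact ⟨h1, h2⟩
  · rw [slideStage_of_notMem hb] at h
    cases hT : T b <;> simp [hT] at h

theorem slideStage_eq_value {T T' : L → Option ℤ} {D : Set L} {v : ℤ} {b : L}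
    (h : slideStage T T' D v b = some (Sum.inl v)) : T b = some v := by
  by_cases hb : b ∈ D
  · rcases slideStage_cases T T' v b with ⟨x, h1, h2⟩ | ⟨h1, ⟨w, h2, h3⟩ | h2⟩
    · rw [slideStage_first h1 h2] at h
      rw [h1]; simpa using h
    · rw [slideStage_last hb h1 h2 h3] at h
      simp only [Option.some.injEq, Sum.inl.injEq] at h
      omega
    · rw [slideStage_dot hb h1 h2] at h; simp at h
  · rw [slideStage_of_notMem hb] at h
    cases hT : T b <;> simp [hT] at h ⊢
    exact h

variable [PartialOrder L]

/-- A description of a slide from `T` to `T'` in terms of the occupied set `P` of the dotted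
tableaux and the set `D` of boxes visited by a dot. -/
structure SlideFacts (T T' : L → Option ℤ) (P D : Set L) : Prop where
  inc : Increasing T
  inc' : Increasing T'
  fin : P.Finite
  conv : P.OrdConnected
  mem_first : ∀ b, T b ≠ none → b ∈ P
  mem_last : ∀ b, T' b ≠ none → b ∈ P
  mem_visited : ∀ b, T b = none → b ∉ D → b ∉ P
  mem_dot : ∀ b, b ∈ D → b ∈ P
  stay : ∀ b, b ∉ D → T' b = T b
  vacate : ∀ b t, b ∈ D → T b = some t → ∃ c, c ⋖ b ∧ c ∈ D ∧ T' c = some t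
  fill : ∀ b w, b ∈ D → T' b = some w → ∃ c, b ⋖ c ∧ c ∈ D ∧ T c = some w
  next : ∀ b c t, b ∈ P → b < c → T c = some t →
    ∃ y ≤ t, T' b = some y ∧ (y = t → b ⋖ c ∧ b ∈ D ∧ c ∈ D)
  minimal : ∀ b, T b = none → b ∈ P → ∀ c, c < b → c ∉ P
  maximal : ∀ b, T' b = none → b ∈ P → ∀ c, b < c → c ∉ P

namespace SlideChain

variable {T T' : L → Option ℤ} {a : ℤ} {n : ℕ} {S : ℕ → L → Option ZDot}

theorem earlier (h : SlideChain T T' a n S) {b : L} {x : ℤ} {k l : ℕ} (hk : k ≤ n) (hl : l ≤ k)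
    (hb : S k b = some (Sum.inl x)) (hx : a + k ≤ x) : S l b = some (Sum.inl x) := by
  induction k with
  | zero => obtain rfl : l = 0 := by omega
            exact hb
  | succ k ih =>
    rcases hl.lt_or_eq with hl | rfl
    · apply ih (by omega) (by omega) _ (by push_cast at hx; omega)
      have hb' := hb
      rw [h.step k (by omega)] at hb'
      rcases swapDot_cases (a + k) (S k) b with h1 | ⟨-, h1, -⟩ | ⟨-, h1, -⟩
      · exact h1.symm.trans hb'
      · exact absurd (hb'.symm.trans h1) (by simp)
      · have := hb'.symm.trans h1
        simp only [Option.some.injEq, Sum.inl.injEq] at this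
        push_cast at hx
        omega
    · exact hb

theorem later (h : SlideChain T T' a n S) {b : L} {x : ℤ} {k l : ℕ} (hk : k ≤ l) (hl : l ≤ n)
    (hb : S k b = some (Sum.inl x)) (hx : x < a + k) : S l b = some (Sum.inl x) := by
  induction l, hk using Nat.le_induction with
  | base => exact hb
  | succ l hkl ih =>
    rw [h.step l (by omega)]
    exact swapDot_int (ih (by omega)) (by omega)

theorem before (h : SlideChain T T' a n S) {b : L} {x : ℤ} {k : ℕ} (hk : k ≤ n)
    (hb : T b = some x) (hx : a + k ≤ x) : S k b = some (Sum.inl x) := by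
  induction k with
  | zero => exact h.eq_first_iff.1 hb
  | succ k ih =>
    push_cast at hx
    rw [h.step k (by omega)]
    exact swapDot_int (ih (by omega) (by omega)) (by omega)

theorem after (h : SlideChain T T' a n S) {b : L} {x : ℤ} {k : ℕ} (hk : k ≤ n)
    (hb : T' b = some x) (hx : x < a + k) : S k b = some (Sum.inl x) := by
  obtain ⟨j, rfl⟩ := Nat.exists_eq_add_of_le hk
  clear hk
  suffices ∀ i ≤ j, S (k + (j - i)) b = some (Sum.inl x) by simpa using this j le_rfl
  intro i
  induction i with
  | zero => intro _; exact h.eq_last_iff.1 hb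
  | succ i ih =>
    intro hi
    have h1 := ih (by omega)
    have e : k + (j - i) = k + (j - (i + 1)) + 1 := by omega
    rw [e, h.step _ (by omega)] at h1
    rcases swapDot_cases (a + (k + (j - (i + 1)) : ℕ)) (S (k + (j - (i + 1)))) b with
      h2 | ⟨-, h2, -⟩ | ⟨-, h2, -⟩
    · exact h2.symm.trans h1
    · exact absurd (h1.symm.trans h2) (by simp)
    · have := h1.symm.trans h2
      simp only [Option.some.injEq, Sum.inl.injEq] at this
      omega

theorem facts (h : SlideChain T T' a n S) :
    SlideFacts T T' {b | S 0 b ≠ none} {b | ∃ k ≤ n, S k b = some (Sum.inr ())} where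
  inc := h.increasing_first
  inc' := h.increasing_last
  fin := h.fin
  conv := h.conv
  mem_first := by
    intro b hb
    obtain ⟨x, hx⟩ := Option.ne_none_iff_exists'.1 hb
    have := h.eq_first_iff.1 hx
    simp [this]
  mem_last := by
    intro b hb
    obtain ⟨x, hx⟩ := Option.ne_none_iff_exists'.1 hb
    have := h.eq_last_iff.1 hx
    exact (h.ne_none_iff le_rfl b).1 (by simp [this])
  mem_visited := by
    intro b hb hD hP
    rw [← h.first, restrictInt_eq_none] at hb
    rcases hb with hb | hb
    · exact hP hb
    · exact hD ⟨0, Nat.zero_le _, hb⟩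
  stay := by
    intro b hb
    have key : ∀ k ≤ n, S k b = S 0 b := by
      intro k
      induction k with
      | zero => intro _; rfl
      | succ k ih =>
        intro hk
        rw [← ih (by omega), h.step k (by omega)]
        rcases swapDot_cases (a + k) (S k) b with h1 | ⟨-, h1, -⟩ | ⟨h1, -, -⟩
        · exact h1
        · exact absurd ⟨k + 1, hk, by rw [h.step k (by omega)]; exact h1⟩ hb
        · exact absurd ⟨k, by omega, h1⟩ hb
    rw [← h.first, ← h.last, restrictInt, restrictInt, key n le_rfl]
  mem_dot := by
    rintro b ⟨k, hk, hb⟩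
    exact (h.ne_none_iff hk b).1 (by simp [hb])
  vacate := by
    rintro b t ⟨l, hl, hbl⟩ hbt
    obtain ⟨h1, h2⟩ := h.range b t (h.eq_first_iff.1 hbt)
    obtain ⟨k, hk⟩ : ∃ k : ℕ, t = a + k := ⟨(t - a).toNat, by omega⟩
    have hkb := h.before (k := k) (by omega) hbt (by omega)
    by_cases hn : ∃ c, Neighbor b c ∧ S k c = some (Sum.inr ())
    · obtain ⟨c, hn, hc⟩ := hn
      refine ⟨c, ?_, ⟨k, by omega, hc⟩, ?_⟩
      · rcases hn with hn | hn
        · have := h.inc k (by omega) b c hn.lt _ _ hkb hc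
          simp only [rank_int, rank_dot] at this; omega
        · exact hn
      · have : S (k + 1) c = some (Sum.inl t) := by
          rw [h.step k (by omega), ← hk]
          exact swapDot_dot hc hn.symm hkb
        exact h.eq_last_iff.2 (h.later (by omega) le_rfl this (by push_cast; omega))
    · exfalso
      have h3 : S (k + 1) b = some (Sum.inl t) := by
        rw [h.step k (by omega), ← hk]
        exact swapDot_value_stay hkb fun c h1 h2 => hn ⟨c, h1, h2⟩
      rcases Nat.lt_or_ge k l with h4 | h4
      · have := h.later (l := l) h4 hl h3 (by push_cast; omega)
        simp [hbl] at this
      · have := h.before (k := l) hl hbt (by omega)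
        simp [hbl] at this
  fill := by
    rintro b t ⟨l, hl, hbl⟩ hbt
    obtain ⟨h1, h2⟩ := h.range' le_rfl (h.eq_last_iff.1 hbt)
    obtain ⟨k, hk⟩ : ∃ k : ℕ, t = a + k := ⟨(t - a).toNat, by omega⟩
    have h3 := h.after (k := k + 1) (by omega) hbt (by push_cast; omega)
    have h3' := h3
    rw [h.step k (by omega), ← hk] at h3'
    rcases swapDot_cases t (S k) b with h4 | ⟨-, h4, -⟩ | ⟨h4, -, c, hn, hc⟩
    · exfalso
      have h5 := h4.symm.trans h3'
      rcases Nat.lt_or_ge k l with h6 | h6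
      · have := h.later (l := l) h6 hl h3 (by push_cast; omega)
        simp [hbl] at this
      · have := h.earlier (by omega) h6 h5 (by omega)
        simp [hbl] at this
    · exact absurd (h3'.symm.trans h4) (by simp)
    · refine ⟨c, ?_, ⟨k + 1, by omega, ?_⟩, ?_⟩
      · rcases hn with hn | hn
        · exact hn
        · have := h.inc k (by omega) c b hn.lt _ _ hc h4
          simp only [rank_int, rank_dot] at this; omega
      · rw [h.step k (by omega), ← hk]
        exact swapDot_value hc hn.symm h4
      · exact h.eq_first_iff.2 (h.earlier (by omega) (Nat.zero_le _) hc (by omega))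
  next := by
    intro b c t hb hbc hct
    obtain ⟨h1, h2⟩ := h.range c t (h.eq_first_iff.1 hct)
    obtain ⟨k, hk⟩ : ∃ k : ℕ, t = a + k := ⟨(t - a).toNat, by omega⟩
    have hkc := h.before (k := k) (by omega) hct (by omega)
    have hkb : S k b ≠ none := (h.ne_none_iff (by omega) b).2 hb
    obtain ⟨x, hx⟩ := Option.ne_none_iff_exists'.1 hkb
    have hlt := h.inc k (by omega) b c hbc _ _ hx hkc
    rcases dot_or_int x with rfl | ⟨w, rfl⟩
    · have hcov := (h.inc k (by omega)).covBy (h.conv' (by omega)) hbc hx hkc (by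
        simp only [rank_int, rank_dot]; omega)
      refine ⟨t, le_rfl, ?_, fun _ => ⟨hcov, ⟨k, by omega, hx⟩, k + 1, by omega, ?_⟩⟩
      · have : S (k + 1) b = some (Sum.inl t) := by
          rw [h.step k (by omega), ← hk]
          exact swapDot_dot hx (Or.inl hcov) hkc
        exact h.eq_last_iff.2 (h.later (by omega) le_rfl this (by push_cast; omega))
      · rw [h.step k (by omega), ← hk]
        exact swapDot_value hkc (Or.inr hcov) hx
    · simp only [rank_int] at hlt
      exact ⟨w, by omega, h.eq_last_iff.2 (h.later (by omega) le_rfl hx (by omega)),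
        fun e => by omega⟩
  minimal := by
    intro b hb hP c hcb hc
    rw [← h.first, restrictInt_eq_none] at hb
    obtain ⟨x, hx⟩ := Option.ne_none_iff_exists'.1 hc
    have := h.inc 0 (Nat.zero_le _) c b hcb x _ hx (hb.resolve_left hP)
    rcases dot_or_int x with rfl | ⟨w, rfl⟩
    · exact lt_irrefl _ this
    · have h2 := h.range c w hx
      simp only [rank_int, rank_dot] at this
      push_cast at this
      omega
  maximal := by
    intro b hb hP c hcb hc
    rw [← h.last, restrictInt_eq_none] at hb
    obtain ⟨x, hx⟩ := Option.ne_none_iff_exists'.1 ((h.ne_none_iff le_rfl c).2 hc)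
    have := h.inc n le_rfl b c hcb _ x (hb.resolve_left ((h.ne_none_iff le_rfl b).2 hP)) hx
    rcases dot_or_int x with rfl | ⟨w, rfl⟩
    · exact lt_irrefl _ this
    · have h2 := h.range' le_rfl hx
      simp only [rank_int, rank_dot] at this
      omega

end SlideChain

/-- Conditions guaranteeing that `T'` arises from `T` by a slide whose dots visit `D`. -/
structure SlideData (T T' : L → Option ℤ) (D : Set L) : Prop where
  inc : Increasing T
  fin : {b | T b ≠ none ∨ b ∈ D}.Finite
  conv : Set.OrdConnected {b | T b ≠ none ∨ b ∈ D}
  minimal : ∀ b ∈ D, T b = none → ∀ c, c < b → T c = none ∧ c ∉ D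
  stay : ∀ b, b ∉ D → T' b = T b
  vacate : ∀ b v, b ∈ D → T b = some v →
    ∃ c ∈ D, Neighbor b c ∧ (∀ x, T c = some x → x < v) ∧ T' c = some v
  fill : ∀ b v, b ∈ D → T' b = some v →
    (∃ c, Neighbor b c ∧ T c = some v) ∧ ∀ x, T b = some x → x < v
  next : ∀ b c v, b ∈ D → Neighbor b c → T c = some v → (∀ x, T b = some x → x < v) →
    (∀ x, T' b = some x → v ≤ x) → T' b = some v ∧ c ∈ D

theorem SlideData.stage_step {T T' : L → Option ℤ} {D : Set L} (h : SlideData T T' D) (v : ℤ) :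
    slideStage T T' D (v + 1) = swapDot v (slideStage T T' D v) := by
  funext b
  by_cases hb : b ∈ D
  · rcases slideStage_cases T T' v b with ⟨x, h1, h2⟩ | ⟨h1, ⟨w, h2, h3⟩ | h2⟩
    · rcases h2.lt_or_eq with h2' | rfl
      · rw [slideStage_first h1 (by omega : v + 1 ≤ x), swapDot_int (slideStage_first h1 h2)
          (by omega)]
      · obtain ⟨c, hc, hn, h3, h4⟩ := h.vacate b v hb h1
        rw [slideStage_dot hb, swapDot_value (slideStage_first h1 le_rfl) hn
          (slideStage_dot hc h3 _)]
        · intro x hx; rw [h4] at hx; simp only [Option.some.injEq] at hx; omega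
        · intro x hx; rw [h1] at hx; simp only [Option.some.injEq] at hx; omega
        · intro x hx
          have := (h.fill b x hb hx).2 v h1
          omega
    · rw [slideStage_last hb _ h2 (by omega : w < v + 1), swapDot_int
        (slideStage_last hb h1 h2 h3) (by omega)]
      intro x hx; have := h1 x hx; omega
    · by_cases h3 : T' b = some v
      · obtain ⟨⟨c, hn, hc⟩, -⟩ := h.fill b v hb h3
        rw [slideStage_last hb _ h3 (by omega), swapDot_dot (slideStage_dot hb h1 h2) hn
          (slideStage_first hc le_rfl)]
        intro x hx; have := h1 x hx; omega
      · rw [slideStage_dot hb, swapDot_dot_stay (slideStage_dot hb h1 h2)]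
        · intro c hn hc
          exact h3 (h.next b c v hb hn (slideStage_eq_value hc) h1 h2).1
        · intro x hx; have := h1 x hx; omega
        · intro x hx
          have h4 := h2 x hx
          have : x ≠ v := fun e => h3 (e ▸ hx)
          omega
  · rw [slideStage_of_notMem hb]
    by_cases h1 : T b = some v
    · rw [swapDot_value_stay, h1]
      · rfl
      · rw [slideStage_of_notMem hb, h1]; rfl
      · intro c hn hc
        obtain ⟨h2, h3, h4⟩ := slideStage_eq_dot hc
        exact hb (h.next c b v h2 hn.symm h1 h3 h4).2
    · rw [swapDot_other, slideStage_of_notMem hb]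
      · rw [slideStage_of_notMem hb]
        cases hT : T b <;> simp [hT] at h1 ⊢
        exact h1
      · intro hc
        exact hb (slideStage_eq_dot hc).1

theorem SlideData.chain {T T' : L → Option ℤ} {D : Set L} (h : SlideData T T' D) :
    ∃ a n S, SlideChain T T' a n S := by
  obtain ⟨a, n, hr⟩ := exists_value_bounds (T := T) (T' := T')
    (h.fin.subset fun b hb => Or.inl hb) (h.fin.subset fun b hb => by
      by_cases hD : b ∈ D
      · exact Or.inr hD
      · left; rwa [← h.stay b hD])
  have hne : ∀ b, slideStage T T' D a b ≠ none ↔ T b ≠ none ∨ b ∈ D := by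
    intro b
    by_cases hb : b ∈ D
    · rcases slideStage_cases T T' a b with ⟨x, h1, h2⟩ | ⟨h1, ⟨w, h2, h3⟩ | h2⟩
      · simp [slideStage_first h1 h2, hb]
      · have := (hr b w (Or.inr h2)).1
        omega
      · simp [slideStage_dot hb h1 h2, hb]
    · rw [slideStage_of_notMem hb]
      simp [hb]
  have hset : {b | slideStage T T' D (a + (0 : ℕ)) b ≠ none} = {b | T b ≠ none ∨ b ∈ D} := by
    ext b
    rw [Nat.cast_zero, add_zero]
    exact hne b
  have hTval : ∀ b x, slideStage T T' D a b = some (Sum.inl x) → T b = some x := by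
    intro b x hx
    by_cases hb : b ∈ D
    · rcases slideStage_cases T T' a b with ⟨x', h1, h2⟩ | ⟨h1, ⟨w, h2, h3⟩ | h2⟩
      · rw [slideStage_first h1 h2] at hx
        rw [h1]; simpa using hx
      · have := (hr b w (Or.inr h2)).1
        omega
      · simp [slideStage_dot hb h1 h2] at hx
    · rw [slideStage_of_notMem hb] at hx
      cases hT : T b <;> simp [hT] at hx ⊢
      exact hx
  have hnone : ∀ b, slideStage T T' D a b = some (Sum.inr ()) → b ∈ D ∧ T b = none := by
    intro b hb
    obtain ⟨h1, h2, -⟩ := slideStage_eq_dot hb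
    refine ⟨h1, ?_⟩
    by_contra h3
    obtain ⟨x, hx⟩ := Option.ne_none_iff_exists'.1 h3
    have h4 := (hr b x (Or.inl hx)).1
    have h5 := h2 x hx
    omega
  have hstep : ∀ k : ℕ, slideStage T T' D (a + (k + 1 : ℕ))
      = swapDot (a + k) (slideStage T T' D (a + k)) := by
    intro k
    rw [← h.stage_step]; push_cast; rw [add_assoc]
  have hsw : ∀ k : ℕ, slideStage T T' D (a + k) = swapUp a k (slideStage T T' D a) := by
    intro k
    induction k with
    | zero => simp [swapUp]
    | succ k ih => rw [hstep, ih]; rfl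
  refine ⟨a, n, fun k => slideStage T T' D (a + k), ?_, ?_, fun k _ => hstep k, ?_, ?_, ?_, ?_⟩
  · funext b
    simp only [Nat.cast_zero, add_zero]
    cases hT : T b with
    | none =>
      rw [restrictInt_eq_none]
      rcases hs : slideStage T T' D a b with _ | (w | u)
      · exact Or.inl rfl
      · have := hTval b w hs
        simp [hT] at this
      · exact Or.inr rfl
    | some x =>
      rw [restrictInt_eq_some]
      exact slideStage_first hT (hr b x (Or.inl hT)).1
  · funext b
    by_cases hb : b ∈ D
    · have h1 : ∀ x, T b = some x → x < a + n := fun x hx => (hr b x (Or.inl hx)).2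
      cases hT : T' b with
      | none =>
        rw [restrictInt_eq_none]
        exact Or.inr (slideStage_dot hb h1 (by simp [hT]))
      | some w =>
        rw [restrictInt_eq_some]
        exact slideStage_last hb h1 hT (hr b w (Or.inr hT)).2
    · rw [h.stay b hb]
      simp only [restrictInt]
      rw [slideStage_of_notMem hb]
      cases T b <;> rfl
  · intro k _
    rw [hsw]
    refine swapUp_inc ?_ ?_ k
    · intro b c hbc x y hx hy
      rcases dot_or_int x with rfl | ⟨w, rfl⟩ <;> rcases dot_or_int y with rfl | ⟨w', rfl⟩
      · exact absurd (hnone b hx).1 (h.minimal c (hnone c hy).1 (hnone c hy).2 b hbc).2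
      · have := (hr c w' (Or.inl (hTval c w' hy))).1
        simp only [rank_int, rank_dot]; omega
      · have := (h.minimal c (hnone c hy).1 (hnone c hy).2 b hbc).1
        rw [hTval b w hx] at this
        simp at this
      · have := h.inc b c hbc w w' (hTval b w hx) (hTval c w' hy)
        simp only [rank_int]; omega
    · have := h.conv
      rw [← hset] at this
      simpa using this
  · rw [hset]; exact h.fin
  · rw [hset]; exact h.conv
  · intro b x hx
    rw [Nat.cast_zero, add_zero] at hx
    exact hr b x (Or.inl (hTval b x hx))

end SlideFacts

/-! ### Slides preserve the weak class of the row word -/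

/-- The entries in column `c` of the `m` rows starting at row `k`, read upwards. -/
def colList (t : ℕ → ℕ → Option ℤ) : ℕ → ℕ → ℕ → List ℤ
  | _, 0, _ => []
  | k, m + 1, c => colList t (k + 1) m c ++ (t k c).toList

/-- The row word of the first `n` columns of the `m` rows starting at row `k`. -/
def wordRows (t : ℕ → ℕ → Option ℤ) : ℕ → ℕ → ℕ → List ℤ
  | _, 0, _ => []
  | k, m + 1, n => wordRows t (k + 1) m n ++ rowList (t k) n

theorem colList_succ (t : ℕ → ℕ → Option ℤ) (k m c : ℕ) :
    colList t k (m + 1) c = colList t (k + 1) m c ++ (t k c).toList := rfl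

theorem wordRows_succ (t : ℕ → ℕ → Option ℤ) (k m n : ℕ) :
    wordRows t k (m + 1) n = wordRows t (k + 1) m n ++ rowList (t k) n := rfl

theorem mem_colList {t : ℕ → ℕ → Option ℤ} {k m c : ℕ} {x : ℤ} :
    x ∈ colList t k m c ↔ ∃ i, k ≤ i ∧ i < k + m ∧ t i c = some x := by
  induction m generalizing k with
  | zero => simp only [colList, List.not_mem_nil, false_iff]; rintro ⟨i, h1, h2, -⟩; omega
  | succ m ih =>
    rw [colList_succ, List.mem_append, ih, Option.mem_toList]
    constructor
    · rintro (⟨i, h1, h2, h3⟩ | h)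
      · exact ⟨i, by omega, by omega, h3⟩
      · exact ⟨k, le_rfl, by omega, h⟩
    · rintro ⟨i, h1, h2, h3⟩
      rcases h1.eq_or_lt with rfl | h1
      · exact Or.inr h3
      · exact Or.inl ⟨i, h1, by omega, h3⟩

theorem colList_ne_nil {t : ℕ → ℕ → Option ℤ} {k m c : ℕ} (h : colList t k m c ≠ []) :
    ∃ i x, k ≤ i ∧ t i c = some x := by
  obtain ⟨x, hx⟩ := List.exists_mem_of_ne_nil _ h
  obtain ⟨i, h1, -, h2⟩ := mem_colList.1 hx
  exact ⟨i, x, h1, h2⟩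

theorem colList_eq_nil {t : ℕ → ℕ → Option ℤ} {k m c : ℕ} (h : ∀ i, k ≤ i → t i c = none) :
    colList t k m c = [] := by
  by_contra h'
  obtain ⟨i, x, h1, h2⟩ := colList_ne_nil h'
  simp [h i h1] at h2

theorem colList_last {t : ℕ → ℕ → Option ℤ} {k m c : ℕ} {Z : List ℤ} {g : ℤ}
    (h : colList t k m c = Z ++ [g]) :
    ∃ i, k ≤ i ∧ t i c = some g ∧ ∀ j, k ≤ j → j < i → t j c = none := by
  induction m generalizing k with
  | zero => simp [colList] at h
  | succ m ih =>
    rw [colList_succ] at h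
    cases hk : t k c with
    | none =>
      rw [hk] at h
      obtain ⟨i, h1, h2, h3⟩ := ih (k := k + 1) (by simpa using h)
      refine ⟨i, by omega, h2, fun j hj hji => ?_⟩
      rcases hj.eq_or_lt with rfl | hj
      · exact hk
      · exact h3 j hj hji
    | some x =>
      rw [hk] at h
      obtain rfl : x = g := by
        have := congrArg List.getLast? h
        simpa using this
      exact ⟨k, le_rfl, hk, fun j _ _ => by omega⟩

theorem wordRows_eq_nil {t : ℕ → ℕ → Option ℤ} {k m n : ℕ}
    (h : ∀ i c, k ≤ i → c < n → t i c = none) : wordRows t k m n = [] := by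
  induction m generalizing k with
  | zero => rfl
  | succ m ih =>
    rw [wordRows_succ, ih fun i c hi hc => h i c (by omega) hc, List.nil_append,
      rowList_eq_nil.2 fun c hc => h k c le_rfl hc]

/-- The facts about a slide between type B tableaux, in terms of plane coordinates. -/
structure PlaneSlide (t f : ℕ → ℕ → Option ℤ) (p d : ℕ → ℕ → Prop) : Prop where
  diag : ∀ r c, p r c → r ≤ c
  conv : ∀ r c r' c' r'' c'', p r c → p r'' c'' → r ≤ r' → r' ≤ r'' → c ≤ c' → c' ≤ c'' →
    r' ≤ c' → p r' c'
  mem_first : ∀ r c x, t r c = some x → p r c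
  mem_last : ∀ r c x, f r c = some x → p r c
  mem_visited : ∀ r c, t r c = none → ¬ d r c → ¬ p r c
  mem_dot : ∀ r c, d r c → p r c
  inc : ∀ r c r' c' x x', t r c = some x → t r' c' = some x' → r ≤ r' → c ≤ c' →
    r + c < r' + c' → x < x'
  inc' : ∀ r c r' c' x x', f r c = some x → f r' c' = some x' → r ≤ r' → c ≤ c' →
    r + c < r' + c' → x < x'
  stay : ∀ r c, ¬ d r c → f r c = t r c
  vacate : ∀ r c x, d r c → t r c = some x →
    (∃ c0, c = c0 + 1 ∧ d r c0 ∧ f r c0 = some x) ∨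
      ∃ r0, r = r0 + 1 ∧ d r0 c ∧ f r0 c = some x
  fill : ∀ r c x, d r c → f r c = some x → t r (c + 1) = some x ∨ t (r + 1) c = some x
  next : ∀ r c r' c' x, p r c → t r' c' = some x → r ≤ r' → c ≤ c' → r + c < r' + c' →
    ∃ y ≤ x, f r c = some y ∧ (y = x → r' + c' = r + c + 1 ∧ d r' c')
  minimal : ∀ r c r' c', t r c = none → p r c → r' ≤ r → c' ≤ c → r' + c' < r + c → ¬ p r' c'
  maximal : ∀ r c r' c', f r c = none → p r c → r ≤ r' → c ≤ c' → r + c < r' + c' → ¬ p r' c'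

theorem shiftedBox_covBy {a b : ShiftedBox} (h : a ⋖ b) :
    (b.1.1 = a.1.1 ∧ b.1.2 = a.1.2 + 1) ∨ (b.1.1 = a.1.1 + 1 ∧ b.1.2 = a.1.2) := by
  obtain ⟨⟨r, c⟩, hrc⟩ := a
  obtain ⟨⟨r', c'⟩, hrc'⟩ := b
  have hlt := h.lt
  rw [← Subtype.coe_lt_coe, Prod.lt_iff] at hlt
  simp only at hlt hrc hrc' ⊢
  rcases Nat.lt_or_ge c c' with h1 | h1
  · have hm : r ≤ c + 1 := by omega
    by_contra hne
    refine h.2 (c := ⟨(r, c + 1), hm⟩) ?_ ?_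
    · rw [← Subtype.coe_lt_coe, Prod.lt_iff]
      simp
    · rw [← Subtype.coe_lt_coe, Prod.lt_iff]
      simp only
      omega
  · have hm : r + 1 ≤ c := by omega
    by_contra hne
    refine h.2 (c := ⟨(r + 1, c), hm⟩) ?_ ?_
    · rw [← Subtype.coe_lt_coe, Prod.lt_iff]
      simp
    · rw [← Subtype.coe_lt_coe, Prod.lt_iff]
      simp only
      omega

theorem shiftedBox_lt {r c r' c' : ℕ} {h : r ≤ c} {h' : r' ≤ c'} (h1 : r ≤ r') (h2 : c ≤ c')
    (h3 : r + c < r' + c') : (⟨(r, c), h⟩ : ShiftedBox) < ⟨(r', c'), h'⟩ := by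
  rw [← Subtype.coe_lt_coe, Prod.lt_iff]
  simp only
  omega

theorem extendToPlane_of_le (T : ShiftedBox → Option ℤ) {r c : ℕ} (h : r ≤ c) :
    extendToPlane T (r, c) = T ⟨(r, c), h⟩ := dif_pos h

theorem extendToPlane_some {T : ShiftedBox → Option ℤ} {r c : ℕ} {x : ℤ}
    (h : extendToPlane T (r, c) = some x) : ∃ hrc : r ≤ c, T ⟨(r, c), hrc⟩ = some x := by
  by_cases hrc : r ≤ c
  · exact ⟨hrc, by rwa [extendToPlane_of_le T hrc] at h⟩
  · simp [extendToPlane, hrc] at h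

theorem SlideFacts.plane {T T' : ShiftedBox → Option ℤ} {P D : Set ShiftedBox}
    (h : SlideFacts T T' P D) :
    PlaneSlide (fun r c => extendToPlane T (r, c)) (fun r c => extendToPlane T' (r, c))
      (fun r c => ∃ hrc : r ≤ c, (⟨(r, c), hrc⟩ : ShiftedBox) ∈ P)
      (fun r c => ∃ hrc : r ≤ c, (⟨(r, c), hrc⟩ : ShiftedBox) ∈ D) where
  diag r c := fun ⟨h, _⟩ => h
  conv := by
    rintro r c r' c' r'' c'' ⟨h1, hP⟩ ⟨h2, hP'⟩ h3 h4 h5 h6 h7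
    exact ⟨h7, h.conv.out hP hP' ⟨⟨h3, h5⟩, ⟨h4, h6⟩⟩⟩
  mem_first r c x hx := by
    obtain ⟨hrc, hx⟩ := extendToPlane_some hx
    exact ⟨hrc, h.mem_first _ (by simp [hx])⟩
  mem_last r c x hx := by
    obtain ⟨hrc, hx⟩ := extendToPlane_some hx
    exact ⟨hrc, h.mem_last _ (by simp [hx])⟩
  mem_visited := by
    rintro r c ht hd ⟨hrc, hp⟩
    rw [extendToPlane_of_le T hrc] at ht
    exact h.mem_visited _ ht (fun h => hd ⟨hrc, h⟩) hp
  mem_dot := by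
    rintro r c ⟨hrc, hd⟩
    exact ⟨hrc, h.mem_dot _ hd⟩
  inc := by
    intro r c r' c' x x' h1 h2 h3 h4 h5
    obtain ⟨hrc, h1⟩ := extendToPlane_some h1
    obtain ⟨hrc', h2⟩ := extendToPlane_some h2
    exact h.inc _ _ (shiftedBox_lt h3 h4 h5) _ _ h1 h2
  inc' := by
    intro r c r' c' x x' h1 h2 h3 h4 h5
    obtain ⟨hrc, h1⟩ := extendToPlane_some h1
    obtain ⟨hrc', h2⟩ := extendToPlane_some h2
    exact h.inc' _ _ (shiftedBox_lt h3 h4 h5) _ _ h1 h2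
  stay := by
    intro r c hd
    by_cases hrc : r ≤ c
    · simp only [extendToPlane_of_le _ hrc]
      exact h.stay _ fun h => hd ⟨hrc, h⟩
    · simp [extendToPlane, hrc]
  vacate := by
    rintro r c x ⟨hrc, hd⟩ hx
    rw [extendToPlane_of_le T hrc] at hx
    obtain ⟨⟨⟨r', c'⟩, hrc'⟩, h1, h2, h3⟩ := h.vacate _ _ hd hx
    rcases shiftedBox_covBy h1 with ⟨e1, e2⟩ | ⟨e1, e2⟩ <;> simp only at e1 e2 hrc' <;> subst e1 e2
    · exact Or.inl ⟨c', rfl, ⟨hrc', h2⟩, by rwa [extendToPlane_of_le _ hrc']⟩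
    · exact Or.inr ⟨r', rfl, ⟨hrc', h2⟩, by rwa [extendToPlane_of_le _ hrc']⟩
  fill := by
    rintro r c x ⟨hrc, hd⟩ hx
    rw [extendToPlane_of_le _ hrc] at hx
    obtain ⟨⟨⟨r', c'⟩, hrc'⟩, h1, h2, h3⟩ := h.fill _ _ hd hx
    rcases shiftedBox_covBy h1 with ⟨e1, e2⟩ | ⟨e1, e2⟩ <;> simp only at e1 e2 hrc' <;> subst e1 e2
    · exact Or.inl (by rwa [extendToPlane_of_le _ hrc'])
    · exact Or.inr (by rwa [extendToPlane_of_le _ hrc'])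
  next := by
    rintro r c r' c' x ⟨hrc, hp⟩ hx h1 h2 h3
    obtain ⟨hrc', hx⟩ := extendToPlane_some hx
    obtain ⟨y, hy, h4, h5⟩ := h.next _ _ _ hp (shiftedBox_lt h1 h2 h3) hx
    refine ⟨y, hy, by rwa [extendToPlane_of_le _ hrc], fun e => ?_⟩
    obtain ⟨h6, -, h7⟩ := h5 e
    refine ⟨?_, hrc', h7⟩
    have := shiftedBox_covBy h6
    simp only at this
    omega
  minimal := by
    rintro r c r' c' ht ⟨hrc, hp⟩ h1 h2 h3 ⟨hrc', hp'⟩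
    rw [extendToPlane_of_le _ hrc] at ht
    exact h.minimal _ ht hp _ (shiftedBox_lt h1 h2 h3) hp'
  maximal := by
    rintro r c r' c' ht ⟨hrc, hp⟩ h1 h2 h3 ⟨hrc', hp'⟩
    rw [extendToPlane_of_le _ hrc] at ht
    exact h.maximal _ ht hp _ (shiftedBox_lt h1 h2 h3) hp'

/-- The row directly above row `r`. -/
def rowAbove (f : ℕ → ℕ → Option ℤ) : ℕ → ℕ → Option ℤ
  | 0, _ => none
  | r + 1, c => f r c

theorem rowAbove_some {f : ℕ → ℕ → Option ℤ} {r c : ℕ} {x : ℤ} (h : rowAbove f r c = some x) :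
    ∃ q, r = q + 1 ∧ f q c = some x := by
  cases r with
  | zero => simp [rowAbove] at h
  | succ q => exact ⟨q, rfl, h⟩

theorem rowList_ne_nil {f : ℕ → Option ℤ} {n : ℕ} (h : rowList f n ≠ []) :
    ∃ c < n, ∃ x, f c = some x := by
  obtain ⟨x, hx⟩ := List.exists_mem_of_ne_nil _ h
  obtain ⟨c, h1, h2⟩ := mem_rowList.1 hx
  exact ⟨c, h1, x, h2⟩

namespace PlaneSlide

variable {t f : ℕ → ℕ → Option ℤ} {p d : ℕ → ℕ → Prop}

theorem colList_pairwise (h : PlaneSlide t f p d) (k m c : ℕ) :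
    (colList t k m c).Pairwise (· > ·) := by
  induction m generalizing k with
  | zero => simp [colList]
  | succ m ih =>
    rw [colList_succ, List.pairwise_append]
    refine ⟨ih _, by cases t k c <;> simp, ?_⟩
    intro a ha b hb
    obtain ⟨i, h1, -, h2⟩ := mem_colList.1 ha
    exact h.inc k c i c b a (by simpa using hb) h2 (by omega) le_rfl (by omega)

/-- The last column of a family of rows may be split off. -/
theorem peel (h : PlaneSlide t f p d) (k m n : ℕ) :
    ck (wordRows t k m (n + 1)) = ck (wordRows t k m n) * ck (colList t k m n) := by
  induction m generalizing k with
  | zero => rfl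
  | succ m ih =>
    have inc : (rowList (t k) n).Pairwise (· < ·) :=
      rowList_pairwise (fun c c' x x' hc h1 h2 => h.inc k c k c' x x' h1 h2 le_rfl hc.le
        (by omega)) n
    rw [wordRows_succ, wordRows_succ, colList_succ, rowList_succ]
    simp only [ck_append]
    rw [ih]
    cases hk : t k n with
    | some x =>
      have := hook (colList t (k + 1) m n) (rowList (t k) n) x (h.colList_pairwise _ _ _) inc
        (by
          intro s hs
          obtain ⟨c, h1, h2⟩ := mem_rowList.1 hs
          exact h.inc k c k n s x h2 hk le_rfl h1.le (by omega))
        (by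
          intro z hz
          obtain ⟨i, h1, -, h2⟩ := mem_colList.1 hz
          exact h.inc k n i n x z hk h2 (by omega) le_rfl (by omega))
      have e : ck (some x).toList = lt x := rfl
      rw [e]
      simp only [mul_assoc] at this ⊢
      rw [this]
    | none =>
      have e : ck (none : Option ℤ).toList = 1 := rfl
      rw [e, mul_one, mul_one]
      by_cases h1 : colList t (k + 1) m n = []
      · rw [h1, ck_nil, mul_one, mul_one]
      by_cases h2 : rowList (t k) n = []
      · rw [h2, ck_nil, mul_one, mul_one]
      exfalso
      obtain ⟨i, x, hi, hx⟩ := colList_ne_nil h1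
      obtain ⟨c, hc, y, hy⟩ := rowList_ne_nil h2
      have p1 := h.mem_first _ _ _ hx
      have p2 := h.mem_first _ _ _ hy
      have p3 := h.diag _ _ p2
      exact h.minimal k n k c hk (h.conv k c k n i n p2 p1 le_rfl (by omega) hc.le le_rfl
        (by omega)) le_rfl hc.le (by omega) p2

theorem rowSlide (h : PlaneSlide t f p d) (r m : ℕ)
    (hm : ∀ i c, r + 1 + m ≤ i → t i c = none) :
    RowSlide (fun n => ck (wordRows t (r + 1) m n)) (fun c => colList t (r + 1) m c)
      (t r) (f r) (rowAbove f r) r (d r) where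
  diag := by
    rw [wordRows_eq_nil, ck_nil]
    intro i c hi hc
    by_contra hn
    obtain ⟨x, hx⟩ := Option.ne_none_iff_exists'.1 hn
    have := h.diag _ _ (h.mem_first _ _ _ hx)
    omega
  peel c := h.peel _ _ _
  col_dec c := h.colList_pairwise _ _ _
  col_diag c hc := colList_eq_nil fun i hi => by
    by_contra hn
    obtain ⟨x, hx⟩ := Option.ne_none_iff_exists'.1 hn
    have := h.diag _ _ (h.mem_first _ _ _ hx)
    omega
  R_lt c x hx z hz := by
    obtain ⟨i, h1, -, h2⟩ := mem_colList.1 hz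
    exact h.inc _ _ _ _ _ _ hx h2 (by omega) le_rfl (by omega)
  F_lt_next c x hx z hz := by
    obtain ⟨i, h1, -, h2⟩ := mem_colList.1 hz
    obtain ⟨y, h3, h4, h5⟩ := h.next r c i (c + 1) z (h.mem_last _ _ _ hx) h2 (by omega) (by omega)
      (by omega)
    obtain rfl : x = y := by simpa [hx] using h4
    exact lt_of_le_of_ne h3 fun e => by have := h5 e; omega
  F_le c x hx z hz := by
    obtain ⟨i, h1, -, h2⟩ := mem_colList.1 hz
    obtain ⟨y, h3, h4, h5⟩ := h.next r c i c z (h.mem_last _ _ _ hx) h2 (by omega) (by omega)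
      (by omega)
    obtain rfl : x = y := by simpa [hx] using h4
    exact h3
  R_inc c c' x x' hc h1 h2 := h.inc _ _ _ _ _ _ h1 h2 le_rfl hc.le (by omega)
  F_inc c c' x x' hc h1 h2 := h.inc' _ _ _ _ _ _ h1 h2 le_rfl hc.le (by omega)
  A_inc c c' x x' hc h1 h2 := by
    obtain ⟨q, rfl, h1⟩ := rowAbove_some h1
    exact h.inc' _ _ _ _ _ _ h1 h2 le_rfl hc.le (by omega)
  A_le_R c a x ha hx := by
    obtain ⟨q, rfl, ha⟩ := rowAbove_some ha
    obtain ⟨y, h3, h4, h5⟩ := h.next q c (q + 1) c x (h.mem_last _ _ _ ha) hx (by omega) (by omega)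
      (by omega)
    obtain rfl : a = y := Option.some.inj (ha.symm.trans h4)
    exact h3
  A_lt_F c a x ha hx := by
    obtain ⟨q, rfl, ha⟩ := rowAbove_some ha
    exact h.inc' _ _ _ _ _ _ ha hx (by omega) le_rfl (by omega)
  A_lt_R_next c a x ha hx := by
    obtain ⟨q, rfl, ha⟩ := rowAbove_some ha
    obtain ⟨y, h3, h4, h5⟩ := h.next q c (q + 1) (c + 1) x (h.mem_last _ _ _ ha) hx (by omega)
      (by omega) (by omega)
    obtain rfl : a = y := Option.some.inj (ha.symm.trans h4)
    exact lt_of_le_of_ne h3 fun e => by have := h5 e; omega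
  F_le_R_next c x z hx hz := by
    obtain ⟨y, h3, h4, h5⟩ := h.next r c r (c + 1) z (h.mem_last _ _ _ hx) hz (by omega)
      (by omega) (by omega)
    obtain rfl : x = y := by simpa [hx] using h4
    exact h3
  col_last c Z g Z' y hF h1 h2 := by
    obtain ⟨x, hx⟩ := Option.ne_none_iff_exists'.1 hF
    obtain ⟨i, h3, h4, h5⟩ := colList_last h1
    obtain ⟨j, h6, h7, h8⟩ := colList_last h2
    have hp := h.mem_last _ _ _ hx
    have hi := h.mem_first _ _ _ h4
    have hj := h.mem_first _ _ _ h7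
    have hij : i ≤ j := by
      by_contra hij
      have := h.diag _ _ hi
      refine h.minimal j c r c (h5 j h6 (by omega)) ?_ (by omega) le_rfl (by omega) hp
      exact h.conv r c j c i c hp hi (by omega) (by omega) le_rfl le_rfl (by omega)
    exact h.inc _ _ _ _ _ _ h4 h7 hij (by omega) (by omega)
  A_none c hc hA := by
    have hp : ∃ k, r ≤ k ∧ p k c := by
      rcases hc with hc | hc | hc
      · obtain ⟨x, hx⟩ := Option.ne_none_iff_exists'.1 hc
        exact ⟨r, le_rfl, h.mem_last _ _ _ hx⟩
      · obtain ⟨x, hx⟩ := Option.ne_none_iff_exists'.1 hc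
        exact ⟨r, le_rfl, h.mem_first _ _ _ hx⟩
      · obtain ⟨i, x, hi, hx⟩ := colList_ne_nil hc
        exact ⟨i, by omega, h.mem_first _ _ _ hx⟩
    obtain ⟨k, hk, hp⟩ := hp
    by_contra hn
    obtain ⟨c', hc', x, hx⟩ := rowList_ne_nil hn
    obtain ⟨q, rfl, hx⟩ := rowAbove_some hx
    have := h.diag _ _ hp
    exact h.maximal q c k c hA (h.conv q c' q c k c (h.mem_last _ _ _ hx) hp le_rfl (by omega)
      (by omega) le_rfl (by omega)) (by omega) le_rfl (by omega) hp
  A_contig c hA hA' := by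
    obtain ⟨y, hy⟩ := Option.ne_none_iff_exists'.1 hA'
    by_contra hn
    obtain ⟨c', hc', x, hx⟩ := rowList_ne_nil hn
    obtain ⟨q, rfl, hx⟩ := rowAbove_some hx
    have p1 := h.mem_last _ _ _ hx
    have p2 := h.mem_last q (c + 1) _ hy
    have := h.diag _ _ p1
    exact h.maximal q c q (c + 1) hA (h.conv q c' q c q (c + 1) p1 p2 le_rfl le_rfl
      (by omega) (by omega) (by omega)) le_rfl (by omega) (by omega) p2
  F_none c hF hc := by
    have hp : ∃ k, r ≤ k ∧ p k (c + 1) := by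
      rcases hc with hc | hc | hc
      · obtain ⟨x, hx⟩ := Option.ne_none_iff_exists'.1 hc
        exact ⟨r, le_rfl, h.mem_last _ _ _ hx⟩
      · obtain ⟨x, hx⟩ := Option.ne_none_iff_exists'.1 hc
        exact ⟨r, le_rfl, h.mem_first _ _ _ hx⟩
      · obtain ⟨i, x, hi, hx⟩ := colList_ne_nil hc
        exact ⟨i, by omega, h.mem_first _ _ _ hx⟩
    obtain ⟨k, hk, hp⟩ := hp
    constructor
    · by_contra hn
      obtain ⟨c', hc', x, hx⟩ := rowList_ne_nil hn
      have p1 := h.mem_last _ _ _ hx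
      have := h.diag _ _ p1
      exact h.maximal r c k (c + 1) hF (h.conv r c' r c k (c + 1) p1 hp le_rfl (by omega)
        (by omega) (by omega) (by omega)) (by omega) (by omega) (by omega) hp
    · by_contra hn
      rw [not_or] at hn
      obtain ⟨c', hc', x, hx⟩ := rowList_ne_nil hn.1
      obtain ⟨q, rfl, hx⟩ := rowAbove_some hx
      have p1 := h.mem_last _ _ _ hx
      have := h.diag _ _ p1
      exact h.maximal (q + 1) c k (c + 1) hF (h.conv q c' (q + 1) c k (c + 1) p1 hp (by omega)
        (by omega) (by omega) (by omega) (by omega)) (by omega) (by omega) (by omega) hp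
  F_diag c hc := by
    by_contra hn
    obtain ⟨x, hx⟩ := Option.ne_none_iff_exists'.1 hn
    have := h.diag _ _ (h.mem_last _ _ _ hx)
    omega
  R_diag c hc := by
    by_contra hn
    obtain ⟨x, hx⟩ := Option.ne_none_iff_exists'.1 hn
    have := h.diag _ _ (h.mem_first _ _ _ hx)
    omega
  A_diag c hc := by
    by_contra hn
    obtain ⟨x, hx⟩ := Option.ne_none_iff_exists'.1 hn
    obtain ⟨q, rfl, hx⟩ := rowAbove_some hx
    have := h.diag _ _ (h.mem_last _ _ _ hx)
    omega
  A_top hr c := by subst hr; rfl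
  corner c hF h1 h2 := by
    obtain ⟨x, hx⟩ := Option.ne_none_iff_exists'.1 hF
    have p1 := h.mem_last _ _ _ hx
    have hrc := h.diag _ _ p1
    have hcr : c = r := by
      by_contra hne
      obtain ⟨i, y, hi, hy⟩ := colList_ne_nil h1
      have p2 := h.mem_first _ _ _ hy
      have hs : t (r + 1) c ≠ none := fun hs =>
        h.minimal (r + 1) c r c hs (h.conv r c (r + 1) c i (c + 1) p1 p2 (by omega) (by omega)
          le_rfl (by omega) (by omega)) (by omega) le_rfl (by omega) p1
      obtain ⟨z, hz⟩ := Option.ne_none_iff_exists'.1 hs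
      have : z ∈ colList t (r + 1) m c := by
        refine mem_colList.2 ⟨r + 1, le_rfl, ?_, hz⟩
        by_contra hle
        exact hs (hm _ _ (by omega))
      rw [h2] at this
      simp at this
    refine ⟨hcr, ?_⟩
    subst hcr
    cases m with
    | zero => exact absurd rfl h1
    | succ m =>
      have e : colList t (c + 1 + 1) m (c + 1) = [] := colList_eq_nil fun i hi => by
        by_contra hn
        obtain ⟨x, hx⟩ := Option.ne_none_iff_exists'.1 hn
        have := h.diag _ _ (h.mem_first _ _ _ hx)
        omega
      rw [colList_succ, e, List.nil_append] at h1 ⊢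
      cases hy : t (c + 1) (c + 1) with
      | none => simp [hy] at h1
      | some y => exact ⟨y, rfl⟩
  stay c hd := h.stay r c hd
  fill c x hd hx := by
    obtain ⟨y, h3, h4, h5⟩ := h.next r c r (c + 1) x (h.mem_dot _ _ hd) hx (by omega)
      (by omega) (by omega)
    by_cases hyx : y = x
    · exact Or.inl ⟨hyx ▸ h4, (h5 hyx).2⟩
    · rcases h.fill r c y hd h4 with h6 | h6
      · exact absurd (by simpa [hx] using h6.symm) hyx
      · cases m with
        | zero => simp [hm _ c le_rfl] at h6
        | succ m => exact Or.inr ⟨_, y, h4, by rw [colList_succ, h6]; rfl, hyx⟩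
  vacate c x hd hx := by
    rcases h.vacate r c x hd hx with ⟨c0, h1, h2⟩ | ⟨r0, rfl, -, h2⟩
    · exact Or.inr ⟨c0, h1, h2⟩
    · exact Or.inl h2
  fill_end c hd hx := by
    cases hy : f r c with
    | none => exact Or.inl rfl
    | some y =>
      right
      rcases h.fill r c y hd hy with h6 | h6
      · simp [hx] at h6
      · cases m with
        | zero => simp [hm _ c le_rfl] at h6
        | succ m => exact ⟨_, y, rfl, by rw [colList_succ, h6]; rfl⟩
  start c hd hR := by
    have key := fun c' (hc' : c' < c) => h.minimal r c r c' hR (h.mem_dot _ _ hd) le_rfl hc'.le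
      (by omega)
    constructor
    · by_contra hn
      obtain ⟨c', hc', x, hx⟩ := rowList_ne_nil hn
      exact key c' hc' (h.mem_first _ _ _ hx)
    · by_contra hn
      obtain ⟨c', hc', x, hx⟩ := rowList_ne_nil hn
      exact key c' hc' (h.mem_last _ _ _ hx)
  gap c hR hd := by
    by_cases hcol : colList t (r + 1) m c = []
    · exact Or.inr hcol
    left
    obtain ⟨i, x, hi, hx⟩ := colList_ne_nil hcol
    have hp := h.mem_first _ _ _ hx
    have key : ∀ c' < c, ¬ p r c' := fun c' hc' hp' => by
      have := h.diag _ _ hp'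
      exact h.mem_visited r c hR hd (h.conv r c' r c i c hp' hp le_rfl (by omega) hc'.le le_rfl
        (by omega))
    constructor
    · by_contra hn
      obtain ⟨c', hc', x, hx⟩ := rowList_ne_nil hn
      exact key c' hc' (h.mem_first _ _ _ hx)
    · by_contra hn
      obtain ⟨c', hc', x, hx⟩ := rowList_ne_nil hn
      exact key c' hc' (h.mem_last _ _ _ hx)

end PlaneSlide

/-- The row word of the first `r` rows and `n` columns. -/
def upWord (f : ℕ → ℕ → Option ℤ) : ℕ → ℕ → List ℤ
  | 0, _ => []
  | r + 1, n => rowList (f r) n ++ upWord f r n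

theorem upWord_succ (f : ℕ → ℕ → Option ℤ) (r n : ℕ) :
    upWord f (r + 1) n = rowList (f r) n ++ upWord f r n := rfl

theorem wordRows_append_upWord (t : ℕ → ℕ → Option ℤ) (k m n : ℕ) :
    wordRows t k m n ++ upWord t k n = upWord t (k + m) n := by
  induction m generalizing k with
  | zero => rfl
  | succ m ih =>
    rw [wordRows_succ, List.append_assoc, ← upWord_succ, ih, show k + 1 + m = k + (m + 1) by omega]

theorem upWord_rowAbove (f : ℕ → ℕ → Option ℤ) (r n : ℕ) :
    ∃ w, upWord f r n = rowList (rowAbove f r) n ++ w := by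
  cases r with
  | zero => exact ⟨[], by simp [upWord, rowList, rowAbove]⟩
  | succ r => exact ⟨_, rfl⟩

theorem rowList_stable {f : ℕ → Option ℤ} {n k : ℕ} (h : ∀ c, n ≤ c → f c = none) :
    rowList f (n + k) = rowList f n := by
  induction k with
  | zero => rfl
  | succ k ih => rw [← add_assoc, rowList_succ, ih, h _ (by omega)]; simp

theorem upWord_stable {f : ℕ → ℕ → Option ℤ} {m n m' n' : ℕ}
    (h : ∀ r c, f r c ≠ none → r < m ∧ c < n) (hm : m ≤ m') (hn : n ≤ n') :
    upWord f m' n' = upWord f m n := by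
  obtain ⟨k, rfl⟩ := Nat.exists_eq_add_of_le hm
  obtain ⟨l, rfl⟩ := Nat.exists_eq_add_of_le hn
  have hrow : ∀ r, rowList (f r) (n + l) = rowList (f r) n := fun r =>
    rowList_stable fun c hc => by
      by_contra h'
      have := h r c h'
      omega
  have h1 : ∀ r, upWord f r (n + l) = upWord f r n := fun r => by
    induction r with
    | zero => rfl
    | succ r ih => rw [upWord_succ, upWord_succ, ih, hrow]
  rw [h1]
  clear h1 hrow hm hn
  induction k with
  | zero => rfl
  | succ k ih =>
    rw [← add_assoc, upWord_succ, ih, rowList_eq_nil.2, List.nil_append]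
    intro c _
    by_contra h'
    have := h _ _ h'
    omega

theorem rowWord_eq_upWord (T : ℕ × ℕ → Option ℤ) (m n : ℕ) :
    rowWord T m n = upWord (fun r c => T (r, c)) (m + 1) (n + 1) := by
  have : ∀ k, ((List.range k).reverse.flatMap fun r =>
      (List.range (n + 1)).filterMap fun c => T (r, c)) =
        upWord (fun r c => T (r, c)) k (n + 1) := by
    intro k
    induction k with
    | zero => rfl
    | succ k ih =>
      rw [List.range_succ (n := k), List.reverse_append, List.flatMap_append, ih, upWord_succ]
      simp [rowList]
  exact this _

namespace PlaneSlide

variable {t f : ℕ → ℕ → Option ℤ} {p d : ℕ → ℕ → Prop}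

theorem wk_step (h : PlaneSlide t f p d) {r m n : ℕ} (hm : ∀ i c, r + 1 + m ≤ i → t i c = none)
    (hn : ¬ d r n) :
    wk (wordRows t r (m + 1) (n + 1) ++ upWord f r (n + 1)) =
      wk (wordRows t (r + 1) m (n + 1) ++ upWord f (r + 1) (n + 1)) := by
  obtain ⟨w, hw⟩ := upWord_rowAbove f r (n + 1)
  have h1 := wcl_mul_right ((h.rowSlide r m hm).convert (n + 1)) (ck w)
  rw [RowSlide.U, if_neg hn] at h1
  simp only [rowEl, ← ck_append, wcl_ck] at h1
  rw [wordRows_succ, upWord_succ, hw]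
  simpa only [List.append_assoc] using h1

theorem wk_rows (h : PlaneSlide t f p d) {n : ℕ} (hn : ∀ r, ¬ d r n) (m r : ℕ)
    (hm : ∀ i c, r + m ≤ i → t i c = none) :
    wk (wordRows t r m (n + 1) ++ upWord f r (n + 1)) = wk (upWord f (r + m) (n + 1)) := by
  induction m generalizing r with
  | zero => rfl
  | succ m ih =>
    rw [h.wk_step (fun i c hi => hm i c (by omega)) (hn r),
      ih (r + 1) fun i c hi => hm i c (by omega), show r + 1 + m = r + (m + 1) by omega]

theorem wk_eq (h : PlaneSlide t f p d) {m n : ℕ} (hp : ∀ r c, p r c → r < m ∧ c < n) :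
    wk (upWord t m (n + 1)) = wk (upWord f m (n + 1)) := by
  have h1 := h.wk_rows (n := n) (fun r hr => by have := hp _ _ (h.mem_dot _ _ hr); omega) m 0
    fun i c hi => by
      by_contra hn
      obtain ⟨x, hx⟩ := Option.ne_none_iff_exists'.1 hn
      have := hp _ _ (h.mem_first _ _ _ hx)
      omega
  rw [upWord, List.append_nil, Nat.zero_add] at h1
  rw [← h1, ← Nat.zero_add m, ← wordRows_append_upWord, upWord, List.append_nil, Nat.zero_add]

end PlaneSlide

/-- The row word of a type B tableau contained in the first `m` rows and `n` columns. -/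
def shiftedWord (T : ShiftedBox → Option ℤ) (m n : ℕ) : List ℤ :=
  upWord (fun r c => extendToPlane T (r, c)) m n

/-- `T` is contained in the first `m` rows and `n` columns. -/
def Within (T : ShiftedBox → Option ℤ) (m n : ℕ) : Prop :=
  ∀ b, T b ≠ none → b.1.1 < m ∧ b.1.2 < n

theorem Within.mono {T : ShiftedBox → Option ℤ} {m n m' n' : ℕ} (h : Within T m n) (hm : m ≤ m')
    (hn : n ≤ n') : Within T m' n' := fun b hb => by
  have := h b hb
  omega

theorem Within.shiftedWord_eq {T : ShiftedBox → Option ℤ} {m n m' n' : ℕ} (h : Within T m n)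
    (hm : m ≤ m') (hn : n ≤ n') : shiftedWord T m' n' = shiftedWord T m n := by
  refine upWord_stable (fun r c hrc => ?_) hm hn
  obtain ⟨x, hx⟩ := Option.ne_none_iff_exists'.1 hrc
  obtain ⟨h1, h2⟩ := extendToPlane_some hx
  exact h ⟨(r, c), h1⟩ (by simp [h2])

theorem rowWordB_eq (T : ShiftedBox → Option ℤ) (m n : ℕ) :
    rowWordB T m n = shiftedWord T (m + 1) (n + 1) := rowWord_eq_upWord _ _ _

theorem Within.of_boundedBy {T : ShiftedBox → Option ℤ} {m n : ℕ}
    (h : BoundedBy (extendToPlane T) m n) : Within T (m + 1) (n + 1) := by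
  rintro ⟨⟨r, c⟩, hrc⟩ hb
  have := h (r, c) (by rwa [extendToPlane_of_le T hrc])
  simp only at this ⊢
  omega

/-- A set of boxes is bounded if it is finite. -/
theorem exists_bound_of_finite {P : Set ShiftedBox} (hP : P.Finite) :
    ∃ N, ∀ b ∈ P, b.1.1 < N ∧ b.1.2 < N := by
  obtain ⟨N, hN⟩ := (hP.image fun b => b.1.2).bddAbove
  refine ⟨N + 1, fun b hb => ?_⟩
  have h1 : b.1.2 ≤ N := hN ⟨b, hb, rfl⟩
  have h2 := b.2
  omega

/-- Type B tableaux have weakly equivalent row words. -/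
def WeakWords (T T' : ShiftedBox → Option ℤ) : Prop :=
  ∃ N, Within T N N ∧ Within T' N N ∧ WKKnuth (shiftedWord T N N) (shiftedWord T' N N)

/-- A slide preserves the weak class of the row word. -/
theorem SlideFacts.weak {T T' : ShiftedBox → Option ℤ} {P D : Set ShiftedBox}
    (h : SlideFacts T T' P D) :
    WeakWords T T' := by
  obtain ⟨N, hN⟩ := exists_bound_of_finite h.fin
  have w1 : Within T N N := fun b hb => hN b (h.mem_first b hb)
  have w2 : Within T' N N := fun b hb => hN b (h.mem_last b hb)
  refine ⟨N, w1, w2, ?_⟩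
  rw [← w1.shiftedWord_eq le_rfl (Nat.le_succ N), ← w2.shiftedWord_eq le_rfl (Nat.le_succ N)]
  exact wk_eq_iff.1 (h.plane.wk_eq fun r c ⟨_, hb⟩ => hN _ hb)

theorem WeakWords.symm {T T' : ShiftedBox → Option ℤ} (h : WeakWords T T') : WeakWords T' T := by
  obtain ⟨N, h1, h2, h3⟩ := h
  exact ⟨N, h2, h1, Relation.EqvGen.symm _ _ h3⟩

theorem WeakWords.trans {T T' T'' : ShiftedBox → Option ℤ} (h : WeakWords T T')
    (h' : WeakWords T' T'') : WeakWords T T'' := by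
  obtain ⟨N, h1, h2, h3⟩ := h
  obtain ⟨M, h4, h5, h6⟩ := h'
  refine ⟨N + M, h1.mono (by omega) (by omega), h5.mono (by omega) (by omega), ?_⟩
  rw [h1.shiftedWord_eq (by omega) (by omega), h5.shiftedWord_eq (by omega) (by omega)]
  refine Relation.EqvGen.trans _ _ _ h3 ?_
  rw [← h2.shiftedWord_eq (m' := N + M) (n' := N + M) (by omega) (by omega),
    h4.shiftedWord_eq (by omega) (by omega)]
  exact h6

/-- Jeu de taquin equivalent tableaux have weakly equivalent row words. -/
theorem JdtEquiv.weakWords {T T' : ShiftedBox → Option ℤ} (h : JdtEquiv T T')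
    (hT : IncreasingSkewTableau T) : Increasing T' ∧ WeakWords T T' := by
  induction h with
  | refl =>
    obtain ⟨⟨lam, nu, -, hs⟩, hi⟩ := hT
    have hfin : (shapeOf T).Finite := by
      rw [hs]
      exact (Finset.finite_toSet nu).subset Set.sdiff_subset
    obtain ⟨N, hN⟩ := exists_bound_of_finite hfin
    exact ⟨hi, N, hN, hN, Relation.EqvGen.refl _⟩
  | tail _ hs ih =>
    rcases hs with hs | hs
    · obtain ⟨a, n, S, hc⟩ := hs.chain ih.1
      exact ⟨hc.increasing_last, ih.2.trans hc.facts.weak⟩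
    · obtain ⟨a, n, S, hc⟩ := hs.chain ih.1
      exact ⟨hc.increasing_first, ih.2.trans (WeakWords.symm hc.facts.weak)⟩

/-! ### Constructing slides in plane coordinates -/

/-- The type B tableau with entries given by a function of plane coordinates. -/
def ofPlane (t : ℕ → ℕ → Option ℤ) : ShiftedBox → Option ℤ := fun b => t b.1.1 b.1.2

/-- `T'` arises from `T` by a slide. -/
def Slides (T T' : ShiftedBox → Option ℤ) : Prop := ∃ a n S, SlideChain T T' a n S

/-- The equivalence relation generated by slides. -/
def SlideEquiv (t t' : ℕ → ℕ → Option ℤ) : Prop :=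
  Relation.EqvGen Slides (ofPlane t) (ofPlane t')

theorem SlideEquiv.refl (t : ℕ → ℕ → Option ℤ) : SlideEquiv t t := Relation.EqvGen.refl _

theorem SlideEquiv.symm {t t' : ℕ → ℕ → Option ℤ} (h : SlideEquiv t t') : SlideEquiv t' t :=
  Relation.EqvGen.symm _ _ h

theorem SlideEquiv.trans {t t' t'' : ℕ → ℕ → Option ℤ} (h : SlideEquiv t t')
    (h' : SlideEquiv t' t'') : SlideEquiv t t'' := Relation.EqvGen.trans _ _ _ h h'

theorem finite_Iic_shiftedBox (b : ShiftedBox) : (Set.Iic b).Finite :=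
  ((Set.finite_Iic b.1).preimage Subtype.val_injective.injOn).subset fun _ h => h

theorem jdtEquiv_of_eqvGen {T T' : ShiftedBox → Option ℤ} (h : Relation.EqvGen Slides T T') :
    JdtEquiv T T' ∧ JdtEquiv T' T := by
  induction h with
  | rel x y h =>
    obtain ⟨a, n, S, h⟩ := h
    exact ⟨.single (Or.inl (h.isForwardSlide finite_Iic_shiftedBox)),
      .single (Or.inr (h.isReverseSlide finite_Iic_shiftedBox))⟩
  | refl x => exact ⟨.refl, .refl⟩
  | symm x y _ ih => exact ih.symm
  | trans x y z _ _ ih1 ih2 => exact ⟨ih1.1.trans ih2.1, ih2.2.trans ih1.2⟩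

/-- A finite, increasing tableau on a convex set of shifted boxes. -/
structure PlaneTableau (t : ℕ → ℕ → Option ℤ) : Prop where
  diag : ∀ r c, t r c ≠ none → r ≤ c
  bounded : ∃ N, ∀ r c, t r c ≠ none → c < N
  inc : ∀ r c r' c' x x', t r c = some x → t r' c' = some x' → r ≤ r' → c ≤ c' →
    r + c < r' + c' → x < x'
  conv : ∀ r c r' c' r'' c'', t r c ≠ none → t r'' c'' ≠ none → r ≤ r' → r' ≤ r'' → c ≤ c' →
    c' ≤ c'' → r' ≤ c' → t r' c' ≠ none

/-- Conditions in plane coordinates guaranteeing that `t'` arises from `t` by a slide whose dots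
visit `d`. -/
structure PlaneData (t t' : ℕ → ℕ → Option ℤ) (d : ℕ → ℕ → Prop) : Prop where
  diag : ∀ r c, t r c ≠ none ∨ d r c → r ≤ c
  bounded : ∃ N, ∀ r c, t r c ≠ none ∨ d r c → c < N
  inc : ∀ r c r' c' x x', t r c = some x → t r' c' = some x' → r ≤ r' → c ≤ c' →
    r + c < r' + c' → x < x'
  conv : ∀ r c r' c' r'' c'', t r c ≠ none ∨ d r c → t r'' c'' ≠ none ∨ d r'' c'' → r ≤ r' →
    r' ≤ r'' → c ≤ c' → c' ≤ c'' → r' ≤ c' → t r' c' ≠ none ∨ d r' c'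
  minimal : ∀ r c r' c', d r c → t r c = none → r' ≤ r → c' ≤ c → r' + c' < r + c →
    t r' c' = none ∧ ¬ d r' c'
  stay : ∀ r c, ¬ d r c → t' r c = t r c
  vacate : ∀ r c v, d r c → t r c = some v →
    (∃ c0, c = c0 + 1 ∧ d r c0 ∧ t' r c0 = some v) ∨ ∃ r0, r = r0 + 1 ∧ d r0 c ∧ t' r0 c = some v
  fill : ∀ r c v, d r c → t' r c = some v → t r (c + 1) = some v ∨ t (r + 1) c = some v
  next : ∀ r c r' c' v, d r c → (r' = r ∧ c' = c + 1) ∨ (r' = r + 1 ∧ c' = c) →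
    t r' c' = some v → (∀ x, t' r c = some x → v ≤ x) → t' r c = some v ∧ d r' c'

theorem shiftedBox_covBy_right {r c : ℕ} (h : r ≤ c) (h' : r ≤ c + 1) :
    (⟨(r, c), h⟩ : ShiftedBox) ⋖ ⟨(r, c + 1), h'⟩ := by
  refine ⟨shiftedBox_lt le_rfl (by omega) (by omega), ?_⟩
  rintro ⟨⟨x, y⟩, hxy⟩ h1 h2
  rw [← Subtype.coe_lt_coe, Prod.lt_iff] at h1 h2
  simp only at h1 h2
  omega

theorem shiftedBox_covBy_down {r c : ℕ} (h : r ≤ c) (h' : r + 1 ≤ c) :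
    (⟨(r, c), h⟩ : ShiftedBox) ⋖ ⟨(r + 1, c), h'⟩ := by
  refine ⟨shiftedBox_lt (by omega) le_rfl (by omega), ?_⟩
  rintro ⟨⟨x, y⟩, hxy⟩ h1 h2
  rw [← Subtype.coe_lt_coe, Prod.lt_iff] at h1 h2
  simp only at h1 h2
  omega

theorem shiftedBox_lt_iff {a b : ShiftedBox} :
    a < b ↔ a.1.1 ≤ b.1.1 ∧ a.1.2 ≤ b.1.2 ∧ a.1.1 + a.1.2 < b.1.1 + b.1.2 := by
  rw [← Subtype.coe_lt_coe, Prod.lt_iff]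
  omega

theorem finite_of_bounded {P : Set ShiftedBox} {N : ℕ} (h : ∀ b ∈ P, b.1.2 < N) : P.Finite :=
  ((Set.finite_Iic ((N, N) : ℕ × ℕ)).preimage Subtype.val_injective.injOn).subset fun b hb => by
    have h1 := h b hb
    have h2 := b.2
    exact ⟨by simp only; omega, by simp only; omega⟩

namespace PlaneData

variable {t t' : ℕ → ℕ → Option ℤ} {d : ℕ → ℕ → Prop}

theorem slideData (h : PlaneData t t' d) :
    SlideData (ofPlane t) (ofPlane t') {b : ShiftedBox | d b.1.1 b.1.2} where
  inc := by
    intro a b hab x y hx hy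
    obtain ⟨h1, h2, h3⟩ := shiftedBox_lt_iff.1 hab
    exact h.inc _ _ _ _ _ _ hx hy h1 h2 h3
  fin := by
    obtain ⟨N, hN⟩ := h.bounded
    exact finite_of_bounded fun b hb => hN _ _ hb
  conv := by
    refine ⟨fun a ha c hc b hb => ?_⟩
    exact h.conv _ _ _ _ _ _ ha hc hb.1.1 hb.2.1 hb.1.2 hb.2.2 b.2
  minimal := by
    intro b hb hT c hc
    obtain ⟨h1, h2, h3⟩ := shiftedBox_lt_iff.1 hc
    exact h.minimal _ _ _ _ hb hT h1 h2 h3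
  stay b hb := h.stay _ _ hb
  vacate := by
    rintro ⟨⟨r, c⟩, hrc⟩ v hb hT
    rcases h.vacate r c v hb hT with ⟨c0, rfl, h1, h2⟩ | ⟨r0, rfl, h1, h2⟩
    · refine ⟨⟨(r, c0), h.diag _ _ (Or.inr h1)⟩, h1, Or.inr (shiftedBox_covBy_right _ _), ?_, h2⟩
      intro x hx
      exact h.inc _ _ _ _ _ _ hx hT le_rfl (by simp) (by simp)
    · refine ⟨⟨(r0, c), h.diag _ _ (Or.inr h1)⟩, h1, Or.inr (shiftedBox_covBy_down _ _), ?_, h2⟩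
      intro x hx
      exact h.inc _ _ _ _ _ _ hx hT (by simp) le_rfl (by simp)
  fill := by
    rintro ⟨⟨r, c⟩, hrc⟩ v hb hT
    simp only at hrc
    rcases h.fill r c v hb hT with h1 | h1
    · refine ⟨⟨⟨(r, c + 1), by simp only; omega⟩, Or.inl (shiftedBox_covBy_right _ _), h1⟩, ?_⟩
      intro x hx
      exact h.inc _ _ _ _ _ _ hx h1 le_rfl (by simp) (by simp)
    · have h2 := h.diag (r + 1) c (Or.inl (by simp [h1]))
      refine ⟨⟨⟨(r + 1, c), h2⟩, Or.inl (shiftedBox_covBy_down _ _), h1⟩, ?_⟩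
      intro x hx
      exact h.inc _ _ _ _ _ _ hx h1 (by simp) le_rfl (by simp)
  next := by
    rintro b c v hb hn hc h1 h2
    rcases hn with hn | hn
    · exact h.next _ _ _ _ _ hb (shiftedBox_covBy hn) hc h2
    · exfalso
      obtain ⟨h3, h4, h5⟩ := shiftedBox_lt_iff.1 hn.lt
      cases hT : t b.1.1 b.1.2 with
      | none =>
        have h6 := (h.minimal _ _ _ _ hb hT h3 h4 h5).1
        have hc' : t c.1.1 c.1.2 = some v := hc
        simp [h6] at hc'
      | some x =>
        have h6 := h.inc _ _ _ _ _ _ hc hT h3 h4 h5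
        have h7 := h1 x hT
        omega

theorem slideEquiv (h : PlaneData t t' d) : SlideEquiv t t' :=
  Relation.EqvGen.rel _ _ h.slideData.chain

theorem tableau (h : PlaneData t t' d) : PlaneTableau t where
  diag r c hrc := h.diag r c (Or.inl hrc)
  bounded := by
    obtain ⟨N, hN⟩ := h.bounded
    exact ⟨N, fun r c hrc => hN r c (Or.inl hrc)⟩
  inc := h.inc
  conv := by
    intro r c r' c' r'' c'' h1 h2 h3 h4 h5 h6 h7 hn
    rcases h.conv r c r' c' r'' c'' (Or.inl h1) (Or.inl h2) h3 h4 h5 h6 h7 with h8 | h8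
    · exact h8 hn
    · by_cases he : r + c = r' + c'
      · obtain rfl : r = r' := by omega
        obtain rfl : c = c' := by omega
        exact h1 hn
      · exact h1 (h.minimal r' c' r c h8 hn h3 h5 (by omega)).1

end PlaneData

/-- Shift row `i` by one step to the right. -/
def shiftRow (s : ℕ → ℕ → Option ℤ) (i r c : ℕ) : Option ℤ :=
  if r = i then (if c = 0 then none else s i (c - 1)) else s r c

theorem shiftRow_zero (s : ℕ → ℕ → Option ℤ) (i : ℕ) : shiftRow s i i 0 = none := by
  simp [shiftRow]

theorem shiftRow_succ (s : ℕ → ℕ → Option ℤ) (i c : ℕ) : shiftRow s i i (c + 1) = s i c := by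
  simp [shiftRow]

theorem shiftRow_of_ne (s : ℕ → ℕ → Option ℤ) {i r : ℕ} (h : r ≠ i) (c : ℕ) :
    shiftRow s i r c = s r c := by
  simp [shiftRow, h]

theorem shiftRow_some {s : ℕ → ℕ → Option ℤ} {i c : ℕ} {x : ℤ} (h : shiftRow s i i c = some x) :
    ∃ c0, c = c0 + 1 ∧ s i c0 = some x := by
  cases c with
  | zero => simp [shiftRow_zero] at h
  | succ c => exact ⟨c, rfl, by rwa [shiftRow_succ] at h⟩

theorem shiftRow_ne_none {s : ℕ → ℕ → Option ℤ} {i c : ℕ} (h : shiftRow s i i c ≠ none) :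
    ∃ c0, c = c0 + 1 ∧ s i c0 ≠ none := by
  cases c with
  | zero => simp [shiftRow_zero] at h
  | succ c => exact ⟨c, rfl, by rwa [shiftRow_succ] at h⟩

/-- A row may be shifted to the right if the rows above it are far away. -/
theorem PlaneTableau.shiftRow {s : ℕ → ℕ → Option ℤ} (h : PlaneTableau s) (i : ℕ)
    (hi : ∀ r c c', r < i → s r c ≠ none → s i c' ≠ none → c' + 1 < c) :
    PlaneData (shiftRow s i) s
      (fun r c => r = i ∧ (s i c ≠ none ∨ _root_.shiftRow s i i c ≠ none)) := by
  have hp : ∀ r c, (_root_.shiftRow s i r c ≠ none ∨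
      r = i ∧ (s i c ≠ none ∨ _root_.shiftRow s i i c ≠ none)) ↔
        s r c ≠ none ∨ (r = i ∧ ∃ c0, c = c0 + 1 ∧ s i c0 ≠ none) := by
    intro r c
    by_cases hr : r = i
    · subst hr
      constructor
      · rintro (h1 | ⟨-, h1 | h1⟩)
        · exact Or.inr ⟨rfl, shiftRow_ne_none h1⟩
        · exact Or.inl h1
        · exact Or.inr ⟨rfl, shiftRow_ne_none h1⟩
      · rintro (h1 | ⟨-, c0, rfl, h1⟩)
        · exact Or.inr ⟨rfl, Or.inl h1⟩
        · exact Or.inl (by rwa [shiftRow_succ])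
    · simp [shiftRow_of_ne s hr, hr]
  constructor
  · intro r c hrc
    rcases (hp r c).1 hrc with h1 | ⟨rfl, c0, rfl, h1⟩
    · exact h.diag _ _ h1
    · have := h.diag _ _ h1
      omega
  · obtain ⟨N, hN⟩ := h.bounded
    refine ⟨N + 1, fun r c hrc => ?_⟩
    rcases (hp r c).1 hrc with h1 | ⟨rfl, c0, rfl, h1⟩
    · have := hN _ _ h1
      omega
    · have := hN _ _ h1
      omega
  · intro r c r' c' x x' h1 h2 h3 h4 h5
    by_cases hr : r = i
    · subst hr
      obtain ⟨c0, rfl, h1s⟩ := shiftRow_some h1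
      by_cases hr' : r' = r
      · subst hr'
        obtain ⟨c1, rfl, h2s⟩ := shiftRow_some h2
        exact h.inc _ _ _ _ _ _ h1s h2s h3 (by omega) (by omega)
      · rw [shiftRow_of_ne s hr'] at h2
        exact h.inc _ _ _ _ _ _ h1s h2 h3 (by omega) (by omega)
    · rw [shiftRow_of_ne s hr] at h1
      by_cases hr' : r' = i
      · subst hr'
        obtain ⟨c1, rfl, h2s⟩ := shiftRow_some h2
        have := hi r c c1 (by omega) (by simp [h1]) (by simp [h2s])
        omega
      · rw [shiftRow_of_ne s hr'] at h2
        exact h.inc _ _ _ _ _ _ h1 h2 h3 h4 h5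
  · intro r c r' c' r'' c'' h1 h2 h3 h4 h5 h6 h7
    rw [hp] at h1 h2 ⊢
    rcases h1 with h1 | ⟨rfl, c0, rfl, h1⟩
    · rcases h2 with h2 | ⟨rfl, c1, rfl, h2⟩
      · exact Or.inl (h.conv _ _ _ _ _ _ h1 h2 h3 h4 h5 h6 h7)
      · by_cases hc : c' = c1 + 1
        · by_cases hr : r = r''
          · exact Or.inr ⟨by omega, c1, hc, h2⟩
          · have := hi r c c1 (by omega) h1 h2
            omega
        · exact Or.inl (h.conv _ _ _ _ _ _ h1 h2 h3 h4 h5 (by omega) h7)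
    · rcases h2 with h2 | ⟨rfl, c1, rfl, h2⟩
      · exact Or.inl (h.conv _ _ _ _ _ _ h1 h2 h3 h4 (by omega) h6 h7)
      · rcases h6.lt_or_eq with h6 | rfl
        · exact Or.inl (h.conv _ _ _ _ _ _ h1 h2 h3 h4 (by omega) (by omega) h7)
        · exact Or.inr ⟨by omega, c1, rfl, h2⟩
  · rintro r c r' c' ⟨rfl, hd⟩ h1 h2 h3 h4
    have hs : s r c ≠ none := hd.resolve_right (by simp [h1])
    have key : ∀ c0, c0 + 1 ≤ c → s r c0 = none := by
      intro c0 hc0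
      by_contra hn
      obtain ⟨e, rfl⟩ : ∃ e, c = e + 1 := ⟨c - 1, by omega⟩
      rw [shiftRow_succ] at h1
      have := h.diag _ _ hn
      exact h.conv r c0 r e r (e + 1) hn hs le_rfl le_rfl (by omega) (by omega) (by omega) h1
    by_cases hr : r' = r
    · subst hr
      have h5 : _root_.shiftRow s r' r' c' = none := by
        by_contra hn
        obtain ⟨c0, rfl, hns⟩ := shiftRow_ne_none hn
        exact hns (key c0 h3)
      refine ⟨h5, ?_⟩
      rintro ⟨-, h6 | h6⟩
      · exact h6 (key c' (by omega))
      · exact h6 h5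
    · refine ⟨?_, fun h6 => hr h6.1⟩
      rw [shiftRow_of_ne s hr]
      by_contra hn
      have := hi r' c' c (by omega) hn hs
      omega
  · intro r c hd
    by_cases hr : r = i
    · subst hr
      simp only [true_and, not_or, not_not] at hd
      rw [hd.1, hd.2]
    · rw [shiftRow_of_ne s hr]
  · rintro r c v ⟨rfl, hd⟩ h1
    obtain ⟨c0, rfl, h1s⟩ := shiftRow_some h1
    exact Or.inl ⟨c0, rfl, ⟨rfl, Or.inl (by simp [h1s])⟩, h1s⟩
  · rintro r c v ⟨rfl, hd⟩ h1
    exact Or.inl (by rwa [shiftRow_succ])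
  · rintro r c r' c' v ⟨rfl, hd⟩ (⟨rfl, rfl⟩ | ⟨rfl, rfl⟩) h1 h2
    · rw [shiftRow_succ] at h1
      exact ⟨h1, rfl, Or.inr (by rw [shiftRow_succ]; simp [h1])⟩
    · exfalso
      rw [shiftRow_of_ne s (by omega)] at h1
      have hs : s r c' ≠ none := by
        rcases hd with hd | hd
        · exact hd
        · obtain ⟨c0, rfl, h3⟩ := shiftRow_ne_none hd
          have := h.diag _ _ h3
          exact h.conv r c0 r (c0 + 1) (r + 1) (c0 + 1) h3 (by simp [h1]) le_rfl (by omega)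
            (by omega) le_rfl (by omega)
      obtain ⟨x, hx⟩ := Option.ne_none_iff_exists'.1 hs
      have h3 := h.inc r c' (r + 1) c' x v hx h1 (by omega) le_rfl (by omega)
      have h4 := h2 x hx
      omega

/-- Move an entry `x` from `(r, c)` to `(r', c')`. -/
def moveEntry (s : ℕ → ℕ → Option ℤ) (x : ℤ) (r c r' c' i j : ℕ) : Option ℤ :=
  if i = r' ∧ j = c' then some x else if i = r ∧ j = c then none else s i j

/-- An entry may be moved to an adjacent cell that is not comparable to any other entry. -/
theorem PlaneTableau.moveEntry {s : ℕ → ℕ → Option ℤ} (h : PlaneTableau s) {x : ℤ} {r c r' c' : ℕ}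
    (hs : s r c = some x) (hcov : (r' = r ∧ c' = c + 1) ∨ (r' = r + 1 ∧ c' = c)) (hd : r' ≤ c')
    (hlow : ∀ i j, i ≤ r' → j ≤ c' → s i j ≠ none → i = r ∧ j = c)
    (hup : ∀ i j, r' ≤ i → c' ≤ j → s i j = none) :
    PlaneData (moveEntry s x r c r' c') s
      (fun i j => (i = r ∧ j = c) ∨ (i = r' ∧ j = c')) := by
  have hrc := h.diag r c (by simp [hs])
  have hp : ∀ i j, (_root_.moveEntry s x r c r' c' i j ≠ none ∨
      ((i = r ∧ j = c) ∨ (i = r' ∧ j = c'))) ↔ s i j ≠ none ∨ (i = r' ∧ j = c') := by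
    intro i j
    simp only [_root_.moveEntry]
    grind
  have hv : ∀ i j y, _root_.moveEntry s x r c r' c' i j = some y →
      (i = r' ∧ j = c' ∧ y = x) ∨ (s i j = some y ∧ ¬ (i = r ∧ j = c)) := by
    intro i j y
    simp only [_root_.moveEntry]
    grind
  constructor
  · intro i j hij
    rcases (hp i j).1 hij with h1 | h1
    · exact h.diag _ _ h1
    · omega
  · obtain ⟨N, hN⟩ := h.bounded
    refine ⟨N + c' + 1, fun i j hij => ?_⟩
    rcases (hp i j).1 hij with h1 | h1
    · have := hN _ _ h1
      omega
    · omega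
  · intro i j i' j' y y' h1 h2 h3 h4 h5
    rcases hv _ _ _ h1 with h1 | h1
    · rcases hv _ _ _ h2 with h2 | h2
      · omega
      · have := hup i' j' (by omega) (by omega)
        simp [this] at h2
    · rcases hv _ _ _ h2 with h2 | h2
      · exact absurd (hlow i j (by omega) (by omega) (by simp [h1.1])) h1.2
      · exact h.inc _ _ _ _ _ _ h1.1 h2.1 h3 h4 h5
  · intro i j i' j' i'' j'' h1 h2 h3 h4 h5 h6 h7
    rw [hp] at h1 h2 ⊢
    rcases h1 with h1 | h1
    · rcases h2 with h2 | h2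
      · exact Or.inl (h.conv _ _ _ _ _ _ h1 h2 h3 h4 h5 h6 h7)
      · have := hlow i j (by omega) (by omega) h1
        by_cases he : i' = r' ∧ j' = c'
        · exact Or.inr he
        · obtain rfl : i' = i := by omega
          obtain rfl : j' = j := by omega
          exact Or.inl h1
    · rcases h2 with h2 | h2
      · exact absurd (hup i'' j'' (by omega) (by omega)) h2
      · right
        omega
  · intro i j i' j' h1 h2 h3 h4 h5
    have he : i = r ∧ j = c := by
      rcases h1 with h1 | ⟨rfl, rfl⟩
      · exact h1
      · simp [_root_.moveEntry] at h2
    constructor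
    · by_contra hn
      obtain ⟨y, hy⟩ := Option.ne_none_iff_exists'.1 hn
      rcases hv _ _ _ hy with h6 | h6
      · omega
      · have := hlow i' j' (by omega) (by omega) (by simp [h6.1])
        omega
    · omega
  · intro i j h1
    simp only [_root_.moveEntry]
    grind
  · intro i j v h1 h2
    rcases hv _ _ _ h2 with h3 | h3
    · rcases hcov with hcov | hcov
      · exact Or.inl ⟨c, by omega, by omega, by rw [show i = r by omega, hs, h3.2.2]⟩
      · exact Or.inr ⟨r, by omega, by omega, by rw [show j = c by omega, hs, h3.2.2]⟩
    · rcases h1 with h1 | h1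
      · exact absurd h1 h3.2
      · have := hup i j (by omega) (by omega)
        simp [this] at h3
  · intro i j v h1 h2
    have he : i = r ∧ j = c := by
      rcases h1 with h1 | ⟨rfl, rfl⟩
      · exact h1
      · have := hup i j le_rfl le_rfl
        simp [this] at h2
    obtain ⟨rfl, rfl⟩ := he
    have hvx : x = v := by simpa [hs] using h2
    subst hvx
    rcases hcov with ⟨rfl, rfl⟩ | ⟨rfl, rfl⟩ <;> simp [_root_.moveEntry]
  · intro i j i' j' v h1 h2 h3 h4
    rcases hv _ _ _ h3 with h5 | h5
    · have he : i = r ∧ j = c := by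
        have := hlow i j
        omega
      obtain ⟨rfl, rfl⟩ := he
      exact ⟨by rw [hs, h5.2.2], Or.inr ⟨h5.1, h5.2.1⟩⟩
    · exfalso
      rcases h1 with ⟨rfl, rfl⟩ | ⟨rfl, rfl⟩
      · have h6 := h.inc _ _ _ _ _ _ hs h5.1 (by omega) (by omega) (by omega)
        have h7 := h4 x hs
        omega
      · have := hup i' j' (by omega) (by omega)
        simp [this] at h5

/-! ### Moving a tableau to an antidiagonal -/

/-- Shift row `r` by `h r` steps to the right. -/
def shiftBy (t : ℕ → ℕ → Option ℤ) (h : ℕ → ℕ) (r c : ℕ) : Option ℤ :=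
  if h r ≤ c then t r (c - h r) else none

theorem shiftBy_ne_none {t : ℕ → ℕ → Option ℤ} {h : ℕ → ℕ} {r c : ℕ}
    (hc : shiftBy t h r c ≠ none) : h r ≤ c ∧ t r (c - h r) ≠ none := by
  simp only [shiftBy] at hc
  split_ifs at hc with h1
  · exact ⟨h1, hc⟩
  · exact absurd rfl hc

theorem shiftRow_shiftBy (t : ℕ → ℕ → Option ℤ) {h h' : ℕ → ℕ} {i : ℕ} (hi : h' i = h i + 1)
    (hne : ∀ r, r ≠ i → h' r = h r) : shiftRow (shiftBy t h) i = shiftBy t h' := by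
  funext r c
  by_cases hr : r = i
  · subst hr
    cases c with
    | zero => simp [shiftRow_zero, shiftBy, hi]
    | succ c => simp [shiftRow_succ, shiftBy, hi]
  · simp [shiftRow_of_ne _ hr, shiftBy, hne r hr]

theorem rowList_shiftBy (t : ℕ → ℕ → Option ℤ) (h : ℕ → ℕ) (r n : ℕ) :
    rowList (shiftBy t h r) (h r + n) = rowList (t r) n := by
  induction n with
  | zero =>
    rw [rowList_zero, rowList_eq_nil]
    intro c hc
    simp [shiftBy, show ¬ h r ≤ c by omega]
  | succ n ih => rw [← add_assoc, rowList_succ, rowList_succ, ih]; simp [shiftBy]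

/-- The amounts by which rows have been shifted when row `i` has been shifted by `k`. -/
def stagedShift (H : ℕ → ℕ) (i k r : ℕ) : ℕ := if r < i then H r else if r = i then k else 0

/-- Rows may be moved far apart. -/
theorem PlaneTableau.separate {t : ℕ → ℕ → Option ℤ} (ht : PlaneTableau t) {N : ℕ}
    (hN : ∀ r c, t r c ≠ none → c < N) {H : ℕ → ℕ}
    (hH : ∀ r r', r < r' → r' < N → H r' + N ≤ H r) :
    PlaneTableau (shiftBy t H) ∧ SlideEquiv t (shiftBy t H) := by
  have key : ∀ i, i ≤ N → PlaneTableau (shiftBy t (stagedShift H i 0)) ∧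
      SlideEquiv t (shiftBy t (stagedShift H i 0)) := by
    intro i
    induction i with
    | zero =>
      intro _
      have h0 : shiftBy t (stagedShift H 0 0) = t := by
        funext r c
        simp [shiftBy, stagedShift]
      rw [h0]
      exact ⟨ht, SlideEquiv.refl t⟩
    | succ i ih =>
      intro hi
      have inner : ∀ k, k ≤ H i → PlaneTableau (shiftBy t (stagedShift H i k)) ∧
          SlideEquiv t (shiftBy t (stagedShift H i k)) := by
        intro k
        induction k with
        | zero => exact fun _ => ih (by omega)
        | succ k ihk =>
          intro hk
          obtain ⟨h1, h2⟩ := ihk (by omega)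
          have h3 := h1.shiftRow i ?_
          · rw [shiftRow_shiftBy t (h' := stagedShift H i (k + 1)) (by simp [stagedShift])
              (fun r hr => by simp [stagedShift, hr])] at h3
            exact ⟨h3.tableau, h2.trans h3.slideEquiv.symm⟩
          · intro r c c' hr h4 h5
            have h4' := (shiftBy_ne_none h4).1
            obtain ⟨h5', h6⟩ := shiftBy_ne_none h5
            have h7 := hN _ _ h6
            have h8 := hH r i hr (by omega)
            simp only [stagedShift, hr, if_true, lt_irrefl, if_false] at h4' h5' h7
            omega
      have h1 := inner (H i) le_rfl
      have h2 : stagedShift H i (H i) = stagedShift H (i + 1) 0 := by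
        funext r
        simp only [stagedShift]
        grind
      rwa [h2] at h1
  have h1 := key N le_rfl
  have h2 : shiftBy t (stagedShift H N 0) = shiftBy t H := by
    funext r c
    by_cases hr : r < N
    · simp [shiftBy, stagedShift, hr]
    · have h3 : ∀ c, t r c = none := by
        intro c
        by_contra hn
        have := hN _ _ hn
        have := ht.diag _ _ hn
        omega
      simp [shiftBy, h3]
  rwa [h2] at h1

/-- The tableau with the entry `u c` in column `c` and row `ρ c`. -/
def columnTab (u : ℕ → Option ℤ) (ρ : ℕ → ℕ) (r c : ℕ) : Option ℤ := if r = ρ c then u c else none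

theorem columnTab_ne_none {u : ℕ → Option ℤ} {ρ : ℕ → ℕ} {r c : ℕ}
    (h : columnTab u ρ r c ≠ none) : r = ρ c ∧ u c ≠ none := by
  simp only [columnTab] at h
  split_ifs at h with h1
  · exact ⟨h1, h⟩
  · exact absurd rfl h

theorem exists_eq_columnTab {s : ℕ → ℕ → Option ℤ}
    (h : ∀ r r' c, s r c ≠ none → s r' c ≠ none → r = r') :
    ∃ u ρ, s = columnTab u ρ ∧ ∀ c, u c = s (ρ c) c := by
  have h1 : ∀ c, ∃ r, ∀ r', s r' c ≠ none → r' = r := by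
    intro c
    by_cases h2 : ∃ r, s r c ≠ none
    · obtain ⟨r, hr⟩ := h2
      exact ⟨r, fun r' hr' => h _ _ _ hr' hr⟩
    · push Not at h2
      exact ⟨0, fun r' hr' => absurd (h2 r') hr'⟩
  choose ρ hρ using h1
  refine ⟨fun c => s (ρ c) c, ρ, ?_, fun c => rfl⟩
  funext r c
  simp only [columnTab]
  split_ifs with h2
  · rw [h2]
  · by_contra hn
    exact h2 (hρ c r hn)

theorem upWord_eq_nil {f : ℕ → ℕ → Option ℤ} {m n : ℕ} (h : ∀ r c, r < m → c < n → f r c = none) :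
    upWord f m n = [] := by
  induction m with
  | zero => rfl
  | succ m ih =>
    rw [upWord_succ, ih fun r c hr hc => h r c (by omega) hc,
      rowList_eq_nil.2 fun c hc => h m c (by omega) hc, List.nil_append]

theorem upWord_columnTab_succ {u : ℕ → Option ℤ} {ρ : ℕ → ℕ}
    (hρ : ∀ c c', c < c' → u c ≠ none → u c' ≠ none → ρ c' ≤ ρ c) (m n : ℕ) :
    upWord (columnTab u ρ) m (n + 1) =
      upWord (columnTab u ρ) m n ++ (if ρ n < m then u n else none).toList := by
  induction m with
  | zero => simp [upWord]
  | succ m ih =>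
    rw [upWord_succ, upWord_succ, ih, rowList_succ]
    cases hu : u n with
    | none => simp [columnTab, hu]
    | some x =>
      rcases lt_trichotomy m (ρ n) with h1 | h1 | h1
      · simp [columnTab, show ¬ ρ n < m by omega, show ¬ ρ n < m + 1 by omega, h1.ne]
      · have h2 : upWord (columnTab u ρ) m n = [] := by
          apply upWord_eq_nil
          intro r c hr hc
          by_contra hn
          obtain ⟨h3, h4⟩ := columnTab_ne_none hn
          have := hρ c n hc h4 (by simp [hu])
          omega
        simp [columnTab, hu, h1] at h2 ⊢
        simp [h2]
      · simp [columnTab, h1, h1.ne', show ρ n < m + 1 by omega]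

theorem upWord_columnTab {u : ℕ → Option ℤ} {ρ : ℕ → ℕ}
    (hρ : ∀ c c', c < c' → u c ≠ none → u c' ≠ none → ρ c' ≤ ρ c) {m : ℕ}
    (hm : ∀ c, u c ≠ none → ρ c < m) (n : ℕ) :
    upWord (columnTab u ρ) m n = rowList u n := by
  induction n with
  | zero => exact upWord_eq_nil (by simp)
  | succ n ih =>
    rw [upWord_columnTab_succ hρ, ih, rowList_succ]
    cases hu : u n with
    | none => simp
    | some x => simp [hm n (by simp [hu])]

/-- Entries in different columns may be moved down to the antidiagonal. -/
theorem PlaneTableau.sink {u : ℕ → Option ℤ} {ρ : ℕ → ℕ} (ht : PlaneTableau (columnTab u ρ))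
    (hρ : ∀ c c', c < c' → u c ≠ none → u c' ≠ none → ρ c' ≤ ρ c) {M : ℕ}
    (hM : ∀ c, u c ≠ none → ρ c + c ≤ M ∧ M ≤ 2 * c) :
    SlideEquiv (columnTab u ρ) (columnTab u fun c => M - c) := by
  let σ : ℕ → ℕ → ℕ → ℕ := fun g s c => if c < g then M - c else if c = g then s else ρ c
  have key : ∀ g, PlaneTableau (columnTab u (σ g (ρ g))) ∧
      SlideEquiv (columnTab u ρ) (columnTab u (σ g (ρ g))) := by
    intro g
    induction g with
    | zero =>
      have h0 : σ 0 (ρ 0) = ρ := by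
        funext c
        simp only [σ]
        grind
      rw [h0]
      exact ⟨ht, SlideEquiv.refl _⟩
    | succ g ih =>
      cases hg : u g with
      | none =>
        have h0 : columnTab u (σ (g + 1) (ρ (g + 1))) = columnTab u (σ g (ρ g)) := by
          funext r c
          by_cases hc : c = g
          · simp [columnTab, hc, hg]
          · have h1 : σ (g + 1) (ρ (g + 1)) c = σ g (ρ g) c := by
              simp only [σ]
              grind
            simp [columnTab, h1]
        rwa [h0]
      | some x =>
        obtain ⟨h1, h2⟩ := hM g (by simp [hg])
        have inner : ∀ k, ρ g + k + g ≤ M → PlaneTableau (columnTab u (σ g (ρ g + k))) ∧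
            SlideEquiv (columnTab u ρ) (columnTab u (σ g (ρ g + k))) := by
          intro k
          induction k with
          | zero => exact fun _ => ih
          | succ k ihk =>
            intro hk
            obtain ⟨h3, h4⟩ := ihk (by omega)
            have h5 := h3.moveEntry (x := x) (r := ρ g + k) (c := g) (r' := ρ g + k + 1) (c' := g)
              (by simp [columnTab, σ, hg]) (Or.inr ⟨rfl, rfl⟩) (by omega) ?_ ?_
            · have h6 : _root_.moveEntry (columnTab u (σ g (ρ g + k))) x (ρ g + k) g
                  (ρ g + k + 1) g = columnTab u (σ g (ρ g + (k + 1))) := by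
                funext i j
                simp only [_root_.moveEntry, columnTab, σ]
                grind
              rw [h6] at h5
              exact ⟨h5.tableau, h4.trans h5.slideEquiv.symm⟩
            · intro i j hi hj hn
              obtain ⟨h6, h7⟩ := columnTab_ne_none hn
              simp only [σ] at h6
              split_ifs at h6 with h8 h9
              · omega
              · omega
              · omega
            · intro i j hi hj
              by_contra hn
              obtain ⟨h6, h7⟩ := columnTab_ne_none hn
              simp only [σ] at h6
              split_ifs at h6 with h8 h9
              · omega
              · omega
              · have := hρ g j (by omega) (by simp [hg]) h7
                omega
        have h3 := inner (M - g - ρ g) (by omega)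
        have h4 : σ g (ρ g + (M - g - ρ g)) = σ (g + 1) (ρ (g + 1)) := by
          funext c
          simp only [σ]
          grind
        rwa [h4] at h3
  have h1 := (key (M + 1)).2
  have h2 : columnTab u (σ (M + 1) (ρ (M + 1))) = columnTab u fun c => M - c := by
    funext r c
    cases hc : u c with
    | none => simp [columnTab, hc]
    | some x =>
      have := hM c (by simp [hc])
      simp [columnTab, σ, show c < M + 1 by omega]
  rwa [h2] at h1

/-- The tableau with the entry `g r` in row `r` of an antidiagonal. -/
def antiTab (g : ℕ → Option ℤ) (M r c : ℕ) : Option ℤ := if r + c = M then g r else none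

theorem antiTab_some {g : ℕ → Option ℤ} {M r c : ℕ} {x : ℤ} (h : antiTab g M r c = some x) :
    r + c = M ∧ g r = some x := by
  simp only [antiTab] at h
  split_ifs at h with h1
  exact ⟨h1, h⟩

theorem antiTab_ne_none {g : ℕ → Option ℤ} {M r c : ℕ} (h : antiTab g M r c ≠ none) :
    r + c = M ∧ g r ≠ none := by
  obtain ⟨x, hx⟩ := Option.ne_none_iff_exists'.1 h
  have := antiTab_some hx
  exact ⟨this.1, by simp [this.2]⟩

theorem planeTableau_antiTab {g : ℕ → Option ℤ} {M : ℕ} (hg : ∀ r, g r ≠ none → 2 * r ≤ M) :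
    PlaneTableau (antiTab g M) where
  diag r c h := by
    obtain ⟨h1, h2⟩ := antiTab_ne_none h
    have := hg _ h2
    omega
  bounded := ⟨M + 1, fun r c h => by
    have := (antiTab_ne_none h).1
    omega⟩
  inc r c r' c' x x' h1 h2 h3 h4 h5 := by
    have := (antiTab_some h1).1
    have := (antiTab_some h2).1
    omega
  conv r c r' c' r'' c'' h1 h2 h3 h4 h5 h6 h7 := by
    have := (antiTab_ne_none h1).1
    have := (antiTab_ne_none h2).1
    rwa [show r' = r by omega, show c' = c by omega]

theorem rowList_eq_toList {f : ℕ → Option ℤ} {c n : ℕ} (hc : c < n)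
    (h : ∀ c', c' ≠ c → f c' = none) : rowList f n = (f c).toList := by
  obtain ⟨k, rfl⟩ := Nat.exists_eq_add_of_le (show c + 1 ≤ n by omega)
  rw [rowList_stable fun c' h1 => h c' (by omega), rowList_succ, rowList_eq_nil.2 fun c' hc' => h c' hc'.ne, List.nil_append]

theorem upWord_antiTab (g : ℕ → Option ℤ) {M m : ℕ} (hm : m ≤ M + 1) :
    upWord (antiTab g M) m (M + 1) = (rowList g m).reverse := by
  induction m with
  | zero => simp [upWord, rowList_zero]
  | succ m ih =>
    rw [upWord_succ, ih (by omega), rowList_succ g, List.reverse_append,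
      rowList_eq_toList (c := M - m) (by omega)
        (fun c' hc' => by simp [antiTab, show ¬ m + c' = M by omega])]
    cases h : g m <;> simp [antiTab, h, show m + (M - m) = M by omega]

/-- An entry on the antidiagonal may be moved up into an adjacent gap. -/
theorem slideEquiv_antiTab_step {g g' : ℕ → Option ℤ} {M r : ℕ} {x : ℤ}
    (hg : ∀ r, g r ≠ none → 2 * r ≤ M) (h0 : g r = none) (h1 : g (r + 1) = some x)
    (h0' : g' r = some x) (h1' : g' (r + 1) = none)
    (hne : ∀ i, i ≠ r → i ≠ r + 1 → g' i = g i) :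
    SlideEquiv (antiTab g M) (antiTab g' M) := by
  have hr := hg (r + 1) (by simp [h1])
  have hg' : ∀ r, g' r ≠ none → 2 * r ≤ M := by
    intro i hi
    by_cases h2 : i = r
    · omega
    · by_cases h3 : i = r + 1
      · omega
      · exact hg i (by rwa [← hne i h2 h3])
  have h2 := (planeTableau_antiTab hg).moveEntry (x := x) (r := r + 1) (c := M - r - 1)
    (r' := r + 1) (c' := M - r) (by simp [antiTab, h1, show r + 1 + (M - r - 1) = M by omega])
    (Or.inl ⟨rfl, by omega⟩) (by omega) ?_ ?_
  · have h3 := (planeTableau_antiTab hg').moveEntry (x := x) (r := r) (c := M - r)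
      (r' := r + 1) (c' := M - r) (by simp [antiTab, h0', show r + (M - r) = M by omega])
      (Or.inr ⟨rfl, rfl⟩) (by omega) ?_ ?_
    · have h4 : _root_.moveEntry (antiTab g M) x (r + 1) (M - r - 1) (r + 1) (M - r) =
          _root_.moveEntry (antiTab g' M) x r (M - r) (r + 1) (M - r) := by
        funext i j
        have := hne i
        simp only [_root_.moveEntry, antiTab]
        grind
      rw [h4] at h2
      exact h2.slideEquiv.symm.trans h3.slideEquiv
    · intro i j hi hj hn
      obtain ⟨h4, h5⟩ := antiTab_ne_none hn
      by_cases h6 : i = r + 1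
      · rw [h6] at h5
        exact absurd h1' h5
      · omega
    · intro i j hi hj
      simp [antiTab, show ¬ i + j = M by omega]
  · intro i j hi hj hn
    obtain ⟨h4, h5⟩ := antiTab_ne_none hn
    by_cases h6 : i = r
    · rw [h6] at h5
      exact absurd h0 h5
    · omega
  · intro i j hi hj
    simp [antiTab, show ¬ i + j = M by omega]

/-- An entry on the antidiagonal may be moved up across a gap. -/
theorem slideEquiv_antiTab_move {M j : ℕ} {x : ℤ} (d : ℕ) {g g' : ℕ → Option ℤ}
    (hg : ∀ r, g r ≠ none → 2 * r ≤ M) (h0 : ∀ i, j ≤ i → i < j + d → g i = none)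
    (h1 : g (j + d) = some x) (h0' : g' j = some x)
    (h1' : ∀ i, j < i → i ≤ j + d → g' i = none)
    (hne : ∀ i, i < j ∨ j + d < i → g' i = g i) :
    SlideEquiv (antiTab g M) (antiTab g' M) := by
  induction d generalizing g with
  | zero =>
    have h2 : g' = g := by
      funext i
      by_cases hi : i = j
      · subst hi
        rw [h0', ← h1, add_zero]
      · exact hne i (by omega)
    rw [h2]
    exact SlideEquiv.refl _
  | succ d ih =>
    let f : ℕ → Option ℤ := fun i =>
      if i = j + d then some x else if i = j + d + 1 then none else g i
    have hf : SlideEquiv (antiTab g M) (antiTab f M) :=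
      slideEquiv_antiTab_step (r := j + d) (x := x) hg (h0 _ (by omega) (by omega)) h1
        (by simp [f]) (by simp [f]) (fun i h2 h3 => by simp [f, h2, h3])
    refine hf.trans (ih ?_ ?_ ?_ ?_ ?_)
    · intro i hi
      have := hg i
      have := hg (j + (d + 1)) (by simp [h1])
      simp only [f] at hi
      split_ifs at hi with h2 h3
      · omega
      · exact absurd rfl hi
      · exact hg i hi
    · intro i h2 h3
      simp only [f]
      rw [if_neg (by omega), if_neg (by omega)]
      exact h0 i h2 (by omega)
    · simp [f]
    · intro i h2 h3
      exact h1' i h2 (by omega)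
    · intro i hi
      simp only [f]
      by_cases h2 : i = j + d + 1
      · rw [if_neg (by omega), if_pos h2]
        exact h1' i (by omega) (by omega)
      · rw [if_neg (by omega), if_neg h2]
        exact hne i (by omega)

theorem length_rowList_le (f : ℕ → Option ℤ) (n : ℕ) : (rowList f n).length ≤ n := by
  simpa [rowList] using List.length_filterMap_le f (List.range n)

/-- The gaps on the antidiagonal may be closed. -/
theorem slideEquiv_antiTab_rowList {g : ℕ → Option ℤ} {M : ℕ}
    (hg : ∀ r, g r ≠ none → 2 * r ≤ M) {n : ℕ} (hn : ∀ r, n ≤ r → g r = none) :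
    SlideEquiv (antiTab g M) (antiTab (fun r => (rowList g n)[r]?) M) := by
  have key : ∀ n, SlideEquiv (antiTab g M)
      (antiTab (fun r => if r < n then (rowList g n)[r]? else g r) M) := by
    intro n
    induction n with
    | zero => simpa using SlideEquiv.refl _
    | succ n ih =>
      have hl := length_rowList_le g n
      refine ih.trans ?_
      cases h : g n with
      | none =>
        have h1 : (fun r => if r < n + 1 then (rowList g (n + 1))[r]? else g r) =
            fun r => if r < n then (rowList g n)[r]? else g r := by
          funext r
          rw [rowList_succ, h, Option.toList_none, List.append_nil]
          by_cases hr : r = n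
          · subst hr
            simp [h, hl]
          · simp [show r < n + 1 ↔ r < n by omega]
        rw [h1]
        exact SlideEquiv.refl _
      | some x =>
        have h2n := hg n (by simp [h])
        have hle : ∀ r, (if r < n then (rowList g n)[r]? else g r) ≠ none → 2 * r ≤ M := by
          intro r hr
          split_ifs at hr with h1
          · omega
          · exact hg r hr
        refine slideEquiv_antiTab_move (x := x) (j := (rowList g n).length)
          (n - (rowList g n).length) hle ?_ ?_ ?_ ?_ ?_
        · intro i h1 h2
          rw [if_pos (by omega)]
          exact List.getElem?_eq_none h1
        · rw [show (rowList g n).length + (n - (rowList g n).length) = n by omega]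
          simp [h]
        · rw [if_pos (by omega), rowList_succ, h]
          simp
        · intro i h1 h2
          rw [if_pos (by omega), rowList_succ, h]
          apply List.getElem?_eq_none
          simp
          omega
        · intro i h1
          rcases h1 with h1 | h1
          · rw [if_pos (by omega), if_pos (by omega), rowList_succ, List.getElem?_append_left h1]
          · rw [if_neg (by omega), if_neg (by omega)]
  have h1 := key n
  have h2 : (fun r => if r < n then (rowList g n)[r]? else g r) = fun r => (rowList g n)[r]? := by
    funext r
    have hl := length_rowList_le g n
    split_ifs with hr
    · rfl
    · rw [hn r (by omega), List.getElem?_eq_none (by omega)]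
  rwa [h2] at h1

/-! ### The row word determines a tableau up to slides -/

theorem rowList_getElem? (L : List ℤ) {n : ℕ} (hn : L.length ≤ n) :
    rowList (fun i => L[i]?) n = L := by
  have h : ∀ m, m ≤ L.length → rowList (fun i => L[i]?) m = L.take m := by
    intro m
    induction m with
    | zero => simp [rowList_zero]
    | succ m ih =>
      intro hm
      rw [rowList_succ, ih (by omega), List.take_add_one]
  obtain ⟨k, rfl⟩ := Nat.exists_eq_add_of_le hn
  rw [rowList_stable fun c hc => List.getElem?_eq_none hc, h _ le_rfl, List.take_length]

/-- A tableau within `N` columns is equivalent to its row word read along an antidiagonal. -/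
theorem PlaneTableau.slideEquiv_antiTab {t : ℕ → ℕ → Option ℤ} (ht : PlaneTableau t) {N : ℕ}
    (hN : ∀ r c, t r c ≠ none → c < N) :
    SlideEquiv t (antiTab (fun r => (upWord t N N).reverse[r]?) (2 * (N * (N + 1) + N))) := by
  set K := N * (N + 1) + N with hK
  set M := 2 * K with hM
  let H : ℕ → ℕ := fun r => N * (N - r) + K
  have hNN : N * (N + 1) = N * N + N := by ring
  have hHle : ∀ r, H r ≤ N * N + K := fun r => by
    have := Nat.mul_le_mul_left N (Nat.sub_le N r)
    simp only [H]
    omega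
  have hH : ∀ r r', r < r' → r' < N → H r' + N ≤ H r := by
    intro r r' h1 h2
    have h3 : N * (N - r' + 1) ≤ N * (N - r) := Nat.mul_le_mul_left N (by omega)
    have h4 : N * (N - r' + 1) = N * (N - r') + N := by ring
    simp only [H]
    omega
  obtain ⟨hs1, hs2⟩ := ht.separate hN hH
  have hcell : ∀ r c, shiftBy t H r c ≠ none → r < N ∧ H r ≤ c ∧ c < H r + N := by
    intro r c h
    obtain ⟨h1, h2⟩ := shiftBy_ne_none h
    have h3 := hN _ _ h2
    have h4 := ht.diag _ _ h2
    omega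
  obtain ⟨u, ρ, hu, hu'⟩ := exists_eq_columnTab (s := shiftBy t H) (by
    intro r r' c h1 h2
    have h3 := hcell _ _ h1
    have h4 := hcell _ _ h2
    rcases lt_trichotomy r r' with h | h | h
    · have := hH r r' h h4.1
      omega
    · exact h
    · have := hH r' r h h3.1
      omega)
  have hcol : ∀ c, u c ≠ none → ρ c < N ∧ H (ρ c) ≤ c ∧ c < H (ρ c) + N := fun c hc =>
    hcell _ _ (by rwa [← hu'])
  have hρ : ∀ c c', c < c' → u c ≠ none → u c' ≠ none → ρ c' ≤ ρ c := by
    intro c c' h h1 h2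
    by_contra h3
    have h4 := hcol c h1
    have h5 := hcol c' h2
    have := hH _ _ (not_le.1 h3) h5.1
    omega
  have hcM : ∀ c, u c ≠ none → ρ c + c ≤ M ∧ M ≤ 2 * c := by
    intro c hc
    have h1 := hcol c hc
    have h2 := hHle (ρ c)
    have h3 : K ≤ H (ρ c) := Nat.le_add_left _ _
    omega
  rw [hu] at hs1 hs2
  have h1 := hs2.trans (hs1.sink hρ hcM)
  let g : ℕ → Option ℤ := fun r => if r ≤ M then u (M - r) else none
  have hg : (columnTab u fun c => M - c) = antiTab g M := by
    funext r c
    simp only [columnTab, antiTab, g]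
    by_cases h2 : r + c = M
    · rw [if_pos (by omega), if_pos h2, if_pos (by omega), show M - r = c by omega]
    · rw [if_neg h2]
      split_ifs with h3
      · by_contra hn
        have := hcM c hn
        omega
      · rfl
  have hg2 : ∀ r, g r ≠ none → 2 * r ≤ M := by
    intro r hr
    simp only [g] at hr
    split_ifs at hr with h2
    · have := hcM _ hr
      omega
    · exact absurd rfl hr
  rw [hg] at h1
  have h2 := h1.trans (slideEquiv_antiTab_rowList hg2 (n := M + 1) fun r hr => by
    simp [g, show ¬ r ≤ M by omega])
  have h3 : (rowList g (M + 1)).reverse = rowList u (M + 1) := by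
    rw [← upWord_antiTab g le_rfl, ← hg]
    refine upWord_columnTab (fun c c' h _ _ => ?_) (fun c _ => ?_) _
    · omega
    · omega
  have h4 : ∀ m, upWord (shiftBy t H) m (M + 1) = upWord t m N := by
    intro m
    induction m with
    | zero => rfl
    | succ m ih =>
      rw [upWord_succ, upWord_succ, ih]
      obtain ⟨k, hk⟩ := Nat.exists_eq_add_of_le (show H m + N ≤ M + 1 by
        have := hHle m
        omega)
      rw [hk, rowList_stable (n := H m + N), rowList_shiftBy]
      intro c hc
      by_contra hn
      have := hcell _ _ hn
      omega
  have h5 : rowList g (M + 1) = (upWord t N N).reverse := by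
    rw [← h4, hu, upWord_columnTab hρ (fun c hc => (hcol c hc).1), ← h3, List.reverse_reverse]
  rwa [h5] at h2

/-- `w` is the row word of `t`. -/
def HasWord (t : ℕ → ℕ → Option ℤ) (w : List ℤ) : Prop :=
  ∃ N, (∀ r c, t r c ≠ none → c < N) ∧ upWord t N N = w

theorem PlaneTableau.slideEquiv_of_hasWord {t t' : ℕ → ℕ → Option ℤ} {w : List ℤ}
    (ht : PlaneTableau t) (ht' : PlaneTableau t') (h : HasWord t w) (h' : HasWord t' w) :
    SlideEquiv t t' := by
  obtain ⟨N, hN, hw⟩ := h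
  obtain ⟨N', hN', hw'⟩ := h'
  have h1 : upWord t (max N N') (max N N') = w := by
    rw [← hw]
    refine upWord_stable (fun r c hrc => ⟨?_, hN r c hrc⟩) (le_max_left _ _) (le_max_left _ _)
    have := ht.diag _ _ hrc
    have := hN r c hrc
    omega
  have h2 : upWord t' (max N N') (max N N') = w := by
    rw [← hw']
    refine upWord_stable (fun r c hrc => ⟨?_, hN' r c hrc⟩) (le_max_right _ _) (le_max_right _ _)
    have := ht'.diag _ _ hrc
    have := hN' r c hrc
    omega
  have h3 := ht.slideEquiv_antiTab (N := max N N') fun r c hrc => by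
    have := hN r c hrc
    omega
  have h4 := ht'.slideEquiv_antiTab (N := max N N') fun r c hrc => by
    have := hN' r c hrc
    omega
  rw [h1] at h3
  rw [h2] at h4
  exact h3.trans h4.symm

theorem exists_planeTableau_hasWord (w : List ℤ) : ∃ t, PlaneTableau t ∧ HasWord t w := by
  have h : ∀ r, w.reverse[r]? ≠ none → r < w.length := by
    intro r hr
    by_contra hn
    exact hr (List.getElem?_eq_none (by simpa using hn))
  refine ⟨antiTab (fun r => w.reverse[r]?) (2 * w.length), planeTableau_antiTab fun r hr => ?_,
    2 * w.length + 1, fun r c hrc => ?_, ?_⟩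
  · have := h r hr
    omega
  · have := (antiTab_ne_none hrc).1
    omega
  · rw [upWord_antiTab _ le_rfl, rowList_getElem? _ (by simp; omega), List.reverse_reverse]

/-! ### Tableaux with a two by two block -/

/-- The entries `p, q` in row `k` and `r, s` in row `k + 1` of columns `l` and `l + 1`, together
with entries along the antidiagonal through the middle of this block. -/
def blockTab (g : ℕ → Option ℤ) (k l : ℕ) (p q r s : Option ℤ) (i j : ℕ) : Option ℤ :=
  if i = k then (if j = l then p else if j = l + 1 then q else none)
  else if i = k + 1 then (if j = l then r else if j = l + 1 then s else none)
  else if i + j = k + l + 1 then g i else none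

/-- The set of boxes of a block satisfying given propositions. -/
def blockSet (k l : ℕ) (p q r s : Prop) (i j : ℕ) : Prop :=
  i = k ∧ j = l ∧ p ∨ i = k ∧ j = l + 1 ∧ q ∨ i = k + 1 ∧ j = l ∧ r ∨ i = k + 1 ∧ j = l + 1 ∧ s

theorem blockTab_cases {g : ℕ → Option ℤ} {k l : ℕ} {p q r s : Option ℤ} {i j : ℕ} {x : ℤ}
    (h : blockTab g k l p q r s i j = some x) :
    i = k ∧ j = l ∧ p = some x ∨ i = k ∧ j = l + 1 ∧ q = some x ∨
      i = k + 1 ∧ j = l ∧ r = some x ∨ i = k + 1 ∧ j = l + 1 ∧ s = some x ∨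
      (i < k ∨ k + 1 < i) ∧ i + j = k + l + 1 ∧ g i = some x := by
  simp only [blockTab] at h
  grind (splits := 20)

theorem blockTab_p (g : ℕ → Option ℤ) (k l : ℕ) (p q r s : Option ℤ) :
    blockTab g k l p q r s k l = p := by simp [blockTab]

theorem blockTab_q (g : ℕ → Option ℤ) (k l : ℕ) (p q r s : Option ℤ) :
    blockTab g k l p q r s k (l + 1) = q := by simp [blockTab]

theorem blockTab_r (g : ℕ → Option ℤ) (k l : ℕ) (p q r s : Option ℤ) :
    blockTab g k l p q r s (k + 1) l = r := by simp [blockTab]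

theorem blockTab_s (g : ℕ → Option ℤ) (k l : ℕ) (p q r s : Option ℤ) :
    blockTab g k l p q r s (k + 1) (l + 1) = s := by simp [blockTab]

theorem blockTab_outer (g : ℕ → Option ℤ) {k l : ℕ} (p q r s : Option ℤ) {i j : ℕ}
    (hi : i < k ∨ k + 1 < i) (hij : i + j = k + l + 1) : blockTab g k l p q r s i j = g i := by
  simp [blockTab, show i ≠ k by omega, show i ≠ k + 1 by omega, hij]

/-- A slide within a block. -/
structure BlockData (k l : ℕ) (p q r s p' q' r' s' : Option ℤ) (dp dq dr ds : Prop) : Prop where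
  le : k ≤ l
  diag : k = l → r = none ∧ ¬ dr
  inc : ∀ x y, (p = some x ∧ (q = some y ∨ r = some y ∨ s = some y)) ∨
    ((q = some x ∨ r = some x) ∧ s = some y) → x < y
  conv : p ≠ none ∨ dp → s ≠ none ∨ ds → (q ≠ none ∨ dq) ∧ (k < l → r ≠ none ∨ dr)
  minimal_q : dq → q = none → p = none ∧ ¬ dp
  minimal_r : dr → r = none → p = none ∧ ¬ dp
  minimal_s : ds → s = none → p = none ∧ ¬ dp ∧ q = none ∧ ¬ dq ∧ r = none ∧ ¬ dr
  stay_p : ¬ dp → p' = p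
  stay_q : ¬ dq → q' = q
  stay_r : ¬ dr → r' = r
  stay_s : ¬ ds → s' = s
  vacate_p : dp → p = none
  vacate_q : ∀ v, dq → q = some v → dp ∧ p' = some v
  vacate_r : ∀ v, dr → r = some v → dp ∧ p' = some v
  vacate_s : ∀ v, ds → s = some v → dr ∧ r' = some v ∨ dq ∧ q' = some v
  fill_p : ∀ v, dp → p' = some v → q = some v ∨ r = some v
  fill_q : ∀ v, dq → q' = some v → s = some v
  fill_r : ∀ v, dr → r' = some v → s = some v
  fill_s : ds → s' = none
  next_p : ∀ v, dp → (∀ x, p' = some x → v ≤ x) →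
    (q = some v → p' = some v ∧ dq) ∧ (r = some v → p' = some v ∧ dr)
  next_q : ∀ v, dq → (∀ x, q' = some x → v ≤ x) → s = some v → q' = some v ∧ ds
  next_r : ∀ v, dr → (∀ x, r' = some x → v ≤ x) → s = some v → r' = some v ∧ ds

theorem BlockData.planeData {g : ℕ → Option ℤ} {k l : ℕ} {p q r s p' q' r' s' : Option ℤ}
    {dp dq dr ds : Prop} (h : BlockData k l p q r s p' q' r' s' dp dq dr ds)
    (hg : ∀ i, g i ≠ none → i < k ∨ k + 1 < i → 2 * i ≤ k + l + 1) :
    PlaneData (blockTab g k l p q r s) (blockTab g k l p' q' r' s') (blockSet k l dp dq dr ds) := by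
  have hle := h.le
  have hocc : ∀ i j, blockTab g k l p q r s i j ≠ none ∨ blockSet k l dp dq dr ds i j ↔
      blockSet k l (p ≠ none ∨ dp) (q ≠ none ∨ dq) (r ≠ none ∨ dr) (s ≠ none ∨ ds) i j ∨
        (i < k ∨ k + 1 < i) ∧ i + j = k + l + 1 ∧ g i ≠ none := by
    intro i j
    simp only [blockTab, blockSet]
    grind
  constructor
  · intro i j hij
    rw [hocc] at hij
    rcases hij with ((h1 | h1 | h1 | h1) | h1)
    · omega
    · omega
    · have := h.diag
      by_cases h2 : k = l
      · obtain ⟨h3, h4⟩ := this h2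
        rcases h1.2.2 with h5 | h5
        · exact absurd h3 h5
        · exact absurd h5 h4
      · omega
    · omega
    · have := hg i h1.2.2 h1.1
      omega
  · refine ⟨k + l + 2, fun i j hij => ?_⟩
    rw [hocc] at hij
    rcases hij with ((h1 | h1 | h1 | h1) | h1) <;> omega
  · intro i j i' j' x x' h1 h2 h3 h4 h5
    have := h.inc x x'
    rcases blockTab_cases h1 with h1 | h1 | h1 | h1 | h1 <;>
    rcases blockTab_cases h2 with h2 | h2 | h2 | h2 | h2 <;>
    first
    | omega
    | exact h.inc x x' (by simp [h1, h2])
  · intro i j i' j' i'' j'' h1 h2 h3 h4 h5 h6 h7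
    rw [hocc] at h1 h2 ⊢
    have hc := h.conv
    by_cases he : i = i' ∧ j = j'
    · rwa [← he.1, ← he.2]
    by_cases he' : i' = i'' ∧ j' = j''
    · rwa [he'.1, he'.2]
    left
    rcases h1 with ((h1 | h1 | h1 | h1) | h1) <;>
    rcases h2 with ((h2 | h2 | h2 | h2) | h2) <;>
    first
    | omega
    | skip
    obtain ⟨h8, h9⟩ := hc h1.2.2 h2.2.2
    by_cases h10 : i' = k
    · exact Or.inr (Or.inl ⟨h10, by omega, h8⟩)
    · exact Or.inr (Or.inr (Or.inl ⟨by omega, by omega, h9 (by omega)⟩))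
  · intro i j i' j' h1 h2 h3 h4 h5
    suffices h6 : ¬ (blockTab g k l p q r s i' j' ≠ none ∨ blockSet k l dp dq dr ds i' j') by
      rwa [not_or, not_not] at h6
    rw [hocc]
    rcases h1 with h1 | h1 | h1 | h1
    · obtain ⟨rfl, rfl, h1⟩ := h1
      simp only [blockSet]
      omega
    · obtain ⟨rfl, rfl, h1⟩ := h1
      rw [blockTab_q] at h2
      have := h.minimal_q h1 h2
      simp only [blockSet]
      grind
    · obtain ⟨rfl, rfl, h1⟩ := h1
      rw [blockTab_r] at h2
      have := h.minimal_r h1 h2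
      simp only [blockSet]
      grind
    · obtain ⟨rfl, rfl, h1⟩ := h1
      rw [blockTab_s] at h2
      have := h.minimal_s h1 h2
      simp only [blockSet]
      grind
  · intro i j h1
    have := h.stay_p
    have := h.stay_q
    have := h.stay_r
    have := h.stay_s
    simp only [blockSet] at h1
    simp only [blockTab]
    grind
  · intro i j v h1 h2
    rcases h1 with ⟨rfl, rfl, h1⟩ | ⟨rfl, rfl, h1⟩ | ⟨rfl, rfl, h1⟩ | ⟨rfl, rfl, h1⟩
    · rw [blockTab_p, h.vacate_p h1] at h2
      simp at h2
    · rw [blockTab_q] at h2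
      obtain ⟨h3, h4⟩ := h.vacate_q v h1 h2
      exact Or.inl ⟨_, rfl, by simp [blockSet, h3], by rwa [blockTab_p]⟩
    · rw [blockTab_r] at h2
      obtain ⟨h3, h4⟩ := h.vacate_r v h1 h2
      exact Or.inr ⟨_, rfl, by simp [blockSet, h3], by rwa [blockTab_p]⟩
    · rw [blockTab_s] at h2
      rcases h.vacate_s v h1 h2 with ⟨h3, h4⟩ | ⟨h3, h4⟩
      · exact Or.inl ⟨_, rfl, by simp [blockSet, h3], by rwa [blockTab_r]⟩
      · exact Or.inr ⟨_, rfl, by simp [blockSet, h3], by rwa [blockTab_q]⟩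
  · intro i j v h1 h2
    rcases h1 with ⟨rfl, rfl, h1⟩ | ⟨rfl, rfl, h1⟩ | ⟨rfl, rfl, h1⟩ | ⟨rfl, rfl, h1⟩
    · rw [blockTab_p] at h2
      rw [blockTab_q, blockTab_r]
      exact h.fill_p v h1 h2
    · rw [blockTab_q] at h2
      rw [blockTab_s]
      exact Or.inr (h.fill_q v h1 h2)
    · rw [blockTab_r] at h2
      rw [blockTab_s]
      exact Or.inl (h.fill_r v h1 h2)
    · rw [blockTab_s, h.fill_s h1] at h2
      simp at h2
  · intro i j i' j' v h1 h2 h3 h4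
    rcases h1 with ⟨rfl, rfl, h1⟩ | ⟨rfl, rfl, h1⟩ | ⟨rfl, rfl, h1⟩ | ⟨rfl, rfl, h1⟩
    · rw [blockTab_p] at h4 ⊢
      obtain ⟨h5, h6⟩ := h.next_p v h1 h4
      rcases h2 with ⟨rfl, rfl⟩ | ⟨rfl, rfl⟩
      · rw [blockTab_q] at h3
        simpa [blockSet] using h5 h3
      · rw [blockTab_r] at h3
        simpa [blockSet] using h6 h3
    · rw [blockTab_q] at h4 ⊢
      rcases h2 with ⟨rfl, rfl⟩ | ⟨rfl, rfl⟩
      · exfalso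
        rcases blockTab_cases h3 with h5 | h5 | h5 | h5 | h5 <;> omega
      · rw [blockTab_s] at h3
        simpa [blockSet] using h.next_q v h1 h4 h3
    · rw [blockTab_r] at h4 ⊢
      rcases h2 with ⟨rfl, rfl⟩ | ⟨rfl, rfl⟩
      · rw [blockTab_s] at h3
        simpa [blockSet] using h.next_r v h1 h4 h3
      · exfalso
        rcases blockTab_cases h3 with h5 | h5 | h5 | h5 | h5 <;> omega
    · exfalso
      rcases blockTab_cases h3 with h5 | h5 | h5 | h5 | h5 <;> omega

/-- The letters of `v` and `u` placed above and below a block. -/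
def outerWord (u v : List ℤ) (i : ℕ) : Option ℤ :=
  if i < v.length then v.reverse[i]? else u.reverse[i - (v.length + 2)]?

theorem outerWord_lt {u v : List ℤ} {i : ℕ} (h : outerWord u v i ≠ none)
    (hi : v.length + 1 < i) : i < v.length + 2 + u.length := by
  by_contra hn
  rw [outerWord, if_neg (by omega), List.getElem?_eq_none (by simp; omega)] at h
  exact h rfl

theorem rowList_eq_pair {f : ℕ → Option ℤ} {c n : ℕ} (hc : c + 1 < n)
    (h : ∀ c', c' ≠ c → c' ≠ c + 1 → f c' = none) :
    rowList f n = (f c).toList ++ (f (c + 1)).toList := by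
  obtain ⟨k, rfl⟩ := Nat.exists_eq_add_of_le (show c + 1 + 1 ≤ n by omega)
  rw [rowList_stable fun c' h1 => h c' (by omega) (by omega), rowList_succ, rowList_succ,
    rowList_eq_nil.2 fun c' hc' => h c' (by omega) (by omega), List.nil_append]

theorem rowList_blockTab (g : ℕ → Option ℤ) {k l : ℕ} (p q r s : Option ℤ) {i : ℕ}
    (hi : i < k ∨ k + 1 < i) (hi' : i ≤ k + l + 1) :
    rowList (blockTab g k l p q r s i) (k + l + 2) = (g i).toList := by
  rw [rowList_eq_toList (c := k + l + 1 - i) (by omega), blockTab_outer _ _ _ _ _ hi (by omega)]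
  intro c hc
  by_contra hn
  obtain ⟨x, hx⟩ := Option.ne_none_iff_exists'.1 hn
  rcases blockTab_cases hx with h | h | h | h | h <;> omega

theorem hasWord_blockTab {u v : List ℤ} {l : ℕ} (p q r s : Option ℤ) (hv : v.length ≤ l)
    (hu : u.length ≤ l) :
    HasWord (blockTab (outerWord u v) v.length l p q r s)
      (u ++ (r.toList ++ s.toList ++ (p.toList ++ q.toList)) ++ v) := by
  set k := v.length with hk
  set t := blockTab (outerWord u v) k l p q r s with ht
  refine ⟨k + l + 2, fun i j hij => ?_, ?_⟩
  · obtain ⟨x, hx⟩ := Option.ne_none_iff_exists'.1 hij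
    rcases blockTab_cases hx with h | h | h | h | h <;> omega
  · have h1 : ∀ m, m ≤ k → upWord t m (k + l + 2) =
        (rowList (fun i => v.reverse[i]?) m).reverse := by
      intro m
      induction m with
      | zero => simp [upWord, rowList_zero]
      | succ m ih =>
        intro hm
        rw [upWord_succ, ih (by omega), ht, rowList_blockTab _ _ _ _ _ (by omega) (by omega),
          rowList_succ, List.reverse_append, outerWord, if_pos (by omega)]
        cases v.reverse[m]? <;> rfl
    have h2 : upWord t k (k + l + 2) = v := by
      rw [h1 k le_rfl, rowList_getElem? _ (by simp [hk]), List.reverse_reverse]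
    have h3 : upWord t (k + 2) (k + l + 2) =
        r.toList ++ s.toList ++ (p.toList ++ q.toList) ++ v := by
      rw [upWord_succ, upWord_succ, h2, ht, rowList_eq_pair (c := l) (by omega),
        rowList_eq_pair (c := l) (by omega), blockTab_p, blockTab_q, blockTab_r, blockTab_s]
      · simp
      · intro c h4 h5
        simp [blockTab, h4, h5]
      · intro c h4 h5
        simp [blockTab, h4, h5]
    have h4 : ∀ m, m ≤ l → upWord t (k + 2 + m) (k + l + 2) =
        (rowList (fun i => u.reverse[i]?) m).reverse ++ upWord t (k + 2) (k + l + 2) := by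
      intro m
      induction m with
      | zero => simp [rowList_zero]
      | succ m ih =>
        intro hm
        rw [← add_assoc, upWord_succ, ih (by omega), ht,
          rowList_blockTab _ _ _ _ _ (by omega) (by omega), rowList_succ, List.reverse_append,
          outerWord, if_neg (by omega), show k + 2 + m - (v.length + 2) = m by omega]
        cases u.reverse[m]? <;> rfl
    rw [show k + l + 2 = k + 2 + l by omega] at h4 h3 ⊢
    rw [h4 l le_rfl, rowList_getElem? _ (by simpa using hu), h3, List.reverse_reverse]
    simp

theorem BlockData.slideEquiv {u v : List ℤ} {l : ℕ} {p q r s p' q' r' s' : Option ℤ}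
    {dp dq dr ds : Prop} (h : BlockData v.length l p q r s p' q' r' s' dp dq dr ds)
    (h' : BlockData v.length l p' q' r' s' p' q' r' s' False False False False)
    (hu : u = [] ∨ v.length + 2 * u.length + 1 ≤ l) {t t' : ℕ → ℕ → Option ℤ}
    (ht : PlaneTableau t) (ht' : PlaneTableau t')
    (hw : HasWord t (u ++ (r.toList ++ s.toList ++ (p.toList ++ q.toList)) ++ v))
    (hw' : HasWord t' (u ++ (r'.toList ++ s'.toList ++ (p'.toList ++ q'.toList)) ++ v)) :
    SlideEquiv t t' := by
  have hl : u.length ≤ l := by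
    rcases hu with rfl | hu
    · simp
    · omega
  have hg : ∀ i, outerWord u v i ≠ none → i < v.length ∨ v.length + 1 < i →
      2 * i ≤ v.length + l + 1 := by
    intro i h1 h2
    have h3 := h.le
    rcases h2 with h2 | h2
    · omega
    · have h4 := outerWord_lt h1 h2
      rcases hu with rfl | hu
      · simp at h4
        omega
      · omega
  have h1 := h.planeData hg
  have h2 := h'.planeData hg
  exact (ht.slideEquiv_of_hasWord h1.tableau hw (hasWord_blockTab p q r s h.le hl)).trans
    (h1.slideEquiv.trans
      (h2.tableau.slideEquiv_of_hasWord ht' (hasWord_blockTab p' q' r' s' h.le hl) hw'))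

theorem blockData_dup (k : ℕ) {l : ℕ} (hl : k < l) (a : ℤ) :
    BlockData k l none (some a) (some a) none (some a) none none none True True True False ∧
      BlockData k l (some a) none none none (some a) none none none False False False False := by
  constructor <;> constructor <;> grind

theorem blockData_aba (k : ℕ) {l : ℕ} (hl : k < l) {a b : ℤ} (h : a < b) :
    BlockData k l none (some a) (some a) (some b) (some a) (some b) (some b) none
        True True True True ∧
      BlockData k l (some a) (some b) (some b) none (some a) (some b) (some b) none
        False False False False := by
  constructor <;> constructor <;> grind

theorem blockData_bac (k : ℕ) {l : ℕ} (hl : k < l) {a b c : ℤ} (h1 : a < c) (h2 : c < b) :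
    BlockData k l none (some c) (some a) (some b) (some a) (some c) (some b) none
        True False True True ∧
      BlockData k l (some a) (some c) (some b) none (some a) (some c) (some b) none
        False False False False := by
  constructor <;> constructor <;> grind

theorem blockData_acb (k : ℕ) {l : ℕ} (hl : k < l) {a b c : ℤ} (h1 : b < a) (h2 : a < c) :
    BlockData k l none (some b) (some a) (some c) (some b) (some c) (some a) none
        True True False True ∧
      BlockData k l (some b) (some c) (some a) none (some b) (some c) (some a) none
        False False False False := by
  constructor <;> constructor <;> grind

theorem blockData_front (k : ℕ) {a b : ℤ} (h : a < b) :
    BlockData k k none (some a) none (some b) (some a) (some b) none none True True False True ∧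
      BlockData k k (some a) (some b) none none (some a) (some b) none none
        False False False False := by
  constructor <;> constructor <;> grind

theorem WKKnuthStep.slideEquiv {w w' : List ℤ} (h : WKKnuthStep w w') {t t' : ℕ → ℕ → Option ℤ}
    (ht : PlaneTableau t) (ht' : PlaneTableau t') (hw : HasWord t w) (hw' : HasWord t' w') :
    SlideEquiv t t' := by
  cases h with
  | dup u v a =>
    obtain ⟨h1, h2⟩ := blockData_dup v.length (l := v.length + 2 * u.length + 1) (by omega) a
    exact h1.slideEquiv h2 (Or.inr le_rfl) ht ht' hw hw'
  | aba u v a b =>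
    rcases lt_trichotomy a b with h | rfl | h
    · obtain ⟨h1, h2⟩ := blockData_aba v.length (l := v.length + 2 * u.length + 1) (by omega) h
      exact h1.slideEquiv h2 (Or.inr le_rfl) ht ht' hw hw'
    · exact ht.slideEquiv_of_hasWord ht' hw hw'
    · obtain ⟨h1, h2⟩ := blockData_aba v.length (l := v.length + 2 * u.length + 1) (by omega) h
      exact (h1.slideEquiv h2 (Or.inr le_rfl) ht' ht hw' hw).symm
  | acb u v a b c h3 h4 =>
    obtain ⟨h1, h2⟩ := blockData_acb v.length (l := v.length + 2 * u.length + 1) (by omega) h3 h4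
    exact (h1.slideEquiv h2 (Or.inr le_rfl) ht' ht hw' hw).symm
  | bac u v a b c h3 h4 =>
    obtain ⟨h1, h2⟩ := blockData_bac v.length (l := v.length + 2 * u.length + 1) (by omega) h3 h4
    exact h1.slideEquiv h2 (Or.inr le_rfl) ht ht' hw hw'
  | front v a b =>
    rcases lt_trichotomy a b with h | rfl | h
    · obtain ⟨h1, h2⟩ := blockData_front v.length h
      exact (h1.slideEquiv (u := []) h2 (Or.inl rfl) ht' ht hw' hw).symm
    · exact ht.slideEquiv_of_hasWord ht' hw hw'
    · obtain ⟨h1, h2⟩ := blockData_front v.length h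
      exact h1.slideEquiv (u := []) h2 (Or.inl rfl) ht ht' hw hw'

/-- Tableaux with weakly equivalent row words are related by slides. -/
theorem WKKnuth.slideEquiv {w w' : List ℤ} (h : WKKnuth w w') {t t' : ℕ → ℕ → Option ℤ}
    (ht : PlaneTableau t) (ht' : PlaneTableau t') (hw : HasWord t w) (hw' : HasWord t' w') :
    SlideEquiv t t' := by
  induction h generalizing t t' with
  | rel x y h => exact h.slideEquiv ht ht' hw hw'
  | refl x => exact ht.slideEquiv_of_hasWord ht' hw hw'
  | symm x y _ ih => exact (ih ht' ht hw' hw).symm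
  | trans x y z _ _ ih1 ih2 =>
    obtain ⟨s, hs, hs'⟩ := exists_planeTableau_hasWord y
    exact (ih1 ht hs hw hs').trans (ih2 hs ht' hs' hw')

theorem IncreasingSkewTableau.planeTableau {T : ShiftedBox → Option ℤ}
    (hT : IncreasingSkewTableau T) : PlaneTableau fun r c => extendToPlane T (r, c) := by
  obtain ⟨⟨lam, nu, ⟨h1, h2, h3⟩, hs⟩, hinc⟩ := hT
  have hmem : ∀ b, T b ≠ none ↔ b ∈ nu ∧ b ∉ lam := fun b => by
    have h4 : b ∈ shapeOf T ↔ b ∈ (nu : Set ShiftedBox) \ lam := by rw [hs]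
    simpa [shapeOf, Set.mem_ofPred_eq] using h4
  have hdiag : ∀ r c, extendToPlane T (r, c) ≠ none → r ≤ c := by
    intro r c h
    obtain ⟨x, hx⟩ := Option.ne_none_iff_exists'.1 h
    exact (extendToPlane_some hx).1
  refine ⟨hdiag, ?_, ?_, ?_⟩
  · refine ⟨nu.sup (fun b => b.1.2) + 1, fun r c h => ?_⟩
    have hrc := hdiag r c h
    rw [extendToPlane_of_le T hrc, hmem] at h
    have := Finset.le_sup (f := fun b : ShiftedBox => b.1.2) h.1
    simp only at this
    omega
  · intro r c r' c' x x' h4 h5 h6 h7 h8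
    obtain ⟨h9, h10⟩ := extendToPlane_some h4
    obtain ⟨h11, h12⟩ := extendToPlane_some h5
    exact hinc _ _ (shiftedBox_lt h6 h7 h8) _ _ h10 h12
  · intro r c r' c' r'' c'' h4 h5 h6 h7 h8 h9 h10
    have hrc := hdiag r c h4
    have hrc' := hdiag r'' c'' h5
    rw [extendToPlane_of_le T hrc, hmem] at h4
    rw [extendToPlane_of_le T hrc', hmem] at h5
    rw [extendToPlane_of_le T h10, hmem]
    refine ⟨h2 _ h5.1 _ ⟨h7, h9⟩, fun h11 => h4.2 (h1 _ h11 _ ⟨h6, h8⟩)⟩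

theorem ofPlane_extendToPlane (T : ShiftedBox → Option ℤ) :
    ofPlane (fun r c => extendToPlane T (r, c)) = T := by
  funext b
  exact extendToPlane_of_le T b.2

theorem BoundedBy.hasWord {T : ShiftedBox → Option ℤ} {m n : ℕ}
    (h : BoundedBy (extendToPlane T) m n) :
    HasWord (fun r c => extendToPlane T (r, c)) (rowWordB T m n) := by
  refine ⟨m + n + 1, fun r c hrc => ?_, ?_⟩
  · have := (h (r, c) hrc).2
    simp only at this
    omega
  · rw [rowWordB_eq]
    exact (Within.of_boundedBy h).shiftedWord_eq (by omega) (by omega)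

theorem weak_kknuth_iff_jdt_equiv_typeB
    (T T' : ShiftedBox → Option ℤ)
    (hT : IncreasingSkewTableau T) (hT' : IncreasingSkewTableau T')
    (rm cm rm' cm' : ℕ)
    (hb : BoundedBy (extendToPlane T) rm cm) (hb' : BoundedBy (extendToPlane T') rm' cm') :
    WKKnuth (rowWordB T rm cm) (rowWordB T' rm' cm') ↔ JdtEquiv T T' := by
  constructor
  · intro h
    have h1 := h.slideEquiv hT.planeTableau hT'.planeTableau hb.hasWord hb'.hasWord
    rw [SlideEquiv, ofPlane_extendToPlane, ofPlane_extendToPlane] at h1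
    exact (jdtEquiv_of_eqvGen h1).1
  · intro h
    obtain ⟨-, N, h1, h2, h3⟩ := h.weakWords hT
    have h4 := Within.of_boundedBy hb
    have h5 := Within.of_boundedBy hb'
    have h6 := h4.shiftedWord_eq (le_max_left _ N) (le_max_left _ N)
    have h7 := h1.shiftedWord_eq (le_max_right (rm + 1) _) (le_max_right (cm + 1) _)
    have h8 := h5.shiftedWord_eq (le_max_left _ N) (le_max_left _ N)
    have h9 := h2.shiftedWord_eq (le_max_right (rm' + 1) _) (le_max_right (cm' + 1) _)
    rwa [rowWordB_eq, rowWordB_eq, ← h6, h7, ← h8, h9]
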